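/- arXiv:1910.07795 — 6 statements merged into one kernel-verified Lean document; each statement's English description precedes it below -/
import Mathlib

section
/- Let a ∈ ℝ, let φ : (a,∞) → ℝ be C¹ with φ'(t) > 0 for all t, and let u₀ ∈ (a,∞). Let u be the maximal C² solution of the grim-reaper equation u''(x) = φ'(u(x))·(1 + u'(x)²) with u(0) = u₀ and u'(0) = 0. Then u is even (u(−x) = u(x) whenever defined) and its maximal interval of existence is exactly (−Λ_{u₀}, Λ_{u₀}), where Λ_{u₀} = ∫_{u₀}^{∞} dλ / √(e^{2(φ(λ) − φ(u₀))} − 1) ∈ (0, ∞] (a Lebesgue integral over (u₀,∞), possibly infinite). -/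
open Set Filter MeasureTheory
open scoped ENNReal Topology

/-- The half-length `Λ_{u₀} = ∫_{u₀}^∞ dλ / √(e^{2(φ(λ)-φ(u₀))} - 1) ∈ (0,∞]`
of the maximal interval of existence of the grim reaper through `u₀`. -/
noncomputable def Lam (φ : ℝ → ℝ) (u₀ : ℝ) : ℝ≥0∞ :=
  ∫⁻ t in Set.Ioi u₀, ENNReal.ofReal (1 / Real.sqrt (Real.exp (2 * (φ t - φ u₀)) - 1))

/-- The slope of the grim reaper as a function of the height. -/
noncomputable def rr (φ : ℝ → ℝ) (u₀ t : ℝ) : ℝ :=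
  Real.sqrt (Real.exp (2 * (φ t - φ u₀)) - 1)

lemma phi_lt (a : ℝ) (φ φ' : ℝ → ℝ)
    (hφ : ∀ t ∈ Ioi a, HasDerivAt φ (φ' t) t)
    (hφ'pos : ∀ t ∈ Ioi a, 0 < φ' t) : StrictMonoOn φ (Ioi a) := by
  apply strictMonoOn_of_deriv_pos (convex_Ioi a)
  · intro t ht
    exact (hφ t ht).continuousAt.continuousWithinAt
  · intro t ht
    rw [interior_Ioi] at ht
    rw [(hφ t ht).deriv]
    exact hφ'pos t ht

lemma exp_pos_aux (a : ℝ) (φ φ' : ℝ → ℝ)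
    (hφ : ∀ t ∈ Ioi a, HasDerivAt φ (φ' t) t)
    (hφ'pos : ∀ t ∈ Ioi a, 0 < φ' t) (u₀ : ℝ) (hu₀ : a < u₀) (t : ℝ) (ht : u₀ < t) :
    0 < Real.exp (2 * (φ t - φ u₀)) - 1 := by
  have h := phi_lt a φ φ' hφ hφ'pos hu₀ (hu₀.trans ht) ht
  have := Real.one_lt_exp_iff.2 (show 0 < 2 * (φ t - φ u₀) by linarith)
  linarith

lemma rr_pos (a : ℝ) (φ φ' : ℝ → ℝ)
    (hφ : ∀ t ∈ Ioi a, HasDerivAt φ (φ' t) t)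
    (hφ'pos : ∀ t ∈ Ioi a, 0 < φ' t) (u₀ : ℝ) (hu₀ : a < u₀) (t : ℝ) (ht : u₀ < t) :
    0 < rr φ u₀ t := Real.sqrt_pos.2 (exp_pos_aux a φ φ' hφ hφ'pos u₀ hu₀ t ht)

lemma rr_sq (a : ℝ) (φ φ' : ℝ → ℝ)
    (hφ : ∀ t ∈ Ioi a, HasDerivAt φ (φ' t) t)
    (hφ'pos : ∀ t ∈ Ioi a, 0 < φ' t) (u₀ : ℝ) (hu₀ : a < u₀) (t : ℝ) (ht : u₀ < t) :
    1 + rr φ u₀ t ^ 2 = Real.exp (2 * (φ t - φ u₀)) := by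
  rw [rr, Real.sq_sqrt (exp_pos_aux a φ φ' hφ hφ'pos u₀ hu₀ t ht).le]
  ring

lemma rr_cont (a : ℝ) (φ φ' : ℝ → ℝ)
    (hφ : ∀ t ∈ Ioi a, HasDerivAt φ (φ' t) t) (u₀ t : ℝ) (ht : a < t) :
    ContinuousAt (rr φ u₀) t := by
  have := (hφ t ht).continuousAt
  unfold rr
  fun_prop

lemma rr_deriv (a : ℝ) (φ φ' : ℝ → ℝ)
    (hφ : ∀ t ∈ Ioi a, HasDerivAt φ (φ' t) t)
    (hφ'pos : ∀ t ∈ Ioi a, 0 < φ' t) (u₀ : ℝ) (hu₀ : a < u₀) (t : ℝ) (ht : u₀ < t) :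
    HasDerivAt (rr φ u₀) (φ' t * Real.exp (2 * (φ t - φ u₀)) / rr φ u₀ t) t := by
  have h1 := ((((hφ t (hu₀.trans ht)).sub_const (φ u₀)).const_mul 2).exp.sub_const 1).sqrt
    (exp_pos_aux a φ φ' hφ hφ'pos u₀ hu₀ t ht).ne'
  have h2 := rr_pos a φ φ' hφ hφ'pos u₀ hu₀ t ht
  unfold rr at h2 ⊢
  convert h1 using 1
  field_simp

lemma int_aux (a : ℝ) (φ φ' : ℝ → ℝ)
    (hφ : ∀ t ∈ Ioi a, HasDerivAt φ (φ' t) t)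
    (hφ'c : ContinuousOn φ' (Ioi a))
    (hφ'pos : ∀ t ∈ Ioi a, 0 < φ' t) (u₀ : ℝ) (hu₀ : a < u₀) (t : ℝ) (ht : u₀ ≤ t) :
    IntervalIntegrable (fun s => 1 / rr φ u₀ s) volume u₀ t := by
  have hsub : uIcc u₀ t ⊆ Ioi a := by
    rw [uIcc_of_le ht]; intro s hs; exact hu₀.trans_le hs.1
  have h1 : IntervalIntegrable
      (fun s => φ' s * Real.exp (2 * (φ s - φ u₀)) / rr φ u₀ s) volume u₀ t := by
    apply intervalIntegral.intervalIntegrable_deriv_of_nonneg (g := rr φ u₀)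
    · intro s hs
      exact (rr_cont a φ φ' hφ u₀ s (hsub hs)).continuousWithinAt
    · intro s hs
      rw [min_eq_left ht, max_eq_right ht] at hs
      exact rr_deriv a φ φ' hφ hφ'pos u₀ hu₀ s hs.1
    · intro s hs
      rw [min_eq_left ht, max_eq_right ht] at hs
      have := rr_pos a φ φ' hφ hφ'pos u₀ hu₀ s hs.1
      have := hφ'pos s (hu₀.trans hs.1)
      positivity
  have hφc : ContinuousOn φ (uIcc u₀ t) := fun s hs =>
    (hφ s (hsub hs)).continuousAt.continuousWithinAt
  have h2 : ContinuousOn (fun s => (φ' s * Real.exp (2 * (φ s - φ u₀)))⁻¹) (uIcc u₀ t) := by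
    apply ContinuousOn.inv₀
    · apply (hφ'c.mono hsub).mul
      fun_prop
    · intro s hs
      have := hφ'pos s (hsub hs)
      positivity
  refine (h1.mul_continuousOn h2).congr ?_
  intro s hs
  rw [uIoc_of_le ht] at hs
  have := rr_pos a φ φ' hφ hφ'pos u₀ hu₀ s hs.1
  have := hφ'pos s (hu₀.trans hs.1)
  simp only
  field_simp

lemma exists_F (a : ℝ) (φ φ' : ℝ → ℝ)
    (hφ : ∀ t ∈ Ioi a, HasDerivAt φ (φ' t) t)
    (hφ'c : ContinuousOn φ' (Ioi a))
    (hφ'pos : ∀ t ∈ Ioi a, 0 < φ' t) (u₀ : ℝ) (hu₀ : a < u₀) :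
    ∃ F : ℝ → ℝ, StrictMono F ∧ Continuous F ∧ F u₀ = 0 ∧
      (∀ t, u₀ < t → HasDerivAt F (1 / rr φ u₀ t) t) ∧
      (∀ t, u₀ ≤ t → ∫⁻ s in Ioc u₀ t, ENNReal.ofReal (1 / rr φ u₀ s)
        = ENNReal.ofReal (F t)) := by
  classical
  set g : ℝ → ℝ := fun s => if s ≤ u₀ then 1 else 1 / rr φ u₀ s with hg
  have hgpos : ∀ s, 0 < g s := by
    intro s
    simp only [hg]
    split_ifs with h
    · norm_num
    · have := rr_pos a φ φ' hφ hφ'pos u₀ hu₀ s (not_le.1 h)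
      positivity
  have hI0 : ∀ t, IntervalIntegrable g volume u₀ t := by
    intro t
    rcases le_total u₀ t with h | h
    · refine (int_aux a φ φ' hφ hφ'c hφ'pos u₀ hu₀ t h).congr ?_
      intro s hs
      rw [uIoc_of_le h] at hs
      simp [hg, not_le.2 hs.1]
    · refine (intervalIntegrable_const (c := (1 : ℝ))).congr ?_
      intro s hs
      rw [uIoc_of_ge h] at hs
      simp [hg, hs.2]
  have hI : ∀ s t, IntervalIntegrable g volume s t := fun s t => (hI0 s).symm.trans (hI0 t)
  refine ⟨fun t => ∫ s in u₀..t, g s, ?_, intervalIntegral.continuous_primitive hI u₀,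
    by simp, ?_, ?_⟩
  · intro s t hst
    have h1 := intervalIntegral.intervalIntegral_pos_of_pos (hI s t) hgpos hst
    have h2 := intervalIntegral.integral_add_adjacent_intervals (hI u₀ s) (hI s t)
    simp only
    linarith
  · intro t ht
    have hc : ∀ s ∈ Ioi u₀, ContinuousAt g s := by
      intro s hs
      have h1 : ContinuousAt (fun s => 1 / rr φ u₀ s) s :=
        continuousAt_const.div (rr_cont a φ φ' hφ u₀ s (hu₀.trans hs))
          (rr_pos a φ φ' hφ hφ'pos u₀ hu₀ s hs).ne'
      refine h1.congr ?_
      filter_upwards [Ioi_mem_nhds hs] with y hy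
      simp [hg, not_le.2 (mem_Ioi.1 hy)]
    have h := intervalIntegral.integral_hasDerivAt_right (hI u₀ t)
      (ContinuousAt.stronglyMeasurableAtFilter isOpen_Ioi hc t ht) (hc t ht)
    simpa [hg, not_le.2 ht] using h
  · intro t ht
    simp only
    rw [intervalIntegral.integral_of_le ht,
      ofReal_integral_eq_lintegral_ofReal ((intervalIntegrable_iff_integrableOn_Ioc_of_le ht).1 (hI u₀ t))
        (Eventually.of_forall fun s => (hgpos s).le)]
    apply setLIntegral_congr_fun measurableSet_Ioc
    intro s hs
    simp [hg, not_le.2 hs.1]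

lemma exists_w (F : ℝ → ℝ) (hF : StrictMono F) (hFc : Continuous F) :
    ∃ w : ℝ → ℝ, (∀ t, w (F t) = t) ∧ (∀ t, ContinuousAt w (F t)) ∧
      (∀ t, ∀ᶠ y in 𝓝 (F t), F (w y) = y) := by
  have hw : ∀ t, Function.invFun F (F t) = t := Function.leftInverse_invFun hF.injective
  have hr : ∀ t, range F ∈ 𝓝 (F t) := by
    intro t
    refine mem_of_superset (Ioo_mem_nhds (hF (sub_one_lt t)) (hF (lt_add_one t))) ?_
    intro y hy
    obtain ⟨s, -, hs⟩ := intermediate_value_Ioo (by linarith) hFc.continuousOn hy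
    exact ⟨s, hs⟩
  refine ⟨Function.invFun F, hw, ?_, ?_⟩
  · intro t
    apply StrictMonoOn.continuousAt_of_image_mem_nhds (s := range F) _ (hr t)
    · have : Function.invFun F '' range F = univ := by
        ext s
        simp only [mem_univ, iff_true]
        exact ⟨F s, ⟨s, rfl⟩, hw s⟩
      rw [this]; exact univ_mem
    · rintro _ ⟨s, rfl⟩ _ ⟨t, rfl⟩ h
      rw [hw, hw]
      exact hF.lt_iff_lt.1 h
  · intro t
    filter_upwards [hr t]
    rintro _ ⟨s, rfl⟩
    rw [hw]

lemma deriv_ext {f g : ℝ → ℝ} {x : ℝ} {s : Set ℝ} (hs : IsOpen s) (hx : x ∈ s)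
    (hd : ∀ y ∈ s, y ≠ x → HasDerivAt f (g y) y) (hf : ContinuousAt f x)
    (hg : ContinuousAt g x) : HasDerivAt f (g x) x := by
  have A : HasDerivWithinAt f (g x) (Ici x) x := by
    apply hasDerivWithinAt_Ici_of_tendsto_deriv (s := s ∩ Ioi x)
    · exact fun y hy => (hd y hy.1 (ne_of_gt hy.2)).differentiableAt.differentiableWithinAt
    · exact hf.continuousWithinAt
    · exact inter_mem (mem_nhdsWithin_of_mem_nhds (hs.mem_nhds hx)) self_mem_nhdsWithin
    · refine (hg.continuousWithinAt (s := Ioi x)).tendsto.congr' ?_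
      filter_upwards [mem_nhdsWithin_of_mem_nhds (hs.mem_nhds hx), self_mem_nhdsWithin] with y h1 h2
      exact (hd y h1 (ne_of_gt h2)).deriv.symm
  have B : HasDerivWithinAt f (g x) (Iic x) x := by
    apply hasDerivWithinAt_Iic_of_tendsto_deriv (s := s ∩ Iio x)
    · exact fun y hy => (hd y hy.1 (ne_of_lt hy.2)).differentiableAt.differentiableWithinAt
    · exact hf.continuousWithinAt
    · exact inter_mem (mem_nhdsWithin_of_mem_nhds (hs.mem_nhds hx)) self_mem_nhdsWithin
    · refine (hg.continuousWithinAt (s := Iio x)).tendsto.congr' ?_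
      filter_upwards [mem_nhdsWithin_of_mem_nhds (hs.mem_nhds hx), self_mem_nhdsWithin] with y h1 h2
      exact (hd y h1 (ne_of_lt h2)).deriv.symm
  simpa using B.union A

lemma maximal_aux (a : ℝ) (φ φ' : ℝ → ℝ)
    (hφ : ∀ t ∈ Ioi a, HasDerivAt φ (φ' t) t)
    (hφ'pos : ∀ t ∈ Ioi a, 0 < φ' t)
    (u₀ : ℝ) (hu₀ : a < u₀) (y : ℝ) (hy : 0 < y) (v v' : ℝ → ℝ)
    (hva : ∀ x ∈ Icc 0 y, v x ∈ Ioi a) (hv0 : v 0 = u₀) (hv'0 : v' 0 = 0)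
    (hv : ∀ x ∈ Icc 0 y, HasDerivAt v (v' x) x)
    (hv' : ∀ x ∈ Icc 0 y, HasDerivAt v' (φ' (v x) * (1 + v' x ^ 2)) x) :
    ENNReal.ofReal y ≤ Lam φ u₀ := by
  have hm' : StrictMonoOn v' (Icc 0 y) := by
    apply strictMonoOn_of_deriv_pos (convex_Icc _ _)
    · exact fun x hx => (hv' x hx).continuousAt.continuousWithinAt
    · intro x hx
      have hx' := interior_subset hx
      rw [(hv' x hx').deriv]
      have := hφ'pos _ (hva x hx')
      positivity
  have hpos : ∀ x ∈ Ioo 0 y, 0 < v' x := by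
    intro x hx
    rw [← hv'0]
    exact hm' ⟨le_rfl, hy.le⟩ ⟨hx.1.le, hx.2.le⟩ hx.1
  have hm : StrictMonoOn v (Icc 0 y) := by
    apply strictMonoOn_of_deriv_pos (convex_Icc _ _)
    · exact fun x hx => (hv x hx).continuousAt.continuousWithinAt
    · intro x hx
      rw [(hv x (interior_subset hx)).deriv]
      rw [interior_Icc] at hx
      exact hpos x hx
  have hE : ∀ x ∈ Icc 0 y, (1 + v' x ^ 2) * Real.exp (-2 * (φ (v x) - φ u₀)) = 1 := by
    have hder : ∀ x ∈ Icc 0 y,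
        HasDerivAt (fun x => (1 + v' x ^ 2) * Real.exp (-2 * (φ (v x) - φ u₀))) 0 x := by
      intro x hx
      have h1 := ((hv' x hx).pow 2).const_add 1
      have h2 := ((((hφ _ (hva x hx)).comp x (hv x hx)).sub_const (φ u₀)).const_mul (-2)).exp
      refine (h1.mul h2).congr_deriv ?_
      simp
      ring
    intro x hx
    rw [constant_of_has_deriv_right_zero (fun x hx => (hder x hx).continuousAt.continuousWithinAt)
      (fun x hx => (hder x ⟨hx.1, hx.2.le⟩).hasDerivWithinAt) x hx]
    simp [hv0, hv'0]
  have hr : ∀ x ∈ Ioo 0 y, rr φ u₀ (v x) = v' x := by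
    intro x hx
    have h := hE x ⟨hx.1.le, hx.2.le⟩
    have h3 : Real.exp (2 * (φ (v x) - φ u₀)) = 1 + v' x ^ 2 := by
      have : Real.exp (-2 * (φ (v x) - φ u₀)) * Real.exp (2 * (φ (v x) - φ u₀)) = 1 := by
        rw [← Real.exp_add]; simp
      calc _ = ((1 + v' x ^ 2) * Real.exp (-2 * (φ (v x) - φ u₀))) *
            Real.exp (2 * (φ (v x) - φ u₀)) := by rw [h, one_mul]
        _ = _ := by rw [mul_assoc, this, mul_one]
    rw [rr, h3, add_sub_cancel_left, Real.sqrt_sq (hpos x hx).le]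
  have hcv := lintegral_image_eq_lintegral_deriv_mul_of_monotoneOn (s := Ioo 0 y) (f := v)
    (f' := v') measurableSet_Ioo (fun x hx => (hv x ⟨hx.1.le, hx.2.le⟩).hasDerivWithinAt)
    (hm.monotoneOn.mono Ioo_subset_Icc_self) (fun t => ENNReal.ofReal (1 / rr φ u₀ t))
  have h1 : ∫⁻ x in Ioo 0 y, ENNReal.ofReal (v' x) * ENNReal.ofReal (1 / rr φ u₀ (v x))
      = ENNReal.ofReal y := by
    rw [setLIntegral_congr_fun (g := fun _ => 1) measurableSet_Ioo]
    · simp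
    · intro x hx
      simp only
      have := hpos x hx
      rw [hr x hx, ← ENNReal.ofReal_mul this.le, mul_one_div_cancel this.ne', ENNReal.ofReal_one]
  rw [← h1, ← hcv]
  apply lintegral_mono_set
  rintro _ ⟨x, hx, rfl⟩
  rw [← hv0]
  exact hm ⟨le_rfl, hy.le⟩ ⟨hx.1.le, hx.2.le⟩ hx.1

lemma maximal_aux2 (a : ℝ) (φ φ' : ℝ → ℝ)
    (hφ : ∀ t ∈ Ioi a, HasDerivAt φ (φ' t) t)
    (hφ'pos : ∀ t ∈ Ioi a, 0 < φ' t)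
    (u₀ : ℝ) (hu₀ : a < u₀) (I' : Set ℝ) (v v' : ℝ → ℝ) (hI : IsOpen I') (hc : Convex ℝ I')
    (h0 : (0 : ℝ) ∈ I')
    (hva : ∀ x ∈ I', v x ∈ Ioi a) (hv0 : v 0 = u₀) (hv'0 : v' 0 = 0)
    (hv : ∀ x ∈ I', HasDerivAt v (v' x) x)
    (hv' : ∀ x ∈ I', HasDerivAt v' (φ' (v x) * (1 + v' x ^ 2)) x)
    (x : ℝ) (hx : x ∈ I') (hx0 : 0 ≤ x) : ENNReal.ofReal x < Lam φ u₀ := by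
  obtain ⟨ε, hε, hb⟩ := Metric.isOpen_iff.1 hI x hx
  have hy : x + ε / 2 ∈ I' := hb (by simp [Real.dist_eq, abs_of_pos, hε])
  have hsub : Icc 0 (x + ε / 2) ⊆ I' := hc.ordConnected.out h0 hy
  refine lt_of_lt_of_le ?_ (maximal_aux a φ φ' hφ hφ'pos u₀ hu₀ (x + ε / 2) (by linarith) v v'
    (fun z hz => hva z (hsub hz)) hv0 hv'0 (fun z hz => hv z (hsub hz))
    (fun z hz => hv' z (hsub hz)))
  exact (ENNReal.ofReal_lt_ofReal_iff (by linarith)).2 (by linarith)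

lemma maximal_aux3 (a : ℝ) (φ φ' : ℝ → ℝ)
    (hφ : ∀ t ∈ Ioi a, HasDerivAt φ (φ' t) t)
    (hφ'pos : ∀ t ∈ Ioi a, 0 < φ' t)
    (u₀ : ℝ) (hu₀ : a < u₀) (I' : Set ℝ) (v v' : ℝ → ℝ) (hI : IsOpen I') (hc : Convex ℝ I')
    (h0 : (0 : ℝ) ∈ I')
    (hva : ∀ x ∈ I', v x ∈ Ioi a) (hv0 : v 0 = u₀) (hv'0 : v' 0 = 0)
    (hv : ∀ x ∈ I', HasDerivAt v (v' x) x)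
    (hv' : ∀ x ∈ I', HasDerivAt v' (φ' (v x) * (1 + v' x ^ 2)) x)
    (x : ℝ) (hx : x ∈ I') : ENNReal.ofReal |x| < Lam φ u₀ := by
  rcases le_total 0 x with h | h
  · rw [abs_of_nonneg h]
    exact maximal_aux2 a φ φ' hφ hφ'pos u₀ hu₀ I' v v' hI hc h0 hva hv0 hv'0 hv hv' x hx h
  · rw [abs_of_nonpos h]
    refine maximal_aux2 a φ φ' hφ hφ'pos u₀ hu₀ ((fun z => -z) ⁻¹' I') (fun z => v (-z))
      (fun z => - v' (-z)) (hI.preimage continuous_neg) ?_ (by simpa using h0)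
      (fun z hz => hva _ hz) (by simpa using hv0) (by simpa using hv'0) ?_ ?_ (-x)
      (by simpa using hx) (by linarith)
    · exact hc.is_linear_preimage (f := fun z : ℝ => -z) (IsLinearMap.isLinearMap_neg)
    · intro z hz
      refine ((hv (-z) hz).scomp z (hasDerivAt_neg z)).congr_deriv ?_
      simp
    · intro z hz
      refine ((hv' (-z) hz).scomp z (hasDerivAt_neg z)).neg.congr_deriv ?_
      simp

/-- The maximal solution of the grim-reaper equation
`u'' = φ'(u)(1 + u'²)`, `u(0) = u₀`, `u'(0) = 0` (with `φ' > 0` on `(a,∞)`) is even,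
and its maximal interval of existence is exactly `(-Λ_{u₀}, Λ_{u₀})`. -/
theorem stmt_1 (a : ℝ) (φ φ' : ℝ → ℝ)
    (hφ : ∀ t ∈ Ioi a, HasDerivAt φ (φ' t) t)
    (hφ'c : ContinuousOn φ' (Ioi a))
    (hφ'pos : ∀ t ∈ Ioi a, 0 < φ' t)
    (u₀ : ℝ) (hu₀ : a < u₀) :
    0 < Lam φ u₀ ∧
    ∃ u u' : ℝ → ℝ,
      (∀ x ∈ {x : ℝ | ENNReal.ofReal |x| < Lam φ u₀}, u x ∈ Ioi a) ∧
      u 0 = u₀ ∧ u' 0 = 0 ∧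
      (∀ x ∈ {x : ℝ | ENNReal.ofReal |x| < Lam φ u₀}, HasDerivAt u (u' x) x) ∧
      (∀ x ∈ {x : ℝ | ENNReal.ofReal |x| < Lam φ u₀},
        HasDerivAt u' (φ' (u x) * (1 + u' x ^ 2)) x) ∧
      -- `u` is even
      (∀ x ∈ {x : ℝ | ENNReal.ofReal |x| < Lam φ u₀}, u (-x) = u x) ∧
      -- maximality: the domain of any solution with the same initial data is
      -- contained in `(-Λ_{u₀}, Λ_{u₀})`
      (∀ (I' : Set ℝ) (v v' : ℝ → ℝ), IsOpen I' → Convex ℝ I' → (0 : ℝ) ∈ I' →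
        (∀ x ∈ I', v x ∈ Ioi a) → v 0 = u₀ → v' 0 = 0 →
        (∀ x ∈ I', HasDerivAt v (v' x) x) →
        (∀ x ∈ I', HasDerivAt v' (φ' (v x) * (1 + v' x ^ 2)) x) →
        I' ⊆ {x : ℝ | ENNReal.ofReal |x| < Lam φ u₀}) := by
  obtain ⟨F, hF, hFc, hF0, hFd, hFi⟩ := exists_F a φ φ' hφ hφ'c hφ'pos u₀ hu₀
  obtain ⟨w, hw, hwc, hwF⟩ := exists_w F hF hFc
  have hle : ∀ t, u₀ ≤ t → ENNReal.ofReal (F t) ≤ Lam φ u₀ := by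
    intro t ht
    rw [← hFi t ht]
    exact lintegral_mono_set Ioc_subset_Ioi_self
  have hpos : 0 < Lam φ u₀ := by
    refine lt_of_lt_of_le ?_ (hle (u₀ + 1) (by linarith))
    rw [ENNReal.ofReal_pos, ← hF0]
    exact hF (by linarith)
  have hsup : Lam φ u₀ = ⨆ n : ℕ, ENNReal.ofReal (F (u₀ + n)) := by
    have hU : Ioi u₀ = ⋃ n : ℕ, Ioc u₀ (u₀ + n) := by
      ext t
      simp only [mem_Ioi, mem_iUnion, mem_Ioc]
      constructor
      · intro h
        obtain ⟨n, hn⟩ := exists_nat_ge (t - u₀)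
        exact ⟨n, h, by linarith⟩
      · rintro ⟨n, h, -⟩
        exact h
    have hmono : Monotone (fun n : ℕ => Ioc u₀ (u₀ + n)) := by
      intro m n hmn
      have : (m : ℝ) ≤ n := by exact_mod_cast hmn
      exact Ioc_subset_Ioc_right (by linarith)
    unfold Lam
    rw [hU, setLIntegral_iUnion_of_directed _ hmono.directed_le]
    congr 1
    ext n
    exact hFi _ (by simp)
  have hsurj : ∀ x, 0 ≤ x → ENNReal.ofReal x < Lam φ u₀ → ∃ t, u₀ ≤ t ∧ F t = x := by
    intro x hx hxL
    rw [hsup, lt_iSup_iff] at hxL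
    obtain ⟨n, hn⟩ := hxL
    have hn' := (ENNReal.ofReal_lt_ofReal_iff_of_nonneg hx).1 hn
    have : x ∈ Icc (F u₀) (F (u₀ + n)) := ⟨by rw [hF0]; exact hx, hn'.le⟩
    obtain ⟨t, ht, rfl⟩ := intermediate_value_Icc (by simp) hFc.continuousOn this
    exact ⟨t, ht.1, rfl⟩
  have hw0 : w 0 = u₀ := by rw [← hF0, hw]
  have hr0 : rr φ u₀ u₀ = 0 := by simp [rr]
  -- derivatives for positive `x`
  have hd1 : ∀ x, 0 < x → ENNReal.ofReal x < Lam φ u₀ →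
      HasDerivAt w (rr φ u₀ (w x)) x ∧
      HasDerivAt (fun z => rr φ u₀ (w z)) (φ' (w x) * (1 + rr φ u₀ (w x) ^ 2)) x := by
    intro x hx hxL
    obtain ⟨t, ht, rfl⟩ := hsurj x hx.le hxL
    rw [← hF0, hF.lt_iff_lt] at hx
    have hrp := rr_pos a φ φ' hφ hφ'pos u₀ hu₀ t hx
    have h1 : HasDerivAt w (rr φ u₀ (w (F t))) (F t) := by
      have := HasDerivAt.of_local_left_inverse (f' := 1 / rr φ u₀ t) (hwc t)
        (by rw [hw]; exact hFd t hx) (by positivity) (hwF t)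
      rw [hw]
      simpa using this
    refine ⟨h1, ?_⟩
    have h2 := rr_deriv a φ φ' hφ hφ'pos u₀ hu₀ (w (F t)) (by rw [hw]; exact hx)
    refine (h2.comp (F t) h1).congr_deriv ?_
    rw [hw, rr_sq a φ φ' hφ hφ'pos u₀ hu₀ t hx]
    field_simp
  set S : Set ℝ := {x : ℝ | ENNReal.ofReal |x| < Lam φ u₀} with hS
  have hSo : IsOpen S := isOpen_lt (ENNReal.continuous_ofReal.comp continuous_abs) continuous_const
  have h0S : (0 : ℝ) ∈ S := by simpa [hS] using hpos
  set u : ℝ → ℝ := fun x => w |x| with hu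
  set u' : ℝ → ℝ := fun x => if x < 0 then - rr φ u₀ (w (-x)) else rr φ u₀ (w x) with hu'
  have hua : ∀ x ∈ S, u x ∈ Ioi a := by
    intro x hx
    obtain ⟨t, ht, hxt⟩ := hsurj |x| (abs_nonneg x) hx
    simp only [hu]
    rw [← hxt, hw]
    exact hu₀.trans_le ht
  have hu0 : u 0 = u₀ := by simp [hu, hw0]
  have hu'0 : u' 0 = 0 := by simp [hu', hw0, hr0]
  have hne : ∀ x ∈ S, x ≠ 0 → HasDerivAt u (u' x) x ∧
      HasDerivAt u' (φ' (u x) * (1 + u' x ^ 2)) x := by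
    intro x hx hx0
    rcases lt_or_gt_of_ne hx0 with h | h
    · have hx' : ENNReal.ofReal (-x) < Lam φ u₀ := by rw [← abs_of_neg h]; exact hx
      obtain ⟨h1, h2⟩ := hd1 (-x) (by linarith) hx'
      have hev : ∀ᶠ z in 𝓝 x, z < 0 := Iio_mem_nhds h
      have e1 : u =ᶠ[𝓝 x] fun z => w (-z) := by
        filter_upwards [hev] with z hz
        simp [hu, abs_of_neg hz]
      have e2 : u' =ᶠ[𝓝 x] fun z => - rr φ u₀ (w (-z)) := by
        filter_upwards [hev] with z hz
        simp [hu', hz]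
      constructor
      · refine HasDerivAt.congr_of_eventuallyEq ?_ e1
        refine (h1.scomp x (hasDerivAt_neg x)).congr_deriv ?_
        rw [e2.eq_of_nhds]; simp
      · refine HasDerivAt.congr_of_eventuallyEq ?_ e2
        refine (h2.scomp x (hasDerivAt_neg x)).neg.congr_deriv ?_
        rw [e2.eq_of_nhds, e1.eq_of_nhds]; simp
    · have hx' : ENNReal.ofReal x < Lam φ u₀ := by rw [← abs_of_pos h]; exact hx
      obtain ⟨h1, h2⟩ := hd1 x h hx'
      have hev : ∀ᶠ z in 𝓝 x, 0 < z := Ioi_mem_nhds h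
      have e1 : u =ᶠ[𝓝 x] w := by
        filter_upwards [hev] with z hz
        simp [hu, abs_of_pos hz]
      have e2 : u' =ᶠ[𝓝 x] fun z => rr φ u₀ (w z) := by
        filter_upwards [hev] with z hz
        simp [hu', not_lt.2 hz.le]
      constructor
      · refine HasDerivAt.congr_of_eventuallyEq ?_ e1
        rw [e2.eq_of_nhds]; exact h1
      · refine HasDerivAt.congr_of_eventuallyEq ?_ e2
        rw [e2.eq_of_nhds, e1.eq_of_nhds]; exact h2
  have hw0c : ContinuousAt w 0 := by rw [← hF0]; exact hwc u₀
  have huc : ContinuousAt u 0 := by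
    apply ContinuousAt.comp (g := w) (f := fun x : ℝ => |x|)
    · simpa using hw0c
    · fun_prop
  have hruc : Tendsto (fun x => rr φ u₀ (u x)) (𝓝 0) (𝓝 0) := by
    have h1 : ContinuousAt (rr φ u₀) (u 0) := by
      rw [hu0]; exact rr_cont a φ φ' hφ u₀ u₀ hu₀
    have h2 : ContinuousAt (fun x => rr φ u₀ (u x)) 0 :=
      ContinuousAt.comp (g := rr φ u₀) (f := u) h1 huc
    have h3 := h2.tendsto
    rwa [hu0, hr0] at h3
  have hu'c : ContinuousAt u' 0 := by
    unfold ContinuousAt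
    rw [hu'0]
    refine squeeze_zero_norm (fun x => ?_) hruc
    have hn : 0 ≤ rr φ u₀ (u x) := Real.sqrt_nonneg _
    simp only [hu'] at *
    split_ifs with h
    · rw [hu] at *
      simp only [abs_of_neg h, norm_neg] at *
      rw [Real.norm_of_nonneg hn]
    · rw [hu] at *
      simp only [abs_of_nonneg (not_lt.1 h)] at *
      rw [Real.norm_of_nonneg hn]
  refine ⟨hpos, u, u', hua, hu0, hu'0, ?_, ?_, ?_, ?_⟩
  · intro x hx
    by_cases h : x = 0
    · subst h
      exact deriv_ext hSo h0S (fun y hy hy0 => (hne y hy hy0).1) huc hu'c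
    · exact (hne x hx h).1
  · intro x hx
    by_cases h : x = 0
    · subst h
      refine deriv_ext (g := fun x => φ' (u x) * (1 + u' x ^ 2)) hSo h0S
        (fun y hy hy0 => (hne y hy hy0).2) hu'c ?_
      have h1 : ContinuousAt φ' (u 0) := by
        rw [hu0]; exact hφ'c.continuousAt (Ioi_mem_nhds hu₀)
      have h2 : ContinuousAt (fun x => φ' (u x)) 0 := ContinuousAt.comp (g := φ') (f := u) h1 huc
      exact h2.mul (continuousAt_const.add (hu'c.pow 2))
    · exact (hne x hx h).2
  · intro x _
    simp [hu]
  · intro I' v v' hI hc h0 hva hv0 hv'0 hv hv' x hx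
    exact maximal_aux3 a φ φ' hφ hφ'pos u₀ hu₀ I' v v' hI hc h0 hva hv0 hv'0 hv hv' x hx
end

section
/- Let a, b ∈ ℝ ∪ {−∞}, c ∈ ℝ, and let φ : (a,∞) → (b,c) be a strictly increasing C¹ bijection with φ'(t) > 0 for all t (so φ(t) → c as t → ∞). Fix u₀ ∈ (a,∞) and let u be the maximal C² solution of the grim-reaper equation u''(x) = φ'(u(x))·(1 + u'(x)²) with u(0) = u₀, u'(0) = 0. Then u is defined on all of ℝ, is convex and even, attains its minimum at x = 0, and lim_{x→±∞} u(x) = +∞, lim_{x→±∞} u'(x) = ±√(e^{2(c − φ(u₀))} − 1). -/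
open Set Filter
open scoped Topology

theorem inv_aux (S T : Set ℝ) (hS : IsOpen S) (hT : IsOpen T) (φ φ' : ℝ → ℝ)
    (hbij : BijOn φ S T) (hmono : StrictMonoOn φ S)
    (hφ : ∀ t ∈ S, HasDerivAt φ (φ' t) t) (hpos : ∀ t ∈ S, 0 < φ' t) :
    ∃ ψ : ℝ → ℝ, (∀ y ∈ T, ψ y ∈ S) ∧ (∀ y ∈ T, φ (ψ y) = y) ∧ (∀ t ∈ S, ψ (φ t) = t) ∧
      StrictMonoOn ψ T ∧ ψ '' T = S ∧
      ∀ y ∈ T, HasDerivAt ψ (φ' (ψ y))⁻¹ y := by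
  have hinv := hbij.invOn_invFunOn
  have hb' := hbij.symm hinv.symm
  set ψ := Function.invFunOn φ S with hψ
  have h1 : ∀ y ∈ T, ψ y ∈ S := fun y hy => hb'.mapsTo hy
  have h2 : ∀ y ∈ T, φ (ψ y) = y := fun y hy => hinv.2 hy
  have h3 : ∀ t ∈ S, ψ (φ t) = t := fun y hy => hinv.1 hy
  have h4 : StrictMonoOn ψ T := by
    intro x hx y hy hxy
    rw [← hmono.lt_iff_lt (h1 x hx) (h1 y hy), h2 x hx, h2 y hy]
    exact hxy
  have h5 : ψ '' T = S := hb'.image_eq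
  refine ⟨ψ, h1, h2, h3, h4, h5, fun y hy => ?_⟩
  have hc : ContinuousAt ψ y := by
    apply continuousAt_of_monotoneOn_of_image_mem_nhds h4.monotoneOn (hT.mem_nhds hy)
    rw [h5]
    exact hS.mem_nhds (h1 y hy)
  exact HasDerivAt.of_local_left_inverse hc (hφ _ (h1 y hy)) (hpos _ (h1 y hy)).ne'
    (by filter_upwards [hT.mem_nhds hy] with z hz using h2 z hz)

theorem prim_aux (P : ℝ) (hP : 0 < P) (f : ℝ → ℝ) (hf : ContinuousOn f (Ioo (-P) P))
    (heven : ∀ s, f (-s) = f s) :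
    ∃ X : ℝ → ℝ, X 0 = 0 ∧ (∀ s, X (-s) = - X s) ∧
      ∀ s ∈ Ioo (-P) P, HasDerivAt X (f s) s := by
  refine ⟨fun p => ∫ s in (0:ℝ)..p, f s, by simp, fun p => ?_, fun p hp => ?_⟩
  · have h := intervalIntegral.integral_comp_neg (a := 0) (b := p) f
    simp only [heven, neg_zero] at h
    change (∫ s in (0:ℝ)..(-p), f s) = - (∫ s in (0:ℝ)..p, f s)
    rw [h, intervalIntegral.integral_symm]
  · apply intervalIntegral.integral_hasDerivAt_right
    · apply ContinuousOn.intervalIntegrable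
      apply hf.mono
      apply OrdConnected.uIcc_subset ordConnected_Ioo _ hp
      constructor <;> linarith
    · exact hf.stronglyMeasurableAtFilter isOpen_Ioo p hp
    · exact hf.continuousAt (isOpen_Ioo.mem_nhds hp)

theorem dom_aux (d p : ℝ) (hd : 0 < d) :
    1 / 2 * Real.log (1 + p ^ 2) < d ↔
      p ∈ Ioo (-Real.sqrt (Real.exp (2 * d) - 1)) (Real.sqrt (Real.exp (2 * d) - 1)) := by
  rw [mem_Ioo, ← abs_lt, Real.lt_sqrt (abs_nonneg p), sq_abs, lt_sub_iff_add_lt, add_comm,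
    ← Real.log_lt_iff_lt_exp (by positivity)]
  constructor <;> intro h <;> linarith

/-- Let `φ : (a,∞) → (b,c)` (`a, b ∈ ℝ ∪ {-∞}`, `c ∈ ℝ`) be a strictly
increasing C¹ bijection with positive derivative.  Then the maximal solution of the
grim-reaper equation with `u(0) = u₀`, `u'(0) = 0` is defined on all of `ℝ`, is convex,
even, has a minimum at `0`, and satisfies `u(x) → ∞` and `u'(x) → ±√(e^{2(c-φ(u₀))}-1)`
as `x → ±∞`. -/
theorem stmt_4 (a b : EReal) (c : ℝ) (φ φ' : ℝ → ℝ)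
    (hbij : Set.BijOn φ {t : ℝ | a < (t : EReal)}
      {y : ℝ | b < (y : EReal) ∧ y < c})
    (hmono : StrictMonoOn φ {t : ℝ | a < (t : EReal)})
    (hφ : ∀ t : ℝ, a < (t : EReal) → HasDerivAt φ (φ' t) t)
    (hφ'c : ContinuousOn φ' {t : ℝ | a < (t : EReal)})
    (hφ'pos : ∀ t : ℝ, a < (t : EReal) → 0 < φ' t)
    (u₀ : ℝ) (hu₀ : a < (u₀ : EReal)) :
    ∃ u u' : ℝ → ℝ,
      (∀ x : ℝ, a < (u x : EReal)) ∧
      u 0 = u₀ ∧ u' 0 = 0 ∧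
      -- `u` solves the grim-reaper equation on all of `ℝ`
      (∀ x : ℝ, HasDerivAt u (u' x) x) ∧
      (∀ x : ℝ, HasDerivAt u' (φ' (u x) * (1 + u' x ^ 2)) x) ∧
      -- `u` is the maximal solution: it extends any other solution
      (∀ (I' : Set ℝ) (v v' : ℝ → ℝ), IsOpen I' → Convex ℝ I' → (0 : ℝ) ∈ I' →
        (∀ x ∈ I', a < (v x : EReal)) → v 0 = u₀ → v' 0 = 0 →
        (∀ x ∈ I', HasDerivAt v (v' x) x) →
        (∀ x ∈ I', HasDerivAt v' (φ' (v x) * (1 + v' x ^ 2)) x) →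
        ∀ x ∈ I', v x = u x) ∧
      -- convex, even, minimum at the origin
      ConvexOn ℝ Set.univ u ∧
      (∀ x : ℝ, u (-x) = u x) ∧
      (∀ x : ℝ, u 0 ≤ u x) ∧
      -- behaviour at infinity
      Tendsto u atTop atTop ∧ Tendsto u atBot atTop ∧
      Tendsto u' atTop (𝓝 (Real.sqrt (Real.exp (2 * (c - φ u₀)) - 1))) ∧
      Tendsto u' atBot (𝓝 (-Real.sqrt (Real.exp (2 * (c - φ u₀)) - 1))) := by
  set S : Set ℝ := {t : ℝ | a < (t : EReal)} with hSdef
  set T : Set ℝ := {y : ℝ | b < (y : EReal) ∧ y < c} with hTdef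
  have hS : IsOpen S := isOpen_lt continuous_const continuous_coe_real_ereal
  have hT : IsOpen T := (isOpen_lt continuous_const continuous_coe_real_ereal).inter
    (isOpen_lt continuous_id continuous_const)
  obtain ⟨ψ, ψS, φψ, ψφ, ψmono, -, ψd⟩ := inv_aux S T hS hT φ φ' hbij hmono hφ hφ'pos
  have hφ0 : φ u₀ ∈ T := hbij.mapsTo hu₀
  have hd : 0 < c - φ u₀ := sub_pos.2 hφ0.2
  set P := Real.sqrt (Real.exp (2 * (c - φ u₀)) - 1) with hPdef
  have hdom := fun p => dom_aux (c - φ u₀) p hd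
  rw [← hPdef] at hdom
  have hP0 : (0:ℝ) ∈ Ioo (-P) P := by rw [← hdom]; simpa using hφ0.2
  have hP : 0 < P := hP0.2
  -- the energy level
  set Y : ℝ → ℝ := fun p => φ u₀ + 1 / 2 * Real.log (1 + p ^ 2) with hY
  have hY0 : ∀ p, φ u₀ ≤ Y p := by
    intro p
    have : 0 ≤ Real.log (1 + p ^ 2) := Real.log_nonneg (by nlinarith [sq_nonneg p])
    simp only [hY]; linarith
  have hYT : ∀ p ∈ Ioo (-P) P, Y p ∈ T := by
    intro p hp
    refine ⟨lt_of_lt_of_le hφ0.1 (by exact_mod_cast hY0 p), ?_⟩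
    have := (hdom p).2 hp
    simp only [hY]; linarith
  have hYd : ∀ p, HasDerivAt Y (p / (1 + p ^ 2)) p := by
    intro p
    have h1 : HasDerivAt (fun p : ℝ => 1 + p ^ 2) (2 * p) p := by
      simpa using (hasDerivAt_pow 2 p).const_add 1
    have h2 := ((h1.log (by positivity)).const_mul (1 / 2)).const_add (φ u₀)
    refine h2.congr_deriv ?_
    ring
  set U : ℝ → ℝ := fun p => ψ (Y p) with hU
  have hUS : ∀ p ∈ Ioo (-P) P, U p ∈ S := fun p hp => ψS _ (hYT p hp)
  have hUd : ∀ p ∈ Ioo (-P) P, HasDerivAt U ((φ' (U p))⁻¹ * (p / (1 + p ^ 2))) p :=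
    fun p hp => (ψd _ (hYT p hp)).comp p (hYd p)
  have hU0 : U 0 = u₀ := by simp [hU, hY, ψφ u₀ hu₀]
  have hUeven : ∀ p, U (-p) = U p := by intro p; simp [hU, hY]
  set g : ℝ → ℝ := fun p => φ' (U p) * (1 + p ^ 2) with hg
  have hgpos : ∀ p ∈ Ioo (-P) P, 0 < g p := fun p hp =>
    mul_pos (hφ'pos _ (hUS p hp)) (by positivity)
  have hUc : ContinuousOn U (Ioo (-P) P) := fun p hp => (hUd p hp).continuousAt.continuousWithinAt
  have hgc : ContinuousOn (fun p => (g p)⁻¹) (Ioo (-P) P) := by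
    apply ContinuousOn.inv₀
    · apply ContinuousOn.mul
      · exact hφ'c.comp hUc hUS
      · fun_prop
    · exact fun p hp => (hgpos p hp).ne'
  obtain ⟨X, hX0, hXodd, hXd⟩ := prim_aux P hP (fun p => (g p)⁻¹) hgc
    (by intro s; simp [hg, hUeven])
  have hXc : ContinuousOn X (Ioo (-P) P) := fun p hp => (hXd p hp).continuousAt.continuousWithinAt
  have hXmono : StrictMonoOn X (Ioo (-P) P) := by
    apply strictMonoOn_of_deriv_pos (convex_Ioo _ _) hXc
    intro p hp
    rw [interior_Ioo] at hp
    rw [(hXd p hp).deriv]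
    exact inv_pos.2 (hgpos p hp)
  have hXU : ∀ p ∈ Ico 0 P, U p - u₀ ≤ P * X p := by
    have hsub : Ico 0 P ⊆ Ioo (-P) P := fun p hp => ⟨by linarith [hp.1], hp.2⟩
    have hm : MonotoneOn (fun p => P * X p - U p) (Ico 0 P) := by
      apply monotoneOn_of_deriv_nonneg (convex_Ico _ _)
      · exact ((hXc.mono hsub).const_mul P).sub (hUc.mono hsub)
      · intro p hp
        rw [interior_Ico] at hp
        have hp' := hsub (Ioo_subset_Ico_self hp)
        exact (((hXd p hp').const_mul P).sub (hUd p hp')).differentiableAt.differentiableWithinAt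
      · intro p hp
        rw [interior_Ico] at hp
        have hp' := hsub (Ioo_subset_Ico_self hp)
        have := (((hXd p hp').const_mul P).sub (hUd p hp')).deriv
        have e : P * (g p)⁻¹ - (φ' (U p))⁻¹ * (p / (1 + p ^ 2)) = (P - p) * (g p)⁻¹ := by
          simp only [hg]; rw [mul_inv]; ring
        rw [e] at this
        refine le_of_le_of_eq ?_ this.symm
        exact mul_nonneg (by linarith [hp.2]) (inv_pos.2 (hgpos p hp')).le
    intro p hp
    have := hm (left_mem_Ico.2 hP) hp hp.1
    simp only [hX0, hU0] at this
    linarith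
  -- U takes arbitrarily large values
  have hbig : ∀ M : ℝ, ∃ p ∈ Ico 0 P, M ≤ U p := by
    intro M
    set M' := max M u₀ with hM'
    have hM'S : M' ∈ S := lt_of_lt_of_le hu₀ (by exact_mod_cast le_max_right M u₀)
    have h1 : φ u₀ ≤ φ M' := hmono.monotoneOn hu₀ hM'S (le_max_right _ _)
    have h2 : φ M' < c := (hbij.mapsTo hM'S).2
    have h3 : 1 ≤ Real.exp (2 * (φ M' - φ u₀)) := Real.one_le_exp (by linarith)
    refine ⟨Real.sqrt (Real.exp (2 * (φ M' - φ u₀)) - 1), ⟨Real.sqrt_nonneg _, ?_⟩, ?_⟩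
    · apply Real.sqrt_lt_sqrt (by linarith)
      have : Real.exp (2 * (φ M' - φ u₀)) < Real.exp (2 * (c - φ u₀)) :=
        Real.exp_lt_exp.2 (by linarith)
      linarith
    · have : U (Real.sqrt (Real.exp (2 * (φ M' - φ u₀)) - 1)) = M' := by
        simp only [hU, hY]
        rw [Real.sq_sqrt (by linarith)]
        rw [show 1 + (Real.exp (2 * (φ M' - φ u₀)) - 1) = Real.exp (2 * (φ M' - φ u₀)) by ring,
          Real.log_exp]
        rw [show φ u₀ + 1 / 2 * (2 * (φ M' - φ u₀)) = φ M' by ring]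
        exact ψφ _ hM'S
      rw [this]; exact le_max_left _ _
  have hXbig : ∀ x : ℝ, ∃ p ∈ Ico 0 P, x ≤ X p := by
    intro x
    obtain ⟨p, hp, h⟩ := hbig (P * x + u₀)
    refine ⟨p, hp, ?_⟩
    have := hXU p hp
    exact le_of_mul_le_mul_left (by linarith) hP
  have hXsurj : SurjOn X (Ioo (-P) P) univ := by
    intro x _
    obtain ⟨p, hp, h⟩ := hXbig x
    obtain ⟨q, hq, h'⟩ := hXbig (-x)
    have hp' : p ∈ Ioo (-P) P := ⟨by linarith [hp.1], hp.2⟩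
    have hq' : -q ∈ Ioo (-P) P := ⟨by linarith [hq.2], by linarith [hq.1]⟩
    have := isPreconnected_Ioo.intermediate_value hq' hp' hXc
    apply this
    refine ⟨?_, h⟩
    rw [hXodd]; linarith
  have hXbij : BijOn X (Ioo (-P) P) univ := ⟨mapsTo_univ _ _, hXmono.injOn, hXsurj⟩
  obtain ⟨p, pS, Xp, pX, pmono, pim, pd⟩ := inv_aux (Ioo (-P) P) univ isOpen_Ioo isOpen_univ X
    (fun p => (g p)⁻¹) hXbij hXmono hXd (fun t ht => inv_pos.2 (hgpos t ht))
  simp only [mem_univ, forall_const, inv_inv, strictMonoOn_univ, image_univ] at pS Xp pd pmono pim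
  have hp0 : p 0 = 0 := by simpa [hX0] using pX 0 hP0
  have hpodd : ∀ x, p (-x) = - p x := by
    intro x
    have hm : - p x ∈ Ioo (-P) P := ⟨by linarith [(pS x).2], by linarith [(pS x).1]⟩
    rw [← pX _ hm, hXodd, Xp]
  have hud : ∀ x, HasDerivAt (fun x => U (p x)) (p x) x := by
    intro x
    refine ((hUd _ (pS x)).comp x (pd x)).congr_deriv ?_
    have h1 := (hφ'pos _ (hUS _ (pS x))).ne'
    have h2 : (1 + p x ^ 2) ≠ 0 := by positivity
    simp only [hg]
    field_simp
  have hUm : ∀ q r, 0 ≤ q → q ≤ r → q ∈ Ioo (-P) P → r ∈ Ioo (-P) P → U q ≤ U r := by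
    intro q r h0 hqr hq hr
    apply ψmono.monotoneOn (hYT q hq) (hYT r hr)
    simp only [hY]
    gcongr
  have htop : Tendsto (fun x => U (p x)) atTop atTop := by
    rw [tendsto_atTop]
    intro M
    obtain ⟨q, hq, hqM⟩ := hbig M
    have hq' : q ∈ Ioo (-P) P := ⟨by linarith [hq.1], hq.2⟩
    filter_upwards [eventually_ge_atTop (X q)] with x hx
    have h1 : q ≤ p x := by
      have := pmono.monotone hx
      rwa [pX q hq'] at this
    exact hqM.trans (hUm q (p x) hq.1 h1 hq' (pS x))
  have hptop : Tendsto p atTop (𝓝 P) := by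
    apply tendsto_atTop_isLUB pmono.monotone
    rw [pim]
    exact isLUB_Ioo (by linarith)
  have hpbot : Tendsto p atBot (𝓝 (-P)) := by
    apply tendsto_atBot_isGLB pmono.monotone
    rw [pim]
    exact isGLB_Ioo (by linarith)
  have hue : ∀ x, U (p (-x)) = U (p x) := by
    intro x; rw [hpodd, hUeven]
  refine ⟨fun x => U (p x), p, fun x => hUS _ (pS x), by simp [hp0, hU0], hp0, hud, pd, ?_, ?_,
    hue, ?_, htop, ?_, hptop, hpbot⟩
  · intro I v v' hI hIc h0 hvS hv0 hv'0 hvd hv'd x hx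
    have hpre := hIc.isPreconnected
    have hE : ∀ x ∈ I, HasDerivAt (fun x => φ (v x) - Y (v' x)) 0 x := by
      intro x hx
      have h := ((hφ _ (hvS x hx)).comp x (hvd x hx)).sub ((hYd (v' x)).comp x (hv'd x hx))
      refine h.congr_deriv ?_
      have h2 : (1 + v' x ^ 2) ≠ 0 := by positivity
      field_simp
      ring
    have hE' : ∀ x ∈ I, φ (v x) = Y (v' x) := by
      intro x hx
      have := hI.is_const_of_deriv_eq_zero hpre
        (fun x hx => (hE x hx).differentiableAt.differentiableWithinAt)
        (fun x hx => (hE x hx).deriv) hx h0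
      simp only [hv0, hv'0] at this
      simp only [hY] at this ⊢
      simp at this
      linarith
    have hvP : ∀ x ∈ I, v' x ∈ Ioo (-P) P := by
      intro x hx
      rw [← hdom]
      have h1 : φ (v x) < c := (hbij.mapsTo (hvS x hx)).2
      rw [hE' x hx] at h1
      simp only [hY] at h1
      linarith
    have hvU : ∀ x ∈ I, v x = U (v' x) := by
      intro x hx
      simp only [hU]
      rw [← hE' x hx, ψφ _ (hvS x hx)]
    have hF : ∀ x ∈ I, HasDerivAt (fun x => X (v' x) - x) 0 x := by
      intro x hx
      have h := ((hXd _ (hvP x hx)).comp x (hv'd x hx)).sub (hasDerivAt_id x)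
      refine h.congr_deriv ?_
      have h3 := (hgpos _ (hvP x hx)).ne'
      rw [hvU x hx]
      change (g (v' x))⁻¹ * g (v' x) - 1 = 0
      rw [inv_mul_cancel₀ h3, sub_self]
    have hF' := hI.is_const_of_deriv_eq_zero hpre
        (fun x hx => (hF x hx).differentiableAt.differentiableWithinAt)
        (fun x hx => (hF x hx).deriv) hx h0
    simp only [hv'0, hX0, sub_zero] at hF'
    have : X (v' x) = x := by linarith
    rw [hvU x hx, ← pX _ (hvP x hx), this]
  · have hder : deriv (fun x => U (p x)) = p := funext fun x => (hud x).deriv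
    apply Monotone.convexOn_univ_of_deriv
    · exact fun x => (hud x).differentiableAt
    · rw [hder]; exact pmono.monotone
  · intro x
    simp only [hp0]
    apply ψmono.monotoneOn (hYT _ hP0) (hYT _ (pS x))
    have := hY0 (p x)
    simpa [hY] using this
  · have := htop.comp tendsto_neg_atBot_atTop
    refine this.congr fun x => hue x
end

section
/- Let a ∈ ℝ ∪ {−∞} and let φ : (a,∞) → ℝ be C¹ with φ'(t) > 0 for all t and lim_{t→∞} φ(t) = +∞. Fix u₀ ∈ (a,∞) and let u be the maximal C² solution of the grim-reaper equation u''(x) = φ'(u(x))·(1 + u'(x)²) with u(0) = u₀, u'(0) = 0. Then u is convex and even, its maximal interval of existence is (−Λ_{u₀}, Λ_{u₀}) where Λ_{u₀} = ∫_{u₀}^{∞} dλ / √(e^{2(φ(λ) − φ(u₀))} − 1) ∈ (0,∞], and lim_{x→±Λ_{u₀}} u(x) = +∞, lim_{x→±Λ_{u₀}} u'(x) = ±∞. -/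
open Set Filter MeasureTheory
open scoped ENNReal Topology

/-- The filter of `x → Λ⁻` (i.e. `x → +∞` when `Λ = ∞`). -/
noncomputable def rightEnd (Λ : ℝ≥0∞) : Filter ℝ :=
  if Λ = ⊤ then Filter.atTop else nhdsWithin Λ.toReal (Set.Iio Λ.toReal)

/-- The filter of `x → (-Λ)⁺` (i.e. `x → -∞` when `Λ = ∞`). -/
noncomputable def leftEnd (Λ : ℝ≥0∞) : Filter ℝ :=
  if Λ = ⊤ then Filter.atBot else nhdsWithin (-Λ.toReal) (Set.Ioi (-Λ.toReal))

/-- inverse function with positive derivative on an open interval -/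
theorem inv_aux_s5 (f f' : ℝ → ℝ) (D : Set ℝ) (hD : IsOpen D) (hc : D.OrdConnected)
    (hf : ∀ x ∈ D, HasDerivAt f (f' x) x) (hpos : ∀ x ∈ D, 0 < f' x) :
    StrictMonoOn f D ∧ ∃ g : ℝ → ℝ, (∀ x ∈ D, g (f x) = x) ∧
      ∀ x ∈ D, HasDerivAt g (f' x)⁻¹ (f x) := by
  have hcont : ContinuousOn f D := fun x hx => (hf x hx).continuousAt.continuousWithinAt
  have hm : StrictMonoOn f D := by
    apply strictMonoOn_of_deriv_pos hc.convex hcont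
    intro x hx
    rw [hD.interior_eq] at hx
    rw [(hf x hx).deriv]; exact hpos x hx
  refine ⟨hm, Function.invFunOn f D, ?_⟩
  have hg : ∀ x ∈ D, Function.invFunOn f D (f x) = x := fun x hx =>
    hm.injOn.leftInvOn_invFunOn hx
  refine ⟨hg, ?_⟩
  set g := Function.invFunOn f D
  intro x hx
  have hnb : f '' D ∈ 𝓝 (f x) := by
    obtain ⟨ε, hε, hb⟩ := Metric.isOpen_iff.1 hD x hx
    have h1 : x - ε/2 ∈ D := hb (by simp [abs_of_pos hε]; linarith)
    have h2 : x + ε/2 ∈ D := hb (by simp [abs_of_pos hε]; linarith)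
    have hsub : Icc (x - ε/2) (x + ε/2) ⊆ D := hc.out h1 h2
    have := intermediate_value_Icc (by linarith : x - ε/2 ≤ x + ε/2) (hcont.mono hsub)
    refine mem_of_superset (Icc_mem_nhds (hm h1 hx (by linarith)) (hm hx h2 (by linarith))) ?_
    exact this.trans (image_mono hsub)
  have hgm : StrictMonoOn g (f '' D) := by
    rintro _ ⟨y, hy, rfl⟩ _ ⟨z, hz, rfl⟩ h
    rw [hg y hy, hg z hz]
    exact (hm.lt_iff_lt hy hz).1 h
  have him : g '' (f '' D) ∈ 𝓝 (g (f x)) := by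
    rw [hg x hx]
    refine mem_of_superset (hD.mem_nhds hx) ?_
    intro y hy
    exact ⟨f y, mem_image_of_mem f hy, hg y hy⟩
  have hgc : ContinuousAt g (f x) := hgm.continuousAt_of_image_mem_nhds hnb him
  have hfx : HasDerivAt f (f' x) (g (f x)) := by rw [hg x hx]; exact hf x hx
  refine HasDerivAt.of_local_left_inverse hgc hfx (hpos x hx).ne' ?_
  filter_upwards [hnb]
  rintro _ ⟨y, hy, rfl⟩
  rw [hg y hy]

theorem rightEnd_aux (Λ : ℝ≥0∞) (c : ℝ) (hc : 0 ≤ c) (h : ENNReal.ofReal c < Λ) :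
    ∀ᶠ x in rightEnd Λ, c < x ∧ ENNReal.ofReal |x| < Λ := by
  unfold rightEnd
  split_ifs with hΛ
  · filter_upwards [eventually_gt_atTop c] with x hx
    exact ⟨hx, by rw [hΛ]; exact ENNReal.ofReal_lt_top⟩
  · have h1 : c < Λ.toReal := (ENNReal.ofReal_lt_iff_lt_toReal hc hΛ).1 h
    filter_upwards [Ioo_mem_nhdsLT h1] with x hx
    refine ⟨hx.1, ?_⟩
    have h0 : 0 ≤ x := hc.trans hx.1.le
    rw [abs_of_nonneg h0]
    exact (ENNReal.ofReal_lt_iff_lt_toReal h0 hΛ).2 hx.2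

theorem leftEnd_neg (Λ : ℝ≥0∞) : Tendsto (fun x : ℝ => -x) (leftEnd Λ) (rightEnd Λ) := by
  unfold rightEnd leftEnd
  split_ifs with hΛ
  · exact tendsto_neg_atBot_atTop
  · have := tendsto_neg_nhdsGT (a := -Λ.toReal)
    simpa using this

/-- the main construction: the angle parametrisation -/
theorem param_aux (a : EReal) (φ φ' : ℝ → ℝ)
    (hφ : ∀ t : ℝ, a < (t : EReal) → HasDerivAt φ (φ' t) t)
    (hφ'c : ContinuousOn φ' {t : ℝ | a < (t : EReal)})
    (hφ'pos : ∀ t : ℝ, a < (t : EReal) → 0 < φ' t)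
    (hφtop : Tendsto φ atTop atTop)
    (u₀ : ℝ) (hu₀ : a < (u₀ : EReal)) :
    StrictMonoOn φ {t : ℝ | a < (t : EReal)} ∧
    ∃ U : ℝ → ℝ, (∀ s, U (-s) = U s) ∧ U 0 = u₀ ∧
      (∀ s ∈ Ioo (-(Real.pi/2)) (Real.pi/2), u₀ ≤ U s) ∧
      (∀ s ∈ Ioo (-(Real.pi/2)) (Real.pi/2), φ (U s) = φ u₀ - Real.log (Real.cos s)) ∧
      (∀ s ∈ Ioo (-(Real.pi/2)) (Real.pi/2), HasDerivAt U (Real.tan s / φ' (U s)) s) ∧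
      (∀ s t : ℝ, a < (t : EReal) → φ t = φ u₀ - Real.log (Real.cos s) → U s = t) := by
  have hD : IsOpen {t : ℝ | a < (t : EReal)} := isOpen_lt continuous_const continuous_coe_real_ereal
  have hup : ∀ t : ℝ, u₀ ≤ t → a < (t : EReal) := fun t ht =>
    hu₀.trans_le (by exact_mod_cast ht)
  have hc : OrdConnected {t : ℝ | a < (t : EReal)} := by
    constructor
    intro x hx y hy z hz
    exact lt_of_lt_of_le hx (by exact_mod_cast hz.1 : (x : EReal) ≤ z)
  obtain ⟨hm, ψ, hψ, hψd⟩ := inv_aux_s5 φ φ' _ hD hc hφ hφ'pos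
  refine ⟨hm, fun s => ψ (φ u₀ - Real.log (Real.cos s)), ?_, ?_, ?_⟩
  · intro s; simp
  · simpa using hψ u₀ hu₀
  have key : ∀ s ∈ Ioo (-(Real.pi/2)) (Real.pi/2), ∃ t, u₀ ≤ t ∧
      φ t = φ u₀ - Real.log (Real.cos s) := by
    intro s hs
    have hcos := Real.cos_pos_of_mem_Ioo hs
    have hl : Real.log (Real.cos s) ≤ 0 := Real.log_nonpos hcos.le (Real.cos_le_one s)
    obtain ⟨M, hM1, hM2⟩ := ((hφtop.eventually_ge_atTop (φ u₀ - Real.log (Real.cos s))).and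
      (eventually_ge_atTop u₀)).exists
    have hcont : ContinuousOn φ (Icc u₀ M) := fun x hx =>
      (hφ x (hup x hx.1)).continuousAt.continuousWithinAt
    obtain ⟨t, ht, hte⟩ := intermediate_value_Icc hM2 hcont
      (⟨by linarith, hM1⟩ : φ u₀ - Real.log (Real.cos s) ∈ Icc (φ u₀) (φ M))
    exact ⟨t, ht.1, hte⟩
  refine ⟨?_, ?_, ?_, ?_⟩
  · intro s hs
    obtain ⟨t, ht, hte⟩ := key s hs
    simp only
    rw [← hte, hψ t (hup t ht)]; exact ht
  · intro s hs
    obtain ⟨t, ht, hte⟩ := key s hs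
    simp only
    rw [← hte, hψ t (hup t ht)]
  · intro s hs
    obtain ⟨t, ht, hte⟩ := key s hs
    have hcos := Real.cos_pos_of_mem_Ioo hs
    have h1 : HasDerivAt (fun s => φ u₀ - Real.log (Real.cos s)) (Real.tan s) s := by
      have := ((Real.hasDerivAt_cos s).log hcos.ne').const_sub (φ u₀)
      refine HasDerivAt.congr_deriv (this) ?_
      rw [Real.tan_eq_sin_div_cos]; ring
    have h2 := hψd t (hup t ht)
    rw [hte] at h2
    have h3 := h2.comp s h1
    simp only
    rw [← hte, hψ t (hup t ht)]
    refine HasDerivAt.congr_deriv (h3) ?_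
    ring
  · intro s t ht hte
    simp only
    rw [← hte]; exact hψ t ht

/-- the abscissa as a function of the angle -/
theorem absc_aux (g : ℝ → ℝ) (he : ∀ s, g (-s) = g s)
    (hg : ContinuousOn g (Ioo (-(Real.pi/2)) (Real.pi/2)))
    (hpos : ∀ s ∈ Ioo (-(Real.pi/2)) (Real.pi/2), 0 < g s) (Λ : ℝ≥0∞)
    (hΛ : Λ = ∫⁻ s in Ioo 0 (Real.pi/2), ENNReal.ofReal (g s)) :
    ∃ X : ℝ → ℝ, X 0 = 0 ∧ (∀ s, X (-s) = - X s) ∧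
      (∀ s ∈ Ioo (-(Real.pi/2)) (Real.pi/2), HasDerivAt X (g s) s) ∧
      X '' (Ioo (-(Real.pi/2)) (Real.pi/2)) = {x : ℝ | ENNReal.ofReal |x| < Λ} := by
  set T := Ioo (-(Real.pi/2)) (Real.pi/2) with hT
  have hpi := Real.pi_pos
  have h0T : (0:ℝ) ∈ T := ⟨by linarith, by linarith⟩
  have hTn : ∀ s ∈ T, -s ∈ T := fun s hs => ⟨by linarith [hs.2], by linarith [hs.1]⟩
  have hTo : IsOpen T := isOpen_Ioo
  have hii : ∀ s ∈ T, IntervalIntegrable g volume 0 s := fun s hs =>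
    (hg.mono (ordConnected_Ioo.uIcc_subset h0T hs)).intervalIntegrable
  set X : ℝ → ℝ := fun s => ∫ t in (0:ℝ)..s, g t with hX
  have hodd : ∀ s, X (-s) = - X s := by
    intro s
    have := intervalIntegral.integral_comp_neg (a := 0) (b := s) g
    simp only [he, neg_zero] at this
    simp only [hX]
    rw [intervalIntegral.integral_symm, ← this]
  have hd : ∀ s ∈ T, HasDerivAt X (g s) s := fun s hs =>
    intervalIntegral.integral_hasDerivAt_right (hii s hs)
      (hg.stronglyMeasurableAtFilter hTo s hs) (hg.continuousAt (hTo.mem_nhds hs))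
  have hX0 : X 0 = 0 := by simp [hX]
  obtain ⟨hm, -⟩ := inv_aux_s5 X g T hTo ordConnected_Ioo hd hpos
  have hlin : ∀ s ∈ T, 0 ≤ s → ENNReal.ofReal (X s) = ∫⁻ t in Ioc 0 s, ENNReal.ofReal (g t) := by
    intro s hs h0
    simp only [hX]
    rw [intervalIntegral.integral_of_le h0]
    apply ofReal_integral_eq_lintegral_ofReal
    · exact (intervalIntegrable_iff_integrableOn_Ioc_of_le h0).1 (hii s hs)
    · refine (ae_restrict_iff' measurableSet_Ioc).2 (Eventually.of_forall fun t ht => ?_)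
      exact (hpos t (ordConnected_Ioo.out h0T hs ⟨ht.1.le, ht.2⟩)).le
  have hle : ∀ s ∈ T, 0 ≤ s → ENNReal.ofReal (X s) ≤ Λ := by
    intro s hs h0
    rw [hlin s hs h0, hΛ]
    exact lintegral_mono_set fun t ht => ⟨ht.1, ht.2.trans_lt hs.2⟩
  have hlt : ∀ s ∈ T, 0 ≤ s → ENNReal.ofReal (X s) < Λ := by
    intro s hs h0
    obtain ⟨r, hr1, hr2⟩ := exists_between hs.2
    have hr : r ∈ T := ⟨hs.1.trans hr1, hr2⟩
    refine lt_of_lt_of_le ?_ (hle r hr (h0.trans hr1.le))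
    have hp : 0 < X r := by rw [← hX0]; exact hm h0T hr (h0.trans_lt hr1)
    exact (ENNReal.ofReal_lt_ofReal_iff hp).2 (hm hs hr hr1)
  have hex : ∀ x : ℝ, 0 ≤ x → ENNReal.ofReal x < Λ → ∃ s ∈ T, 0 ≤ s ∧ X s = x := by
    intro x hx hxl
    obtain ⟨r, hrm, hr, hrt⟩ := exists_seq_strictMono_tendsto' (show (0:ℝ) < Real.pi/2 by linarith)
    have hun : Ioo 0 (Real.pi/2) = ⋃ n, Ioc 0 (r n) := by
      ext t
      simp only [mem_iUnion, mem_Ioo, mem_Ioc]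
      constructor
      · rintro ⟨h1, h2⟩
        obtain ⟨n, hn⟩ := (hrt.eventually (lt_mem_nhds h2)).exists
        exact ⟨n, h1, hn.le⟩
      · rintro ⟨n, h1, h2⟩
        exact ⟨h1, h2.trans_lt (hr n).2⟩
    have hdir : Directed (· ⊆ ·) (fun n => Ioc 0 (r n)) :=
      directed_of_isDirected_le fun i j hij => Ioc_subset_Ioc_right (hrm.monotone hij)
    rw [hΛ, hun, setLIntegral_iUnion_of_directed _ hdir] at hxl
    obtain ⟨n, hn⟩ := lt_iSup_iff.1 hxl
    have hrT : r n ∈ T := ⟨by linarith [(hr n).1], (hr n).2⟩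
    rw [← hlin (r n) hrT (hr n).1.le] at hn
    have hn' : x < X (r n) := (ENNReal.ofReal_lt_ofReal_iff_of_nonneg hx).1 hn
    have hcont : ContinuousOn X (Icc 0 (r n)) := fun t ht =>
      (hd t (ordConnected_Ioo.out h0T hrT ht)).continuousAt.continuousWithinAt
    obtain ⟨s, hs, hse⟩ := intermediate_value_Icc (hr n).1.le hcont
      (⟨by rw [hX0]; exact hx, hn'.le⟩ : x ∈ Icc (X 0) (X (r n)))
    exact ⟨s, ordConnected_Ioo.out h0T hrT hs, hs.1, hse⟩
  refine ⟨X, hX0, hodd, hd, ?_⟩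
  ext x
  simp only [mem_image, mem_ofPred_eq]
  constructor
  · rintro ⟨s, hs, rfl⟩
    rcases le_total 0 s with h | h
    · have : 0 ≤ X s := by rw [← hX0]; exact hm.monotoneOn h0T hs h
      rw [abs_of_nonneg this]; exact hlt s hs h
    · have : X s ≤ 0 := by rw [← hX0]; exact hm.monotoneOn hs h0T h
      rw [abs_of_nonpos this, ← hodd]; exact hlt _ (hTn s hs) (by linarith)
  · intro hx
    obtain ⟨s, hs, h0, hse⟩ := hex |x| (abs_nonneg x) hx
    rcases abs_choice x with h | h
    · exact ⟨s, hs, by rw [hse, h]⟩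
    · exact ⟨-s, hTn s hs, by rw [hodd, hse, h, neg_neg]⟩

/-- change of variables in the integral defining `Lam` -/
theorem Lam_aux (a : EReal) (φ φ' : ℝ → ℝ)
    (hφ'pos : ∀ t : ℝ, a < (t : EReal) → 0 < φ' t)
    (u₀ : ℝ) (hu₀ : a < (u₀ : EReal))
    (hm : StrictMonoOn φ {t : ℝ | a < (t : EReal)}) (U : ℝ → ℝ)
    (hU1 : ∀ s ∈ Ioo (-(Real.pi/2)) (Real.pi/2), u₀ ≤ U s)
    (hU2 : ∀ s ∈ Ioo (-(Real.pi/2)) (Real.pi/2), φ (U s) = φ u₀ - Real.log (Real.cos s))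
    (hU3 : ∀ s ∈ Ioo (-(Real.pi/2)) (Real.pi/2), HasDerivAt U (Real.tan s / φ' (U s)) s)
    (hU4 : ∀ s t : ℝ, a < (t : EReal) → φ t = φ u₀ - Real.log (Real.cos s) → U s = t) :
    Lam φ u₀ = ∫⁻ s in Ioo 0 (Real.pi/2), ENNReal.ofReal (1 / φ' (U s)) := by
  have hpi := Real.pi_pos
  have hup : ∀ t : ℝ, u₀ ≤ t → a < (t : EReal) := fun t ht =>
    hu₀.trans_le (by exact_mod_cast ht)
  have hsub : Ioo 0 (Real.pi/2) ⊆ Ioo (-(Real.pi/2)) (Real.pi/2) :=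
    Ioo_subset_Ioo_left (by linarith)
  have hinj : InjOn U (Ioo 0 (Real.pi/2)) := by
    intro s hs t ht hst
    have h1 := hU2 s (hsub hs)
    have h2 := hU2 t (hsub ht)
    rw [hst] at h1
    have h3 : Real.log (Real.cos s) = Real.log (Real.cos t) := by linarith
    have h4 := Real.log_injOn_pos (Real.cos_pos_of_mem_Ioo (hsub hs))
      (Real.cos_pos_of_mem_Ioo (hsub ht)) h3
    exact Real.injOn_cos ⟨hs.1.le, by linarith [hs.2]⟩ ⟨ht.1.le, by linarith [ht.2]⟩ h4
  have himg : U '' Ioo 0 (Real.pi/2) = Ioi u₀ := by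
    ext t
    constructor
    · rintro ⟨s, hs, rfl⟩
      refine lt_of_le_of_ne (hU1 s (hsub hs)) ?_
      intro h
      have h1 := hU2 s (hsub hs)
      rw [← h] at h1
      have hc := Real.cos_pos_of_mem_Ioo (hsub hs)
      have h2 : Real.cos s < 1 := by
        have := Real.strictAntiOn_cos (left_mem_Icc.2 hpi.le)
          (⟨hs.1.le, by linarith [hs.2]⟩ : s ∈ Icc 0 Real.pi) hs.1
        simpa using this
      have := Real.log_neg hc h2
      linarith
    · intro ht
      have ht' : u₀ < t := ht
      have h1 : φ u₀ < φ t := hm hu₀ (hup t ht'.le) ht'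
      refine ⟨Real.arccos (Real.exp (φ u₀ - φ t)), ⟨?_, ?_⟩, ?_⟩
      · rw [Real.arccos_pos, Real.exp_lt_one_iff]; linarith
      · rw [Real.arccos_lt_pi_div_two]; exact Real.exp_pos _
      · apply hU4 _ t (hup t ht'.le)
        rw [Real.cos_arccos (by linarith [Real.exp_pos (φ u₀ - φ t)])
          (Real.exp_le_one_iff.2 (by linarith)), Real.log_exp]
        ring
  unfold Lam
  rw [← himg, lintegral_image_eq_lintegral_abs_deriv_mul measurableSet_Ioo
    (fun s hs => (hU3 s (hsub hs)).hasDerivWithinAt) hinj]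
  refine setLIntegral_congr_fun measurableSet_Ioo ?_
  intro s hs
  have hc := Real.cos_pos_of_mem_Ioo (hsub hs)
  have htan : 0 < Real.tan s := Real.tan_pos_of_pos_of_lt_pi_div_two hs.1 hs.2
  have hp := hφ'pos _ (hup _ (hU1 s (hsub hs)))
  have hq : 0 < Real.tan s / φ' (U s) := div_pos htan hp
  simp only
  rw [abs_of_pos hq, ← ENNReal.ofReal_mul hq.le, hU2 s (hsub hs)]
  congr 1
  have h1 : Real.exp (2 * (φ u₀ - Real.log (Real.cos s) - φ u₀)) - 1 = Real.tan s ^ 2 := by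
    have : 2 * (φ u₀ - Real.log (Real.cos s) - φ u₀) = -(Real.log (Real.cos s) + Real.log (Real.cos s)) := by ring
    rw [this, Real.exp_neg, Real.exp_add, Real.exp_log hc, Real.tan_eq_sin_div_cos]
    field_simp
    nlinarith [Real.sin_sq_add_cos_sq s]
  rw [h1, Real.sqrt_sq htan.le]
  field_simp

/-- For `φ : (a,∞) → ℝ` C¹ with `φ' > 0` and `φ(t) → +∞` as `t → ∞`,
the maximal solution of the grim-reaper equation with `u(0) = u₀`, `u'(0) = 0` is
convex and even, its maximal interval of existence is `(-Λ_{u₀}, Λ_{u₀})`, and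
`u → +∞`, `u' → ±∞` at `±Λ_{u₀}`. -/
theorem stmt_5 (a : EReal) (φ φ' : ℝ → ℝ)
    (hφ : ∀ t : ℝ, a < (t : EReal) → HasDerivAt φ (φ' t) t)
    (hφ'c : ContinuousOn φ' {t : ℝ | a < (t : EReal)})
    (hφ'pos : ∀ t : ℝ, a < (t : EReal) → 0 < φ' t)
    (hφtop : Tendsto φ atTop atTop)
    (u₀ : ℝ) (hu₀ : a < (u₀ : EReal)) :
    0 < Lam φ u₀ ∧
    ∃ u u' : ℝ → ℝ,
      (∀ x ∈ {x : ℝ | ENNReal.ofReal |x| < Lam φ u₀}, a < (u x : EReal)) ∧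
      u 0 = u₀ ∧ u' 0 = 0 ∧
      (∀ x ∈ {x : ℝ | ENNReal.ofReal |x| < Lam φ u₀}, HasDerivAt u (u' x) x) ∧
      (∀ x ∈ {x : ℝ | ENNReal.ofReal |x| < Lam φ u₀},
        HasDerivAt u' (φ' (u x) * (1 + u' x ^ 2)) x) ∧
      -- convex and even
      ConvexOn ℝ {x : ℝ | ENNReal.ofReal |x| < Lam φ u₀} u ∧
      (∀ x ∈ {x : ℝ | ENNReal.ofReal |x| < Lam φ u₀}, u (-x) = u x) ∧
      -- maximality: the domain of any solution with the same initial data is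
      -- contained in `(-Λ_{u₀}, Λ_{u₀})`
      (∀ (I' : Set ℝ) (v v' : ℝ → ℝ), IsOpen I' → Convex ℝ I' → (0 : ℝ) ∈ I' →
        (∀ x ∈ I', a < (v x : EReal)) → v 0 = u₀ → v' 0 = 0 →
        (∀ x ∈ I', HasDerivAt v (v' x) x) →
        (∀ x ∈ I', HasDerivAt v' (φ' (v x) * (1 + v' x ^ 2)) x) →
        I' ⊆ {x : ℝ | ENNReal.ofReal |x| < Lam φ u₀}) ∧
      -- behaviour at the ends of the maximal interval
      Tendsto u (rightEnd (Lam φ u₀)) atTop ∧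
      Tendsto u (leftEnd (Lam φ u₀)) atTop ∧
      Tendsto u' (rightEnd (Lam φ u₀)) atTop ∧
      Tendsto u' (leftEnd (Lam φ u₀)) atBot := by
  obtain ⟨hm, U, hUe, hU0, hU1, hU2, hU3, hU4⟩ :=
    param_aux a φ φ' hφ hφ'c hφ'pos hφtop u₀ hu₀
  have hΛ := Lam_aux a φ φ' hφ'pos u₀ hu₀ hm U hU1 hU2 hU3 hU4
  have hpi := Real.pi_pos
  have hup : ∀ t : ℝ, u₀ ≤ t → a < (t : EReal) := fun t ht =>
    hu₀.trans_le (by exact_mod_cast ht)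
  set T := Ioo (-(Real.pi/2)) (Real.pi/2) with hT
  have hTo : IsOpen T := isOpen_Ioo
  have h0T : (0:ℝ) ∈ T := ⟨by linarith, by linarith⟩
  have hgpos : ∀ s ∈ T, 0 < 1 / φ' (U s) := fun s hs =>
    one_div_pos.2 (hφ'pos _ (hup _ (hU1 s hs)))
  have hgc : ContinuousOn (fun s => 1 / φ' (U s)) T := by
    refine continuousOn_const.div ?_ fun s hs => (hφ'pos _ (hup _ (hU1 s hs))).ne'
    exact hφ'c.comp (fun s hs => (hU3 s hs).continuousAt.continuousWithinAt)
      fun s hs => hup _ (hU1 s hs)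
  obtain ⟨X, hX0, hXo, hXd, hXi⟩ := absc_aux (fun s => 1 / φ' (U s))
    (fun s => by simp only [hUe]) hgc hgpos (Lam φ u₀) hΛ
  obtain ⟨hXm, Θ, hΘ, hΘd⟩ := inv_aux_s5 X _ T hTo ordConnected_Ioo hXd hgpos
  set Λ := Lam φ u₀ with hΛdef
  set S := {x : ℝ | ENNReal.ofReal |x| < Λ} with hS
  have hXS : ∀ s ∈ T, X s ∈ S := fun s hs => hXi ▸ mem_image_of_mem X hs
  have hSX : ∀ x ∈ S, ∃ s ∈ T, X s = x := fun x hx => by rw [← hXi] at hx; exact hx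
  have h0S : (0:ℝ) ∈ S := hX0 ▸ hXS 0 h0T
  have hΛpos : 0 < Λ := by simpa [hS] using h0S
  have hΘT : ∀ x ∈ S, Θ x ∈ T := by
    intro x hx
    obtain ⟨s, hs, rfl⟩ := hSX x hx
    rw [hΘ s hs]; exact hs
  have hΘ0 : Θ 0 = 0 := by have := hΘ 0 h0T; rwa [hX0] at this
  have hTn : ∀ s ∈ T, -s ∈ T := fun s hs => ⟨by linarith [hs.2], by linarith [hs.1]⟩
  have hΘn : ∀ x ∈ S, Θ (-x) = - Θ x := by
    intro x hx
    obtain ⟨s, hs, rfl⟩ := hSX x hx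
    rw [← hXo, hΘ _ (hTn s hs), hΘ s hs]
  have hΘd' : ∀ x ∈ S, HasDerivAt Θ (φ' (U (Θ x))) x := by
    intro x hx
    obtain ⟨s, hs, rfl⟩ := hSX x hx
    have := hΘd s hs
    rw [hΘ s hs]
    simpa using this
  have hΘm : StrictMonoOn Θ S := by
    intro x hx y hy hxy
    obtain ⟨s, hs, rfl⟩ := hSX x hx
    obtain ⟨t, ht, rfl⟩ := hSX y hy
    rw [hΘ s hs, hΘ t ht]
    exact (hXm.lt_iff_lt hs ht).1 hxy
  have hScv : Convex ℝ S := by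
    rw [← hXi]
    refine IsPreconnected.convex ?_
    exact isPreconnected_Ioo.image X
      fun s hs => (hXd s hs).continuousAt.continuousWithinAt
  have hSo : IsOpen S := by
    apply isOpen_lt _ continuous_const
    exact ENNReal.continuous_ofReal.comp continuous_abs
  have hud : ∀ x ∈ S, HasDerivAt (fun x => U (Θ x)) (Real.tan (Θ x)) x := by
    intro x hx
    have h1 := (hU3 _ (hΘT x hx)).comp x (hΘd' x hx)
    refine HasDerivAt.congr_deriv (h1) ?_
    have := (hφ'pos _ (hup _ (hU1 _ (hΘT x hx)))).ne'
    field_simp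
  have hu'd : ∀ x ∈ S, HasDerivAt (fun x => Real.tan (Θ x))
      (φ' (U (Θ x)) * (1 + Real.tan (Θ x) ^ 2)) x := by
    intro x hx
    have hc := (Real.cos_pos_of_mem_Ioo (hΘT x hx)).ne'
    have h1 := (Real.hasDerivAt_tan hc).comp x (hΘd' x hx)
    refine HasDerivAt.congr_deriv (h1) ?_
    rw [Real.tan_eq_sin_div_cos]
    field_simp
    rw [Real.cos_sq_add_sin_sq, mul_one]
  have hr : Tendsto Θ (rightEnd Λ) (𝓝[<] (Real.pi/2)) := by
    refine tendsto_nhdsWithin_iff.2 ⟨?_, ?_⟩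
    · refine tendsto_order.2 ⟨fun b hb => ?_, fun b hb => ?_⟩
      · have hb' : max b 0 ∈ T := ⟨by linarith [le_max_right b 0], max_lt hb (by linarith)⟩
        have h0 : 0 ≤ X (max b 0) := by
          have := hXm.monotoneOn h0T hb' (le_max_right b 0)
          rwa [hX0] at this
        have h1 := hXS _ hb'
        simp only [hS, mem_ofPred_eq, abs_of_nonneg h0] at h1
        filter_upwards [rightEnd_aux Λ _ h0 h1] with x hx
        have h2 := hΘm (hXS _ hb') hx.2 hx.1
        rw [hΘ _ hb'] at h2
        exact (le_max_left b 0).trans_lt h2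
      · filter_upwards [rightEnd_aux Λ 0 le_rfl (by simpa using hΛpos)] with x hx
        exact (hΘT x hx.2).2.trans hb
    · filter_upwards [rightEnd_aux Λ 0 le_rfl (by simpa using hΛpos)] with x hx
      exact (hΘT x hx.2).2
  have hrS : ∀ᶠ x in rightEnd Λ, x ∈ S := by
    filter_upwards [rightEnd_aux Λ 0 le_rfl (by simpa using hΛpos)] with x hx
    exact hx.2
  have hSn : ∀ x, -x ∈ S → x ∈ S := fun x hx => by simpa [hS] using hx
  have hlS : ∀ᶠ x in leftEnd Λ, x ∈ S := by
    filter_upwards [(leftEnd_neg Λ).eventually hrS] with x hx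
    exact hSn x hx
  have hUt : Tendsto U (𝓝[<] (Real.pi/2)) atTop := by
    rw [tendsto_atTop]
    intro M
    have h1 : Tendsto (fun s => φ u₀ - Real.log (Real.cos s)) (𝓝[<] (Real.pi/2)) atTop := by
      refine tendsto_atTop_add_const_left _ _ ?_
      refine tendsto_neg_atBot_atTop.comp ?_
      exact Real.tendsto_log_nhdsGT_zero.comp Real.tendsto_cos_pi_div_two
    filter_upwards [h1.eventually_gt_atTop (φ (max M u₀)),
      Ioo_mem_nhdsLT (show -(Real.pi/2) < Real.pi/2 by linarith)] with s hs1 hs2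
    rw [← hU2 s hs2] at hs1
    have := (hm.lt_iff_lt (hup _ (le_max_right M u₀)) (hup _ (hU1 s hs2))).1 hs1
    exact (le_max_left M u₀).trans this.le
  have hu_r : Tendsto (fun x => U (Θ x)) (rightEnd Λ) atTop := hUt.comp hr
  have hu'_r : Tendsto (fun x => Real.tan (Θ x)) (rightEnd Λ) atTop :=
    Real.tendsto_tan_pi_div_two.comp hr
  refine ⟨hΛpos, fun x => U (Θ x), fun x => Real.tan (Θ x),
    fun x hx => hup _ (hU1 _ (hΘT x hx)), ?_, ?_, hud, hu'd, ?_, ?_, ?_, hu_r, ?_, hu'_r, ?_⟩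
  · simp only [hΘ0, hU0]
  · simp only [hΘ0, Real.tan_zero]
  · refine MonotoneOn.convexOn_of_deriv hScv
      (fun x hx => (hud x hx).continuousAt.continuousWithinAt) ?_ ?_
    · intro x hx
      rw [hSo.interior_eq] at hx
      exact (hud x hx).differentiableAt.differentiableWithinAt
    · rw [hSo.interior_eq]
      intro x hx y hy hxy
      rw [(hud x hx).deriv, (hud y hy).deriv]
      exact Real.strictMonoOn_tan.monotoneOn (hΘT x hx) (hΘT y hy) (hΘm.monotoneOn hx hy hxy)
  · intro x hx
    simp only [hΘn x hx, hUe]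
  · intro I v v' hIo hIc h0I hva hv0 hv'0 hvd hv'd x hx
    have hpc := hIc.isPreconnected
    have hAT : ∀ y, Real.arctan (v' y) ∈ T := fun y => Real.arctan_mem_Ioo _
    have hAd : ∀ y ∈ I, HasDerivAt (fun y => Real.arctan (v' y)) (φ' (v y)) y := by
      intro y hy
      refine HasDerivAt.congr_deriv ((hv'd y hy).arctan) ?_
      have : 1 + v' y ^ 2 ≠ 0 := by positivity
      field_simp
    have hconst : ∀ F : ℝ → ℝ, (∀ y ∈ I, HasDerivAt F 0 y) → ∀ y ∈ I, F y = F 0 := by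
      intro F hF y hy
      exact hIo.is_const_of_deriv_eq_zero hpc
        (fun z hz => (hF z hz).differentiableAt.differentiableWithinAt)
        (fun z hz => (hF z hz).deriv) hy h0I
    have hfi : ∀ y ∈ I, U (Real.arctan (v' y)) = v y := by
      intro y hy
      apply hU4 _ _ (hva y hy)
      have := hconst (fun y => φ (v y) + Real.log (Real.cos (Real.arctan (v' y)))) (by
        intro z hz
        have hc := (Real.cos_pos_of_mem_Ioo (hAT z)).ne'
        have h1 := (hφ (v z) (hva z hz)).comp z (hvd z hz)
        have h2 := ((Real.hasDerivAt_cos _).comp z (hAd z hz)).log hc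
        refine HasDerivAt.congr_deriv (h1.add h2) ?_
        have h3 := Real.tan_arctan (v' z)
        rw [Real.tan_eq_sin_div_cos] at h3
        have h4 : Real.sin (Real.arctan (v' z)) = v' z * Real.cos (Real.arctan (v' z)) :=
          (div_eq_iff hc).1 h3
        rw [h4, Function.comp_apply]
        field_simp
        ring) y hy
      simp only [hv'0, hv0, Real.arctan_zero, Real.cos_zero, Real.log_one] at this
      linarith
    have hxe := hconst (fun y => X (Real.arctan (v' y)) - y) (by
      intro z hz
      have h1 := ((hXd _ (hAT z)).comp z (hAd z hz)).sub (hasDerivAt_id z)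
      refine HasDerivAt.congr_deriv (h1) ?_
      rw [hfi z hz]
      have := (hφ'pos _ (hva z hz)).ne'
      field_simp
      ring) x hx
    simp only [hv'0, Real.arctan_zero, hX0, sub_zero] at hxe
    have : x = X (Real.arctan (v' x)) := by linarith
    rw [this]
    exact hXS _ (hAT x)
  · refine (hu_r.comp (leftEnd_neg Λ)).congr' ?_
    filter_upwards [hlS] with x hx
    simp only [Function.comp, hΘn x hx, hUe]
  · refine (tendsto_neg_atTop_atBot.comp (hu'_r.comp (leftEnd_neg Λ))).congr' ?_
    filter_upwards [hlS] with x hx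
    simp only [Function.comp, hΘn x hx, Real.tan_neg, neg_neg]
end

section
/- Let a ∈ ℝ, b ∈ ℝ ∪ {−∞}, and let φ : (a,∞) → (b,∞) be a strictly decreasing C¹ bijection with φ'(t) < 0 for all t (so φ(t) → +∞ as t → a⁺). Fix u₀ ∈ (a,∞) and set Λ = ∫_{a}^{u₀} dλ / √(e^{2(φ(λ) − φ(u₀))} − 1) ∈ (0,∞]. Let u be the maximal C² solution of the grim-reaper equation u''(x) = φ'(u(x))·(1 + u'(x)²) with u(0) = u₀, u'(0) = 0. Then: (i) the maximal interval of existence of u is (−Λ, Λ); (ii) Λ < ∞ if and only if ∫_{a}^{u₀} e^{−φ(λ)} dλ < ∞; (iii) u is concave and even with maximum at x = 0; and (iv) lim_{x→±Λ} u(x) = a and lim_{x→±Λ} |u'(x)| = +∞. -/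
open Set Filter MeasureTheory
open scoped ENNReal Topology

/-- `Λ = ∫_a^{u₀} dλ / √(e^{2(φ(λ)-φ(u₀))} - 1) ∈ (0,∞]` (lower Lebesgue integral). -/
noncomputable def LamLow (φ : ℝ → ℝ) (a u₀ : ℝ) : ℝ≥0∞ :=
  ∫⁻ t in Set.Ioo a u₀, ENNReal.ofReal (1 / Real.sqrt (Real.exp (2 * (φ t - φ u₀)) - 1))

lemma exists_psi (a : ℝ) (b : EReal) (φ φ' : ℝ → ℝ)
    (hbij : Set.BijOn φ (Ioi a) {y : ℝ | b < (y : EReal)})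
    (hφ : ∀ t ∈ Ioi a, HasDerivAt φ (φ' t) t)
    (hφ'c : ContinuousOn φ' (Ioi a))
    (hφ'neg : ∀ t ∈ Ioi a, φ' t < 0)
    (u₀ : ℝ) (hu₀ : a < u₀) :
    ∃ ψ : ℝ → ℝ, ∀ θ ∈ Ioo (-(Real.pi/2)) (Real.pi/2), a < ψ θ ∧
      φ (ψ θ) = φ u₀ - Real.log (Real.cos θ) ∧
      HasDerivAt ψ (Real.tan θ / φ' (ψ θ)) θ := by
  set F := Function.invFunOn φ (Ioi a) with hF
  have hleft : ∀ t ∈ Ioi a, F (φ t) = t := fun t ht => hbij.injOn.leftInvOn_invFunOn ht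
  have key : ∀ θ ∈ Ioo (-(Real.pi/2)) (Real.pi/2), ∃ t ∈ Ioi a, φ t = φ u₀ - Real.log (Real.cos θ) := by
    intro θ hθ
    have hc := Real.cos_pos_of_mem_Ioo hθ
    have hl : Real.log (Real.cos θ) ≤ 0 := Real.log_nonpos hc.le (Real.cos_le_one θ)
    have h1 : b < (φ u₀ : EReal) := hbij.mapsTo hu₀
    have h2 : b < ((φ u₀ - Real.log (Real.cos θ) : ℝ) : EReal) :=
      lt_of_lt_of_le h1 (by exact_mod_cast (by linarith))
    obtain ⟨t, ht, h⟩ := hbij.surjOn h2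
    exact ⟨t, ht, h⟩
  refine ⟨fun θ => F (φ u₀ - Real.log (Real.cos θ)), fun θ hθ => ?_⟩
  obtain ⟨t, ht, h⟩ := key θ hθ
  have hc := Real.cos_pos_of_mem_Ioo hθ
  have hFt : F (φ u₀ - Real.log (Real.cos θ)) = t := by rw [← h, hleft t ht]
  simp only [hFt]
  refine ⟨ht, h, ?_⟩
  have hs : HasStrictDerivAt φ (φ' t) t := by
    apply hasStrictDerivAt_of_hasDerivAt_of_continuousAt
    · filter_upwards [isOpen_Ioi.mem_nhds ht] with y hy using hφ y hy
    · exact hφ'c.continuousAt (isOpen_Ioi.mem_nhds ht)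
  have hinv : HasDerivAt F (φ' t)⁻¹ (φ t) := (hs.to_local_left_inverse (hφ'neg t ht).ne (by
    filter_upwards [isOpen_Ioi.mem_nhds ht] with y hy using hleft y hy)).hasDerivAt
  have hd : HasDerivAt (fun θ => φ u₀ - Real.log (Real.cos θ)) (Real.tan θ) θ := by
    have := ((Real.hasDerivAt_cos θ).log hc.ne').const_sub (φ u₀)
    exact this.congr_deriv (by rw [Real.tan_eq_sin_div_cos]; ring)
  rw [h] at hinv
  have := HasDerivAt.comp θ hinv hd
  exact this.congr_deriv (by rw [div_eq_inv_mul])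

lemma exists_G (g : ℝ → ℝ) (hgc : ContinuousOn g (Ioo (-(Real.pi/2)) (Real.pi/2)))
    (hpos : ∀ θ ∈ Ioo (-(Real.pi/2)) (Real.pi/2), 0 < g θ)
    (heven : ∀ θ ∈ Ioo (-(Real.pi/2)) (Real.pi/2), g (-θ) = g θ)
    (L : ℝ≥0∞) (hL : L = ∫⁻ θ in Ioo 0 (Real.pi/2), ENNReal.ofReal (g θ)) :
    ∃ G S : ℝ → ℝ, G 0 = 0 ∧
     (∀ θ ∈ Ioo (-(Real.pi/2)) (Real.pi/2), HasDerivAt G (g θ) θ) ∧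
     StrictMonoOn G (Ioo (-(Real.pi/2)) (Real.pi/2)) ∧
     (∀ θ ∈ Ioo (-(Real.pi/2)) (Real.pi/2), G (-θ) = - G θ) ∧
     (∀ θ ∈ Ioo (-(Real.pi/2)) (Real.pi/2), ENNReal.ofReal |G θ| < L) ∧
     (∀ θ ∈ Ioo (-(Real.pi/2)) (Real.pi/2), S (G θ) = θ) ∧
     (∀ x, ENNReal.ofReal |x| < L → S x ∈ Ioo (-(Real.pi/2)) (Real.pi/2) ∧ G (S x) = x ∧
        HasDerivAt S (g (S x))⁻¹ x) := by
  set J := Ioo (-(Real.pi/2)) (Real.pi/2) with hJ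
  have hpi := Real.pi_pos
  have h0 : (0:ℝ) ∈ J := ⟨by linarith, by linarith⟩
  have hJo : IsOpen J := isOpen_Ioo
  have hsub : ∀ θ ∈ J, uIcc 0 θ ⊆ J := fun θ hθ => (ordConnected_Ioo).uIcc_subset h0 hθ
  have hint : ∀ θ ∈ J, IntervalIntegrable g volume 0 θ := fun θ hθ =>
    (hgc.mono (hsub θ hθ)).intervalIntegrable
  set G : ℝ → ℝ := fun θ => ∫ t in (0:ℝ)..θ, g t with hG
  have hstrict : ∀ θ ∈ J, HasStrictDerivAt G (g θ) θ := by
    intro θ hθ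
    exact intervalIntegral.integral_hasStrictDerivAt_right (hint θ hθ)
      (hgc.stronglyMeasurableAtFilter hJo θ hθ) (hgc.continuousAt (hJo.mem_nhds hθ))
  have hder : ∀ θ ∈ J, HasDerivAt G (g θ) θ := fun θ hθ => (hstrict θ hθ).hasDerivAt
  have hcont : ContinuousOn G J := fun θ hθ => (hder θ hθ).continuousAt.continuousWithinAt
  have hmono : StrictMonoOn G J := by
    apply strictMonoOn_of_deriv_pos (convex_Ioo _ _) hcont
    intro x hx
    rw [interior_Ioo] at hx
    rw [(hder x hx).deriv]; exact hpos x hx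
  have hG0 : G 0 = 0 := by simp [hG]
  have hneg : ∀ θ ∈ J, -θ ∈ J := fun θ hθ => ⟨by linarith [hθ.2], by linarith [hθ.1]⟩
  have hodd : ∀ θ ∈ J, G (-θ) = - G θ := by
    intro θ hθ
    have h1 : ∫ t in (0:ℝ)..θ, g (-t) = ∫ t in (0:ℝ)..θ, g t :=
      intervalIntegral.integral_congr (fun t ht => heven t (hsub θ hθ ht))
    have h2 := intervalIntegral.integral_comp_neg (a := 0) (b := θ) g
    simp only [hG]
    rw [← h1, h2, neg_zero, intervalIntegral.integral_symm]
  have hofReal : ∀ θ ∈ J, 0 ≤ θ → ENNReal.ofReal (G θ) = ∫⁻ t in Ioc 0 θ, ENNReal.ofReal (g t) := by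
    intro θ hθ h
    simp only [hG]
    rw [intervalIntegral.integral_of_le h, ofReal_integral_eq_lintegral_ofReal]
    · exact (intervalIntegrable_iff_integrableOn_Ioc_of_le h).1 (hint θ hθ)
    · filter_upwards [ae_restrict_mem measurableSet_Ioc] with t ht
      exact (hpos t ⟨by linarith [ht.1], by linarith [ht.2, hθ.2]⟩).le
  have hle : ∀ θ ∈ J, 0 ≤ θ → ENNReal.ofReal (G θ) ≤ L := by
    intro θ hθ h
    rw [hofReal θ hθ h, hL]
    exact lintegral_mono_set (fun t ht => ⟨ht.1, by linarith [ht.2, hθ.2]⟩)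
  have hnn : ∀ θ ∈ J, 0 ≤ θ → 0 ≤ G θ := fun θ hθ h => by
    rw [← hG0]; exact hmono.monotoneOn h0 hθ h
  have hlt : ∀ θ ∈ J, 0 ≤ θ → ENNReal.ofReal (G θ) < L := by
    intro θ hθ h
    have h2 : (θ + Real.pi/2)/2 ∈ J := ⟨by linarith [hθ.1], by linarith [hθ.2]⟩
    have h3 := hmono hθ h2 (by linarith [hθ.2])
    refine lt_of_lt_of_le ?_ (hle _ h2 (by linarith))
    exact (ENNReal.ofReal_lt_ofReal_iff (lt_of_le_of_lt (hnn θ hθ h) h3)).2 h3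
  have hlt' : ∀ θ ∈ J, ENNReal.ofReal |G θ| < L := by
    intro θ hθ
    rcases le_total 0 θ with h | h
    · rw [abs_of_nonneg (hnn θ hθ h)]; exact hlt θ hθ h
    · have := hlt (-θ) (hneg θ hθ) (by linarith)
      have h5 := hnn (-θ) (hneg θ hθ) (by linarith)
      rw [hodd θ hθ] at this h5
      rw [abs_of_nonpos (by linarith)]; exact this
  have hsurj0 : ∀ x, 0 ≤ x → ENNReal.ofReal x < L → ∃ θ ∈ J, G θ = x := by
    intro x hx hxL
    by_contra hcon
    push Not at hcon
    have hbd : ∀ θ ∈ J, 0 ≤ θ → G θ ≤ x := by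
      intro θ hθ h
      by_contra hgt
      push Not at hgt
      have hss : Icc 0 θ ⊆ J := by rw [← uIcc_of_le h]; exact hsub θ hθ
      obtain ⟨t, ht, h'⟩ := intermediate_value_Icc h (hcont.mono hss) ⟨by rw [hG0]; exact hx, hgt.le⟩
      exact hcon t (hss ht) h'
    have hU : Ioo 0 (Real.pi/2) = ⋃ n : ℕ, Ioc 0 (Real.pi/2 * (n/(n+1))) := by
      ext t
      simp only [mem_Ioo, mem_iUnion, mem_Ioc]
      constructor
      · rintro ⟨h1, h2⟩
        obtain ⟨n, hn⟩ := exists_nat_gt (t / (Real.pi/2 - t))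
        refine ⟨n, h1, ?_⟩
        rw [div_lt_iff₀ (by linarith)] at hn
        rw [mul_div_assoc', le_div_iff₀ (by positivity)]
        nlinarith
      · rintro ⟨n, h1, h2⟩
        refine ⟨h1, lt_of_le_of_lt h2 ?_⟩
        have : (n:ℝ)/(n+1) < 1 := by rw [div_lt_one (by positivity)]; linarith
        nlinarith
    have hmn : Monotone (fun n : ℕ => Ioc 0 (Real.pi/2 * ((n:ℝ)/(n+1)))) := by
      intro m n hmn
      apply Ioc_subset_Ioc_right
      have hmn' : (m:ℝ) ≤ n := by exact_mod_cast hmn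
      have : (m:ℝ)/(m+1) ≤ n/(n+1) := by
        rw [div_le_div_iff₀ (by positivity) (by positivity)]; nlinarith
      nlinarith
    rw [hL, hU, setLIntegral_iUnion_of_directed _ hmn.directed_le] at hxL
    refine absurd hxL (not_lt.2 (iSup_le fun n => ?_))
    have h1 : (n:ℝ)/(n+1) < 1 := by rw [div_lt_one (by positivity)]; linarith
    have h2 : 0 ≤ (n:ℝ)/(n+1) := by positivity
    have h3 : Real.pi/2 * ((n:ℝ)/(n+1)) ∈ J := ⟨by nlinarith, by nlinarith⟩
    rw [← hofReal _ h3 (by positivity)]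
    exact ENNReal.ofReal_le_ofReal (hbd _ h3 (by positivity))
  have hsurj : ∀ x, ENNReal.ofReal |x| < L → ∃ θ ∈ J, G θ = x := by
    intro x hx
    rcases le_total 0 x with h | h
    · rw [abs_of_nonneg h] at hx; exact hsurj0 x h hx
    · rw [abs_of_nonpos h] at hx
      obtain ⟨θ, hθ, h'⟩ := hsurj0 (-x) (by linarith) hx
      exact ⟨-θ, hneg θ hθ, by rw [hodd θ hθ, h', neg_neg]⟩
  have hleft : ∀ θ ∈ J, Function.invFunOn G J (G θ) = θ :=
    fun θ hθ => hmono.injOn.leftInvOn_invFunOn hθ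
  refine ⟨G, Function.invFunOn G J, hG0, hder, hmono, hodd, hlt', hleft, ?_⟩
  intro x hx
  obtain ⟨θ, hθ, rfl⟩ := hsurj x hx
  rw [hleft θ hθ]
  refine ⟨hθ, rfl, ?_⟩
  exact ((hstrict θ hθ).to_local_left_inverse (hpos θ hθ).ne' (by
    filter_upwards [hJo.mem_nhds hθ] with y hy using hleft y hy)).hasDerivAt

lemma cov (a : ℝ) (φ φ' ψ : ℝ → ℝ) 
    (hanti : StrictAntiOn φ (Ioi a))
    (u₀ : ℝ) (hu₀ : a < u₀)
    (hψ : ∀ θ ∈ Ioo (-(Real.pi/2)) (Real.pi/2), a < ψ θ ∧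
      φ (ψ θ) = φ u₀ - Real.log (Real.cos θ) ∧
      HasDerivAt ψ (Real.tan θ / φ' (ψ θ)) θ) :
    (∀ s ∈ Ico 0 (Real.pi/2), ∀ t ∈ Ico 0 (Real.pi/2), s < t → ψ t < ψ s) ∧
    ψ 0 = u₀ ∧ ψ '' Ioo 0 (Real.pi/2) = Ioo a u₀ ∧
    ∀ h : ℝ → ℝ≥0∞, ∫⁻ t in Ioo a u₀, h t =
      ∫⁻ θ in Ioo 0 (Real.pi/2), ENNReal.ofReal |Real.tan θ / φ' (ψ θ)| * h (ψ θ) := by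
  have hpi := Real.pi_pos
  have hIco : ∀ s ∈ Ico 0 (Real.pi/2), s ∈ Ioo (-(Real.pi/2)) (Real.pi/2) :=
    fun s hs => ⟨by linarith [hs.1], hs.2⟩
  have hA : ∀ s ∈ Ico 0 (Real.pi/2), ∀ t ∈ Ico 0 (Real.pi/2), s < t → ψ t < ψ s := by
    intro s hs t ht hst
    have h1 := hψ s (hIco s hs)
    have h2 := hψ t (hIco t ht)
    rw [← hanti.lt_iff_gt h1.1 h2.1, h1.2.1, h2.2.1]
    have hc : Real.cos t < Real.cos s := Real.cos_lt_cos_of_nonneg_of_le_pi_div_two hs.1 ht.2.le hst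
    have := Real.log_lt_log (Real.cos_pos_of_mem_Ioo (hIco t ht)) hc
    linarith
  have h0 : ψ 0 = u₀ := by
    have := hψ 0 ⟨by linarith, by linarith⟩
    refine hanti.injOn this.1 hu₀ ?_
    rw [this.2.1]; simp
  have him : ψ '' Ioo 0 (Real.pi/2) = Ioo a u₀ := by
    ext y
    constructor
    · rintro ⟨t, ht, rfl⟩
      refine ⟨(hψ t (hIco t ⟨ht.1.le, ht.2⟩)).1, ?_⟩
      rw [← h0]
      exact hA 0 ⟨le_rfl, by linarith⟩ t ⟨ht.1.le, ht.2⟩ ht.1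
    · rintro ⟨h1, h2⟩
      have hlt : φ u₀ < φ y := hanti h1 hu₀ h2
      have he1 : Real.exp (φ u₀ - φ y) < 1 := (by rw [← Real.exp_zero]; exact Real.exp_lt_exp.2 (by linarith))
      have he0 := Real.exp_pos (φ u₀ - φ y)
      have hm : Real.arccos (Real.exp (φ u₀ - φ y)) ∈ Ioo 0 (Real.pi/2) :=
        ⟨Real.arccos_pos.2 he1, Real.arccos_lt_pi_div_two.2 he0⟩
      refine ⟨_, hm, ?_⟩
      have h3 := hψ _ (hIco _ ⟨hm.1.le, hm.2⟩)
      refine hanti.injOn h3.1 h1 ?_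
      rw [h3.2.1, Real.cos_arccos (by linarith) he1.le, Real.log_exp]; ring
  refine ⟨hA, h0, him, fun h => ?_⟩
  rw [← him]
  apply lintegral_image_eq_lintegral_abs_deriv_mul measurableSet_Ioo
  · intro x hx
    exact (hψ x (hIco x ⟨hx.1.le, hx.2⟩)).2.2.hasDerivWithinAt
  · intro s hs t ht hst
    rcases lt_trichotomy s t with h | h | h
    · exact absurd hst (hA s ⟨hs.1.le, hs.2⟩ t ⟨ht.1.le, ht.2⟩ h).ne'
    · exact h
    · exact absurd hst (hA t ⟨ht.1.le, ht.2⟩ s ⟨hs.1.le, hs.2⟩ h).ne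

lemma fin_iff (g : ℝ → ℝ) (hgc : ContinuousOn g (Ioo (-(Real.pi/2)) (Real.pi/2)))
    (hpos : ∀ θ ∈ Ioo (-(Real.pi/2)) (Real.pi/2), 0 < g θ) (c : ℝ) (hc : 0 < c) :
    (∫⁻ θ in Ioo 0 (Real.pi/2), ENNReal.ofReal (g θ)) < ⊤ ↔
    (∫⁻ θ in Ioo 0 (Real.pi/2), ENNReal.ofReal (c * (Real.sin θ * g θ))) < ⊤ := by
  have hpi := Real.pi_pos
  constructor
  · intro h
    have h1 : (∫⁻ θ in Ioo 0 (Real.pi/2), ENNReal.ofReal (c * (Real.sin θ * g θ))) ≤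
        ∫⁻ θ in Ioo 0 (Real.pi/2), ENNReal.ofReal c * ENNReal.ofReal (g θ) := by
      apply setLIntegral_mono' measurableSet_Ioo
      intro t ht
      rw [← ENNReal.ofReal_mul hc.le]
      apply ENNReal.ofReal_le_ofReal
      have := hpos t ⟨by linarith [ht.1], ht.2⟩
      have := Real.sin_le_one t
      have : Real.sin t * g t ≤ g t := by nlinarith
      nlinarith
    rw [lintegral_const_mul' _ _ ENNReal.ofReal_ne_top] at h1
    exact lt_of_le_of_lt h1 (ENNReal.mul_lt_top ENNReal.ofReal_lt_top h)
  · intro h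
    have hsplit : Ioo 0 (Real.pi/2) ⊆ Icc 0 (Real.pi/4) ∪ Ioo (Real.pi/4) (Real.pi/2) := by
      intro t ht
      rcases le_or_gt t (Real.pi/4) with h | h
      · exact Or.inl ⟨ht.1.le, h⟩
      · exact Or.inr ⟨h, ht.2⟩
    refine lt_of_le_of_lt (lintegral_mono_set hsplit) ?_
    refine lt_of_le_of_lt (lintegral_union_le _ _ _) ?_
    refine ENNReal.add_lt_top.2 ⟨?_, ?_⟩
    · have hi : IntegrableOn g (Icc 0 (Real.pi/4)) :=
        (hgc.mono (fun t ht => ⟨by linarith [ht.1], by linarith [ht.2]⟩)).integrableOn_Icc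
      exact hi.lintegral_lt_top
    · have hs4 : 0 < Real.sin (Real.pi/4) := Real.sin_pos_of_pos_of_lt_pi (by linarith) (by linarith)
      set k := (c * Real.sin (Real.pi/4))⁻¹ with hk
      have hkp : 0 < k := by positivity
      have h1 : (∫⁻ θ in Ioo (Real.pi/4) (Real.pi/2), ENNReal.ofReal (g θ)) ≤
        ∫⁻ θ in Ioo (Real.pi/4) (Real.pi/2), ENNReal.ofReal k *
          ENNReal.ofReal (c * (Real.sin θ * g θ)) := by
        apply setLIntegral_mono' measurableSet_Ioo
        intro t ht
        rw [← ENNReal.ofReal_mul hkp.le]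
        apply ENNReal.ofReal_le_ofReal
        have hg := hpos t ⟨by linarith [ht.1], ht.2⟩
        have hst : Real.sin (Real.pi/4) ≤ Real.sin t :=
          Real.sin_le_sin_of_le_of_le_pi_div_two (by linarith) ht.2.le ht.1.le
        rw [hk, le_inv_mul_iff₀ (by positivity)]
        nlinarith [mul_le_mul_of_nonneg_right hst (mul_pos hc hg).le]
      rw [lintegral_const_mul' _ _ ENNReal.ofReal_ne_top] at h1
      refine lt_of_le_of_lt h1 (ENNReal.mul_lt_top ENNReal.ofReal_lt_top ?_)
      exact lt_of_le_of_lt (lintegral_mono_set (Ioo_subset_Ioo_left (by linarith))) h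

lemma tendsto_left_right (L : ℝ≥0∞) : Tendsto (fun x : ℝ => -x) (leftEnd L) (rightEnd L) := by
  unfold leftEnd rightEnd
  split_ifs
  · exact tendsto_neg_atBot_atTop
  · have := tendsto_neg_nhdsGT (a := -L.toReal)
    rwa [neg_neg] at this

lemma eventually_right (L : ℝ≥0∞) (hL : 0 < L) (y : ℝ) (hy : ENNReal.ofReal |y| < L) :
    ∀ᶠ x in rightEnd L, ENNReal.ofReal |x| < L ∧ y < x := by
  unfold rightEnd
  split_ifs with h
  · filter_upwards [eventually_gt_atTop y] with x hx
    exact ⟨by rw [h]; exact ENNReal.ofReal_lt_top, hx⟩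
  · have h1 : 0 < L.toReal := ENNReal.toReal_pos hL.ne' h
    have h2 : y < L.toReal :=
      lt_of_le_of_lt (le_abs_self y) ((ENNReal.ofReal_lt_iff_lt_toReal (abs_nonneg y) h).1 hy)
    filter_upwards [Ioo_mem_nhdsLT (max_lt h1 h2)] with x hx
    have hx0 := (le_max_left _ _).trans_lt hx.1
    refine ⟨?_, (le_max_right _ _).trans_lt hx.1⟩
    rw [abs_of_pos hx0]
    exact (ENNReal.ofReal_lt_iff_lt_toReal hx0.le h).2 hx.2

lemma const_of_deriv {I : Set ℝ} (ho : IsOpen I) (hc : Convex ℝ I) (h0 : (0:ℝ) ∈ I) (f : ℝ → ℝ)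
    (hf : ∀ x ∈ I, HasDerivAt f 0 x) : ∀ x ∈ I, f x = f 0 := by
  intro x hx
  refine ho.is_const_of_deriv_eq_zero hc.isPreconnected
    (fun y hy => (hf y hy).differentiableAt.differentiableWithinAt) (fun y hy => (hf y hy).deriv) hx h0

/-- Let `φ : (a,∞) → (b,∞)` (`a ∈ ℝ`, `b ∈ ℝ ∪ {-∞}`) be a strictly
decreasing C¹ bijection with negative derivative, and `Λ = ∫_a^{u₀} dλ/√(e^{2(φ(λ)-φ(u₀))}-1)`.
Then the maximal interval of existence of the solution with `u(0)=u₀`, `u'(0)=0` is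
`(-Λ,Λ)`; `Λ < ∞ ↔ ∫_a^{u₀} e^{-φ} < ∞`; `u` is concave and even with maximum at `0`;
and `u → a`, `|u'| → +∞` at `±Λ`. -/
theorem stmt_7 (a : ℝ) (b : EReal) (φ φ' : ℝ → ℝ)
    (hbij : Set.BijOn φ (Ioi a) {y : ℝ | b < (y : EReal)})
    (hanti : StrictAntiOn φ (Ioi a))
    (hφ : ∀ t ∈ Ioi a, HasDerivAt φ (φ' t) t)
    (hφ'c : ContinuousOn φ' (Ioi a))
    (hφ'neg : ∀ t ∈ Ioi a, φ' t < 0)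
    (u₀ : ℝ) (hu₀ : a < u₀) :
    0 < LamLow φ a u₀ ∧
    -- (ii) finiteness criterion
    (LamLow φ a u₀ < ⊤ ↔ ∫⁻ t in Ioo a u₀, ENNReal.ofReal (Real.exp (-φ t)) < ⊤) ∧
    ∃ u u' : ℝ → ℝ,
      (∀ x ∈ {x : ℝ | ENNReal.ofReal |x| < LamLow φ a u₀}, u x ∈ Ioi a) ∧
      u 0 = u₀ ∧ u' 0 = 0 ∧
      (∀ x ∈ {x : ℝ | ENNReal.ofReal |x| < LamLow φ a u₀}, HasDerivAt u (u' x) x) ∧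
      (∀ x ∈ {x : ℝ | ENNReal.ofReal |x| < LamLow φ a u₀},
        HasDerivAt u' (φ' (u x) * (1 + u' x ^ 2)) x) ∧
      -- (iii) concave and even with maximum at the origin
      ConcaveOn ℝ {x : ℝ | ENNReal.ofReal |x| < LamLow φ a u₀} u ∧
      (∀ x ∈ {x : ℝ | ENNReal.ofReal |x| < LamLow φ a u₀}, u (-x) = u x) ∧
      (∀ x ∈ {x : ℝ | ENNReal.ofReal |x| < LamLow φ a u₀}, u x ≤ u 0) ∧
      -- (i) maximality of the interval of existence `(-Λ, Λ)`
      (∀ (I' : Set ℝ) (v v' : ℝ → ℝ), IsOpen I' → Convex ℝ I' → (0 : ℝ) ∈ I' →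
        (∀ x ∈ I', v x ∈ Ioi a) → v 0 = u₀ → v' 0 = 0 →
        (∀ x ∈ I', HasDerivAt v (v' x) x) →
        (∀ x ∈ I', HasDerivAt v' (φ' (v x) * (1 + v' x ^ 2)) x) →
        I' ⊆ {x : ℝ | ENNReal.ofReal |x| < LamLow φ a u₀}) ∧
      -- (iv) behaviour at the ends of the maximal interval
      Tendsto u (rightEnd (LamLow φ a u₀)) (𝓝 a) ∧
      Tendsto u (leftEnd (LamLow φ a u₀)) (𝓝 a) ∧
      Tendsto (fun x => |u' x|) (rightEnd (LamLow φ a u₀)) atTop ∧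
      Tendsto (fun x => |u' x|) (leftEnd (LamLow φ a u₀)) atTop := by
  have hpi := Real.pi_pos
  obtain ⟨ψ, hψ⟩ := exists_psi a b φ φ' hbij hφ hφ'c hφ'neg u₀ hu₀
  obtain ⟨hψanti, hψ0, hψim, hcov⟩ := cov a φ φ' ψ hanti u₀ hu₀ hψ
  set J := Ioo (-(Real.pi/2)) (Real.pi/2) with hJ
  have h0J : (0:ℝ) ∈ J := ⟨by linarith, by linarith⟩
  have hnegJ : ∀ θ ∈ J, -θ ∈ J := fun θ hθ => ⟨by linarith [hθ.2], by linarith [hθ.1]⟩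
  set g : ℝ → ℝ := fun θ => (-φ' (ψ θ))⁻¹ with hg
  have hneg : ∀ θ ∈ J, 0 < -φ' (ψ θ) := fun θ hθ => by
    have := hφ'neg _ (hψ θ hθ).1; linarith
  have hgpos : ∀ θ ∈ J, 0 < g θ := fun θ hθ => inv_pos.2 (hneg θ hθ)
  have hψc : ContinuousOn ψ J := fun θ hθ => (hψ θ hθ).2.2.continuousAt.continuousWithinAt
  have hgc : ContinuousOn g J :=
    ((hφ'c.comp hψc (fun θ hθ => (hψ θ hθ).1)).neg).inv₀ (fun θ hθ => (hneg θ hθ).ne')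
  have hψeven : ∀ θ ∈ J, ψ (-θ) = ψ θ := by
    intro θ hθ
    refine hanti.injOn (hψ _ (hnegJ θ hθ)).1 (hψ θ hθ).1 ?_
    rw [(hψ _ (hnegJ θ hθ)).2.1, (hψ θ hθ).2.1, Real.cos_neg]
  have hgeven : ∀ θ ∈ J, g (-θ) = g θ := fun θ hθ => by simp only [hg, hψeven θ hθ]
  have habs : ∀ θ ∈ Ioo 0 (Real.pi/2), |Real.tan θ / φ' (ψ θ)| = Real.tan θ * g θ := by
    intro θ hθ
    have ht := Real.tan_pos_of_pos_of_lt_pi_div_two hθ.1 hθ.2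
    have hn := hneg θ ⟨by linarith [hθ.1], hθ.2⟩
    rw [abs_div, abs_of_pos ht, abs_of_neg (by linarith)]
    rfl
  have hLeq : LamLow φ a u₀ = ∫⁻ θ in Ioo 0 (Real.pi/2), ENNReal.ofReal (g θ) := by
    unfold LamLow
    rw [hcov]
    apply setLIntegral_congr_fun measurableSet_Ioo
    intro θ hθ
    have hθJ : θ ∈ J := ⟨by linarith [hθ.1], hθ.2⟩
    have ht := Real.tan_pos_of_pos_of_lt_pi_div_two hθ.1 hθ.2
    have hc := Real.cos_pos_of_mem_Ioo hθJ
    have hsq : Real.exp (2 * (φ (ψ θ) - φ u₀)) - 1 = Real.tan θ ^ 2 := by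
      rw [(hψ θ hθJ).2.1, show 2 * (φ u₀ - Real.log (Real.cos θ) - φ u₀)
        = -(Real.log (Real.cos θ) + Real.log (Real.cos θ)) by ring, Real.exp_neg, Real.exp_add,
        Real.exp_log hc, ← sq, ← Real.inv_one_add_tan_sq hc.ne', inv_inv]
      ring
    simp only
    rw [habs θ hθ, hsq, Real.sqrt_sq ht.le, ← ENNReal.ofReal_mul (mul_pos ht (hgpos θ hθJ)).le]
    congr 1
    field_simp
  have hEeq : ∫⁻ t in Ioo a u₀, ENNReal.ofReal (Real.exp (-φ t)) =
      ∫⁻ θ in Ioo 0 (Real.pi/2), ENNReal.ofReal (Real.exp (-φ u₀) * (Real.sin θ * g θ)) := by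
    rw [hcov]
    apply setLIntegral_congr_fun measurableSet_Ioo
    intro θ hθ
    have hθJ : θ ∈ J := ⟨by linarith [hθ.1], hθ.2⟩
    have ht := Real.tan_pos_of_pos_of_lt_pi_div_two hθ.1 hθ.2
    have hc := Real.cos_pos_of_mem_Ioo hθJ
    simp only
    rw [habs θ hθ, ← ENNReal.ofReal_mul (mul_pos ht (hgpos θ hθJ)).le, (hψ θ hθJ).2.1,
      show -(φ u₀ - Real.log (Real.cos θ)) = -φ u₀ + Real.log (Real.cos θ) by ring,
      Real.exp_add, Real.exp_log hc, Real.tan_eq_sin_div_cos]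
    congr 1
    field_simp
  obtain ⟨G, S, hG0, hGd, hGm, hGodd, hGL, hSG, hS⟩ := exists_G g hgc hgpos hgeven _ hLeq
  have hfin : LamLow φ a u₀ < ⊤ ↔ ∫⁻ t in Ioo a u₀, ENNReal.ofReal (Real.exp (-φ t)) < ⊤ := by
    rw [hLeq, hEeq]
    exact fin_iff g hgc hgpos _ (Real.exp_pos _)
  clear hLeq hEeq
  set L := LamLow φ a u₀ with hLdef
  have hLpos : 0 < L := lt_of_le_of_lt zero_le (hGL 0 h0J)
  have hS0 : S 0 = 0 := by have := hSG 0 h0J; rwa [hG0] at this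
  have hSodd : ∀ x, ENNReal.ofReal |x| < L → S (-x) = - S x := by
    intro x hx
    obtain ⟨h1, h2, -⟩ := hS x hx
    have := hSG _ (hnegJ _ h1)
    rwa [hGodd _ h1, h2] at this
  have hconv : Convex ℝ {x : ℝ | ENNReal.ofReal |x| < L} := by
    rw [convex_iff_ordConnected]
    refine ⟨fun x hx y hy z hz => ?_⟩
    refine lt_of_le_of_lt (ENNReal.ofReal_le_ofReal (abs_le_max_abs_abs hz.1 hz.2)) ?_
    rcases max_choice |x| |y| with h | h <;> rw [h]
    exacts [hx, hy]
  have hopen : IsOpen {x : ℝ | ENNReal.ofReal |x| < L} :=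
    isOpen_lt (ENNReal.continuous_ofReal.comp continuous_abs) continuous_const
  have hSmono : ∀ x y, ENNReal.ofReal |x| < L → ENNReal.ofReal |y| < L → x ≤ y → S x ≤ S y := by
    intro x y hx hy hxy
    obtain ⟨h1, h2, -⟩ := hS x hx
    obtain ⟨h3, h4, -⟩ := hS y hy
    rw [← hGm.le_iff_le h1 h3, h2, h4]; exact hxy
  have hev : ∀ θ ∈ J, ∀ᶠ x in rightEnd L, ENNReal.ofReal |x| < L ∧ θ < S x := by
    intro θ hθ
    filter_upwards [eventually_right L hLpos (G θ) (hGL θ hθ)] with x hx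
    obtain ⟨h1, h2, -⟩ := hS x hx.1
    refine ⟨hx.1, ?_⟩
    rw [← hGm.lt_iff_lt hθ h1, h2]; exact hx.2
  have hud : ∀ x, ENNReal.ofReal |x| < L → HasDerivAt (fun x => ψ (S x)) (-Real.tan (S x)) x := by
    intro x hx
    obtain ⟨h1, h2, h3⟩ := hS x hx
    have := HasDerivAt.comp x (hψ _ h1).2.2 h3
    refine this.congr_deriv ?_
    have := hneg _ h1
    have : φ' (ψ (S x)) ≠ 0 := by intro h; rw [h] at this; simp at this
    simp only [hg, inv_inv]
    field_simp
  have hu'd : ∀ x, ENNReal.ofReal |x| < L → HasDerivAt (fun x => -Real.tan (S x))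
      (φ' (ψ (S x)) * (1 + (-Real.tan (S x)) ^ 2)) x := by
    intro x hx
    obtain ⟨h1, h2, h3⟩ := hS x hx
    have hc := Real.cos_pos_of_mem_Ioo h1
    have := (HasDerivAt.comp x (Real.hasDerivAt_tan hc.ne') h3).neg
    refine this.congr_deriv ?_
    simp only [hg, inv_inv]
    rw [neg_sq, ← Real.inv_one_add_tan_sq hc.ne']
    simp only [one_div, inv_inv]
    ring
  have hueven : ∀ x, ENNReal.ofReal |x| < L → ψ (S (-x)) = ψ (S x) := by
    intro x hx
    rw [hSodd x hx, hψeven _ (hS x hx).1]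
  have hR1 : Tendsto (fun x => ψ (S x)) (rightEnd L) (𝓝 a) := by
    rw [tendsto_order]
    constructor
    · intro c hc
      filter_upwards [hev 0 h0J] with x hx
      exact hc.trans (hψ _ (hS x hx.1).1).1
    · intro c hc
      have hm : (a + min c u₀)/2 ∈ Ioo a u₀ := by
        have h1 := lt_min hc hu₀
        have h2 := min_le_right c u₀
        constructor <;> linarith
      have hmc : (a + min c u₀)/2 < c := by
        have h2 := min_le_left c u₀
        linarith
      rw [← hψim] at hm
      obtain ⟨θ, hθ, hθe⟩ := hm
      filter_upwards [hev θ ⟨by linarith [hθ.1], hθ.2⟩] with x hx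
      have := hψanti θ ⟨hθ.1.le, hθ.2⟩ (S x) ⟨by linarith [hθ.1, hx.2], (hS x hx.1).1.2⟩ hx.2
      linarith
  have hR2 : Tendsto (fun x => |(-Real.tan (S x))|) (rightEnd L) atTop := by
    rw [tendsto_atTop]
    intro M
    filter_upwards [hev (Real.arctan M) ⟨Real.neg_pi_div_two_lt_arctan M, Real.arctan_lt_pi_div_two M⟩]
      with x hx
    have := Real.tan_lt_tan_of_lt_of_lt_pi_div_two (Real.neg_pi_div_two_lt_arctan M)
      (hS x hx.1).1.2 hx.2
    rw [Real.tan_arctan] at this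
    rw [abs_neg]
    exact this.le.trans (le_abs_self _)
  have hevL : ∀ᶠ x in leftEnd L, ENNReal.ofReal |x| < L := by
    have := (tendsto_left_right L).eventually (hev 0 h0J)
    filter_upwards [this] with x hx
    have := hx.1
    rwa [abs_neg] at this
  refine ⟨hLpos, hfin, fun x => ψ (S x), fun x => -Real.tan (S x), fun x hx => (hψ _ (hS x hx).1).1,
    by simp [hS0, hψ0], by simp [hS0], hud, hu'd, ?_, hueven, ?_, ?_, hR1, ?_, hR2, ?_⟩
  · apply AntitoneOn.concaveOn_of_deriv hconv
    · exact fun x hx => (hud x hx).continuousAt.continuousWithinAt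
    · rw [hopen.interior_eq]
      exact fun x hx => (hud x hx).differentiableAt.differentiableWithinAt
    · rw [hopen.interior_eq]
      intro x hx y hy hxy
      rw [(hud x hx).deriv, (hud y hy).deriv]
      have h1 := hSmono x y hx hy hxy
      have h2 := Real.strictMonoOn_tan.monotoneOn (hS x hx).1 (hS y hy).1 h1
      linarith
  · intro x hx
    have h1 := (hS x hx).1
    simp only [hS0, hψ0]
    rw [← hanti.le_iff_ge hu₀ (hψ _ h1).1, (hψ _ h1).2.1]
    have := Real.log_nonpos (Real.cos_pos_of_mem_Ioo h1).le (Real.cos_le_one _)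
    linarith
  · intro I v v' hIo hIc hI0 hva hv0 hv'0 hvd hv'd x hx
    have hp : ∀ y, 0 < 1 + v' y ^ 2 := fun y => by positivity
    have hE := const_of_deriv hIo hIc hI0 (fun y => φ (v y) - Real.log (1 + v' y ^ 2) / 2) (by
      intro y hy
      have h1 := HasDerivAt.comp y (hφ _ (hva y hy)) (hvd y hy)
      have h2 := ((((hv'd y hy).pow 2).const_add 1).log (hp y).ne').div_const 2
      refine (h1.sub h2).congr_deriv ?_
      have := (hp y).ne'
      simp only [Nat.cast_ofNat, Pi.pow_apply]
      field_simp
      ring)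
    have hsJ : ∀ y, -Real.arctan (v' y) ∈ J := fun y => 
      hnegJ _ ⟨Real.neg_pi_div_two_lt_arctan _, Real.arctan_lt_pi_div_two _⟩
    have hvψ : ∀ y ∈ I, ψ (-Real.arctan (v' y)) = v y := by
      intro y hy
      refine hanti.injOn (hψ _ (hsJ y)).1 (hva y hy) ?_
      rw [(hψ _ (hsJ y)).2.1, Real.cos_neg, Real.cos_arctan, one_div, Real.log_inv,
        Real.log_sqrt (hp y).le]
      have := hE y hy
      simp only [hv0, hv'0] at this
      norm_num at this
      linarith
    have hX := const_of_deriv hIo hIc hI0 (fun y => G (-Real.arctan (v' y)) - y) (by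
      intro y hy
      have h1 := HasDerivAt.comp y (hGd _ (hsJ y)) ((hv'd y hy).arctan.neg)
      refine (h1.sub (hasDerivAt_id y)).congr_deriv ?_
      have hn := (hneg _ (hsJ y))
      simp only [hg, Pi.neg_apply]
      rw [hvψ y hy] at hn ⊢
      have hn' : φ' (v y) ≠ 0 := by intro h; rw [h] at hn; simp at hn
      have := (hp y).ne'
      field_simp
      ring)
    have h3 := hX x hx
    simp only [hv'0, Real.arctan_zero, neg_zero, hG0, sub_zero] at h3
    have h4 := hGL _ (hsJ x)
    rw [sub_eq_zero.1 h3] at h4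
    exact h4
  · refine (hR1.comp (tendsto_left_right L)).congr' ?_
    filter_upwards [hevL] with x hx using hueven x hx
  · refine (hR2.comp (tendsto_left_right L)).congr' ?_
    filter_upwards [hevL] with x hx
    simp only [Function.comp, hSodd x hx, Real.tan_neg, abs_neg]
end

section
/- Let a < b (a ∈ ℝ ∪ {−∞}, b ∈ ℝ ∪ {+∞}), let φ : (a,b) → ℝ be smooth, and let u₀ ∈ (a,b). Then there exist R > 0 and a function u ∈ C²([0,R]) with values in (a,b) such that u(0) = u₀, u'(0) = 0, u''(r) = (1 + u'(r)²)·(φ'(u(r)) − u'(r)/r) for all r ∈ (0,R], and the (one-sided) second derivative at the origin satisfies u''(0) = φ'(u₀)/2. Moreover the solution is unique: any two C² functions with these initial conditions solving the equation on punctured intervals (0,R₁], (0,R₂] coincide on the common domain. -/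
open Set Filter

lemma lip_aux (S : Set ℝ) (hS : IsOpen S) (φ φ' : ℝ → ℝ)
    (hφsm : ContDiffOn ℝ (⊤ : ℕ∞) φ S)
    (hφd : ∀ t ∈ S, HasDerivAt φ (φ' t) t) (T : Set ℝ) (hTS : T ⊆ S) (hT : IsCompact T)
    (hTc : Convex ℝ T) :
    ∃ K B : ℝ, 0 ≤ K ∧ 0 ≤ B ∧ (∀ x ∈ T, |φ' x| ≤ B) ∧
      ∀ x ∈ T, ∀ y ∈ T, |φ' x - φ' y| ≤ K * |x - y| := by
  have h1 : ContDiffOn ℝ 1 φ' S := by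
    have := hφsm.deriv_of_isOpen (m := 1) hS (by
      rw [one_add_one_eq_two]; exact WithTop.coe_le_coe.2 (le_top : (2 : ℕ∞) ≤ ⊤))
    exact this.congr fun x hx => (hφd x hx).deriv.symm
  obtain ⟨K, hK⟩ := (h1.mono hTS).exists_lipschitzOnWith one_ne_zero hTc hT
  obtain ⟨B, hB⟩ := hT.exists_bound_of_continuousOn (h1.mono hTS).continuousOn
  refine ⟨K, max B 0, K.2, le_max_right _ _, fun x hx => (hB x hx).trans (le_max_left _ _), ?_⟩
  intro x hx y hy
  have := hK.dist_le_mul x hx y hy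
  simpa [Real.dist_eq] using this

lemma energy_ineq (K B P g1 g2 p1 p2 v r : ℝ) (hK : 0 ≤ K) (hB : 0 ≤ B) (hP : 0 ≤ P) (hr : 0 < r)
    (hg : |g1 - g2| ≤ K * |v|) (hg2 : |g2| ≤ B) (hp1 : |p1| ≤ P) (hp2 : |p2| ≤ P) :
    2 * v * (p1 - p2) + 2 * (p1 - p2) * ((1 + p1 ^ 2) * (g1 - p1 / r) - (1 + p2 ^ 2) * (g2 - p2 / r))
      ≤ (1 + K * (1 + P ^ 2) + 4 * B * P) * (v ^ 2 + (p1 - p2) ^ 2) := by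
  set w := p1 - p2 with hw
  have e : 2 * w * ((1 + p1 ^ 2) * (g1 - p1 / r) - (1 + p2 ^ 2) * (g2 - p2 / r))
      = 2 * (w * (g1 - g2) * (1 + p1 ^ 2)) + 2 * (g2 * (p1 + p2)) * w ^ 2
        - 2 * w ^ 2 * (1 + p1 ^ 2 + p1 * p2 + p2 ^ 2) / r := by
    rw [hw]; field_simp; ring
  have h1 : 0 ≤ 2 * w ^ 2 * (1 + p1 ^ 2 + p1 * p2 + p2 ^ 2) / r := by
    have : 0 ≤ 1 + p1 ^ 2 + p1 * p2 + p2 ^ 2 := by nlinarith [sq_nonneg (p1 + p2)]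
    positivity
  have h2 : w * (g1 - g2) * (1 + p1 ^ 2) ≤ |w| * (K * |v|) * (1 + P ^ 2) := by
    have a1 : p1 ^ 2 ≤ P ^ 2 := sq_le_sq' (abs_le.1 hp1).1 (abs_le.1 hp1).2
    have a2 : w * (g1 - g2) ≤ |w| * (K * |v|) := by
      calc w * (g1 - g2) ≤ |w * (g1 - g2)| := le_abs_self _
        _ = |w| * |g1 - g2| := abs_mul _ _
        _ ≤ _ := by gcongr
    gcongr
  have h3 : g2 * (p1 + p2) ≤ B * (2 * P) := by
    calc g2 * (p1 + p2) ≤ |g2 * (p1 + p2)| := le_abs_self _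
      _ = |g2| * |p1 + p2| := abs_mul _ _
      _ ≤ B * (2 * P) := by
        gcongr
        exact (abs_add_le _ _).trans (by linarith)
  have h4 : 2 * (|w| * |v|) ≤ v ^ 2 + w ^ 2 := by
    nlinarith [sq_nonneg (|w| - |v|), sq_abs w, sq_abs v]
  have h5 : 2 * v * w ≤ v ^ 2 + w ^ 2 := by nlinarith [sq_nonneg (v - w)]
  rw [e]
  have h6 : 2 * (g2 * (p1 + p2)) * w ^ 2 ≤ 2 * (B * (2 * P)) * w ^ 2 := by gcongr
  have h7 : K * (1 + P ^ 2) * (2 * (|w| * |v|)) ≤ K * (1 + P ^ 2) * (v ^ 2 + w ^ 2) := by gcongr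
  have h8 : 0 ≤ 4 * B * P * v ^ 2 := by positivity
  nlinarith

lemma gron (E E' : ℝ → ℝ) (R C : ℝ) (hc : ContinuousOn E (Icc 0 R))
    (hd : ∀ r ∈ Ioo 0 R, HasDerivAt E (E' r) r) (hE0 : E 0 = 0)
    (hle : ∀ r ∈ Ioo 0 R, E' r ≤ C * E r) : ∀ r ∈ Icc 0 R, E r ≤ 0 := by
  have hd2 : ∀ r ∈ Ioo 0 R, HasDerivAt (fun r => E r * Real.exp (-C * r))
      (E' r * Real.exp (-C * r) + E r * (Real.exp (-C * r) * (-C))) r := by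
    intro r hr
    have : HasDerivAt (fun r => Real.exp (-C * r)) (Real.exp (-C * r) * (-C)) r := by
      simpa using ((hasDerivAt_id r).const_mul (-C)).exp
    exact (hd r hr).mul this
  have hanti : AntitoneOn (fun r => E r * Real.exp (-C * r)) (Icc 0 R) := by
    apply antitoneOn_of_deriv_nonpos (convex_Icc _ _)
    · exact hc.mul (by fun_prop)
    · rw [interior_Icc]
      exact fun r hr => (hd2 r hr).differentiableAt.differentiableWithinAt
    · rw [interior_Icc]
      intro r hr
      rw [(hd2 r hr).deriv]
      have := hle r hr
      nlinarith [Real.exp_pos (-C * r)]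
  intro r hr
  have := hanti (left_mem_Icc.2 (hr.1.trans hr.2)) hr hr.1
  simp only [hE0, zero_mul] at this
  by_contra h
  push Not at h
  nlinarith [mul_pos h (Real.exp_pos (-C * r))]

lemma uniq_aux (S : Set ℝ) (hS : IsOpen S) (hSc : Convex ℝ S) (φ φ' : ℝ → ℝ)
    (hφsm : ContDiffOn ℝ (⊤ : ℕ∞) φ S)
    (hφd : ∀ t ∈ S, HasDerivAt φ (φ' t) t) (R : ℝ) (hR : 0 ≤ R)
    (u₁ u₁' u₁'' u₂ u₂' u₂'' : ℝ → ℝ)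
    (m1 : ∀ r ∈ Icc (0 : ℝ) R, u₁ r ∈ S)
    (d1 : ∀ r ∈ Icc (0 : ℝ) R, HasDerivWithinAt u₁ (u₁' r) (Icc 0 R) r)
    (dd1 : ∀ r ∈ Icc (0 : ℝ) R, HasDerivWithinAt u₁' (u₁'' r) (Icc 0 R) r)
    (e1 : ∀ r ∈ Ioc (0 : ℝ) R, u₁'' r = (1 + u₁' r ^ 2) * (φ' (u₁ r) - u₁' r / r))
    (m2 : ∀ r ∈ Icc (0 : ℝ) R, u₂ r ∈ S)
    (d2 : ∀ r ∈ Icc (0 : ℝ) R, HasDerivWithinAt u₂ (u₂' r) (Icc 0 R) r)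
    (dd2 : ∀ r ∈ Icc (0 : ℝ) R, HasDerivWithinAt u₂' (u₂'' r) (Icc 0 R) r)
    (e2 : ∀ r ∈ Ioc (0 : ℝ) R, u₂'' r = (1 + u₂' r ^ 2) * (φ' (u₂ r) - u₂' r / r))
    (h0 : u₁ 0 = u₂ 0) (h0' : u₁' 0 = u₂' 0) :
    ∀ r ∈ Icc (0 : ℝ) R, u₁ r = u₂ r := by
  have c1 : ContinuousOn u₁ (Icc 0 R) := fun r hr => (d1 r hr).continuousWithinAt
  have c2 : ContinuousOn u₂ (Icc 0 R) := fun r hr => (d2 r hr).continuousWithinAt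
  have c1' : ContinuousOn u₁' (Icc 0 R) := fun r hr => (dd1 r hr).continuousWithinAt
  have c2' : ContinuousOn u₂' (Icc 0 R) := fun r hr => (dd2 r hr).continuousWithinAt
  obtain ⟨P1, hP1⟩ := isCompact_Icc.exists_bound_of_continuousOn c1'
  obtain ⟨P2, hP2⟩ := isCompact_Icc.exists_bound_of_continuousOn c2'
  set P := max 0 (max P1 P2) with hPdef
  set I := u₁ '' Icc 0 R ∪ u₂ '' Icc 0 R with hI
  have hIc : IsCompact I := (isCompact_Icc.image_of_continuousOn c1).union
    (isCompact_Icc.image_of_continuousOn c2)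
  have hIS : I ⊆ S := by
    rintro x (⟨r, hr, rfl⟩ | ⟨r, hr, rfl⟩)
    exacts [m1 r hr, m2 r hr]
  have hIn : I.Nonempty := ⟨u₁ 0, Or.inl ⟨0, ⟨le_rfl, hR⟩, rfl⟩⟩
  have hTS : Icc (sInf I) (sSup I) ⊆ S :=
    hSc.ordConnected.out (hIS (hIc.sInf_mem hIn)) (hIS (hIc.sSup_mem hIn))
  have hIT : I ⊆ Icc (sInf I) (sSup I) := fun x hx =>
    ⟨csInf_le hIc.bddBelow hx, le_csSup hIc.bddAbove hx⟩
  obtain ⟨K, B, hK, hB, hb, hlip⟩ := lip_aux S hS φ φ' hφsm hφd _ hTS isCompact_Icc (convex_Icc _ _)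
  have key := gron (fun r => (u₁ r - u₂ r) ^ 2 + (u₁' r - u₂' r) ^ 2)
    (fun r => 2 * (u₁ r - u₂ r) * (u₁' r - u₂' r) + 2 * (u₁' r - u₂' r) * (u₁'' r - u₂'' r)) R
    (1 + K * (1 + P ^ 2) + 4 * B * P) (by fun_prop) (by
      intro r hr
      have hn : Icc 0 R ∈ nhds r := Icc_mem_nhds hr.1 hr.2
      have hr' := Ioo_subset_Icc_self hr
      have A := (((d1 r hr').hasDerivAt hn).sub ((d2 r hr').hasDerivAt hn)).pow 2
      have A' := (((dd1 r hr').hasDerivAt hn).sub ((dd2 r hr').hasDerivAt hn)).pow 2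
      refine (A.add A').congr_deriv ?_
      simp) (by simp [h0, h0']) (by
      intro r hr
      have hr' := Ioo_subset_Icc_self hr
      have hr'' := Ioo_subset_Ioc_self hr
      rw [e1 r hr'', e2 r hr'']
      have t1 : u₁ r ∈ Icc (sInf I) (sSup I) :=
        hIT (Or.inl ⟨r, hr', rfl⟩)
      have t2 : u₂ r ∈ Icc (sInf I) (sSup I) :=
        hIT (Or.inr ⟨r, hr', rfl⟩)
      exact energy_ineq K B P _ _ _ _ _ r hK hB (le_max_left _ _) hr.1 (hlip _ t1 _ t2) (hb _ t2)
        ((hP1 r hr').trans ((le_max_left _ _).trans (le_max_right _ _)))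
        ((hP2 r hr').trans ((le_max_right _ _).trans (le_max_right _ _))))
  intro r hr
  have h := key r hr
  have : (u₁ r - u₂ r) ^ 2 = 0 := by nlinarith [sq_nonneg (u₁ r - u₂ r), sq_nonneg (u₁' r - u₂' r)]
  exact sub_eq_zero.1 (pow_eq_zero_iff two_ne_zero |>.1 this)

/-- Truncation of the variable `x` to `[-M, M]`. -/
noncomputable def ctr (M x : ℝ) : ℝ := max (-M) (min M x)

/-- The truncated right-hand side. -/
noncomputable def Ftr (G : ℝ → ℝ) (M s u x : ℝ) : ℝ :=
  G u * (1 + s ^ 2 * ctr M x ^ 2) - s ^ 2 * ctr M x ^ 3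

/-- The height function attached to `q`. -/
noncomputable def Uq (u₀ : ℝ) (q : ℝ → ℝ) (s : ℝ) : ℝ :=
  u₀ + s ^ 2 * ∫ t in (0:ℝ)..1, t * q (t * s)

lemma ctr_abs (M x : ℝ) (hM : 0 ≤ M) : |ctr M x| ≤ M := by
  rw [abs_le]; unfold ctr
  exact ⟨le_max_left _ _, max_le (by linarith) (min_le_left _ _)⟩

lemma ctr_eq (M x : ℝ) (hx : |x| ≤ M) : ctr M x = x := by
  rw [abs_le] at hx; unfold ctr
  rw [min_eq_right hx.2, max_eq_right hx.1]

lemma ctr_lip (M x y : ℝ) : |ctr M x - ctr M y| ≤ |x - y| := by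
  unfold ctr
  calc _ ≤ max |(-M) - (-M)| |min M x - min M y| := abs_max_sub_max_le_max _ _ _ _
    _ = |min M x - min M y| := by simp
    _ ≤ max |M - M| |x - y| := abs_min_sub_min_le_max _ _ _ _
    _ = _ := by simp

lemma Ftr_bound (G : ℝ → ℝ) (M B s u x : ℝ) (hM : 0 ≤ M) (hG : |G u| ≤ B) :
    |Ftr G M s u x| ≤ B + s ^ 2 * (B * M ^ 2 + M ^ 3) := by
  unfold Ftr
  have hc := ctr_abs M x hM
  set c := ctr M x
  have h2 : |c| ^ 2 ≤ M ^ 2 := by gcongr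
  have h3 : |c| ^ 3 ≤ M ^ 3 := by gcongr
  have hB : 0 ≤ B := (abs_nonneg _).trans hG
  calc |G u * (1 + s ^ 2 * c ^ 2) - s ^ 2 * c ^ 3|
      ≤ |G u * (1 + s ^ 2 * c ^ 2)| + |s ^ 2 * c ^ 3| := abs_sub _ _
    _ = |G u| * (1 + s ^ 2 * |c| ^ 2) + s ^ 2 * |c| ^ 3 := by
      rw [abs_mul, abs_mul, abs_pow c, abs_of_nonneg (sq_nonneg s),
        abs_of_nonneg (by positivity : 0 ≤ 1 + s ^ 2 * c ^ 2), sq_abs]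
    _ ≤ B * (1 + s ^ 2 * M ^ 2) + s ^ 2 * M ^ 3 := by gcongr
    _ = _ := by ring

lemma Ftr_lip (G : ℝ → ℝ) (K M B s u v x y : ℝ) (hM : 0 ≤ M) (hK : 0 ≤ K) (hs : s ^ 2 ≤ 1)
    (hG : |G v| ≤ B) (hl : |G u - G v| ≤ K * |u - v|) :
    |Ftr G M s u x - Ftr G M s v y| ≤
      K * (1 + M ^ 2) * |u - v| + s ^ 2 * (2 * B * M + 3 * M ^ 2) * |x - y| := by
  unfold Ftr
  have hx := ctr_abs M x hM
  have hy := ctr_abs M y hM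
  have hxy := ctr_lip M x y
  set c := ctr M x
  set d := ctr M y
  have hB : 0 ≤ B := (abs_nonneg _).trans hG
  have e : G u * (1 + s ^ 2 * c ^ 2) - s ^ 2 * c ^ 3 - (G v * (1 + s ^ 2 * d ^ 2) - s ^ 2 * d ^ 3)
     = (G u - G v) * (1 + s ^ 2 * c ^ 2) +
       s ^ 2 * (G v * (c + d) - (c ^ 2 + c * d + d ^ 2)) * (c - d) := by ring
  rw [e]
  have h2 : |c| ^ 2 ≤ M ^ 2 := by gcongr
  rw [sq_abs] at h2
  have h3 : |G v * (c + d) - (c ^ 2 + c * d + d ^ 2)| ≤ 2 * B * M + 3 * M ^ 2 := by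
    calc _ ≤ |G v * (c + d)| + |c ^ 2 + c * d + d ^ 2| := abs_sub _ _
      _ ≤ |G v| * (|c| + |d|) + (|c| ^ 2 + |c| * |d| + |d| ^ 2) := by
        rw [abs_mul]
        gcongr
        · exact abs_add_le _ _
        · refine (abs_add_three _ _ _).trans ?_
          rw [abs_mul, abs_pow, abs_pow]
      _ ≤ B * (M + M) + (M ^ 2 + M * M + M ^ 2) := by gcongr
      _ = _ := by ring
  have h4 : 1 + s ^ 2 * c ^ 2 ≤ 1 + M ^ 2 := by nlinarith [sq_nonneg c]
  calc _ ≤ |(G u - G v) * (1 + s ^ 2 * c ^ 2)| +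
       |s ^ 2 * (G v * (c + d) - (c ^ 2 + c * d + d ^ 2)) * (c - d)| := abs_add_le _ _
    _ = |G u - G v| * (1 + s ^ 2 * c ^ 2) +
       s ^ 2 * |G v * (c + d) - (c ^ 2 + c * d + d ^ 2)| * |c - d| := by
      rw [abs_mul, abs_mul, abs_mul, abs_of_nonneg (sq_nonneg s),
        abs_of_nonneg (by positivity : 0 ≤ 1 + s ^ 2 * c ^ 2)]
    _ ≤ K * |u - v| * (1 + M ^ 2) + s ^ 2 * (2 * B * M + 3 * M ^ 2) * |x - y| := by
      gcongr
    _ = _ := by ring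

lemma Uq_cont (u₀ : ℝ) (q : ℝ → ℝ) (hq : Continuous q) : Continuous (Uq u₀ q) := by
  unfold Uq
  have : Continuous fun s : ℝ => ∫ t in (0:ℝ)..1, t * q (t * s) := by
    apply intervalIntegral.continuous_parametric_intervalIntegral_of_continuous'
    simp only [Function.uncurry_def]
    fun_prop
  fun_prop

lemma Ftr_cont (G : ℝ → ℝ) (hG : Continuous G) (M u₀ : ℝ) (q : ℝ → ℝ) (hq : Continuous q) :
    Continuous fun s => Ftr G M s (Uq u₀ q s) (q s) := by
  have := Uq_cont u₀ q hq
  unfold Ftr ctr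
  fun_prop

/-- `r² ∫₀¹ t f(t r) dt = ∫₀ʳ s f(s) ds`. -/
lemma subst_aux (f : ℝ → ℝ) (r : ℝ) :
    r ^ 2 * ∫ t in (0:ℝ)..1, t * f (t * r) = ∫ s in (0:ℝ)..r, s * f s := by
  have := intervalIntegral.mul_integral_comp_mul_right (a := 0) (b := 1) (f := fun s => s * f s) r
  rw [zero_mul, one_mul] at this
  rw [← this, pow_two, mul_assoc, ← intervalIntegral.integral_const_mul]
  congr 2
  ext t; ring

lemma int_bound (f : ℝ → ℝ) (C : ℝ) (h : ∀ t ∈ Icc (0:ℝ) 1, |f t| ≤ C) :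
    |∫ t in (0:ℝ)..1, t * f t| ≤ C := by
  have := intervalIntegral.norm_integral_le_of_norm_le_const (a := 0) (b := 1) (C := C)
    (f := fun t => t * f t) (by
      intro t ht
      rw [uIoc_of_le zero_le_one] at ht
      have := h t ⟨ht.1.le, ht.2⟩
      rw [Real.norm_eq_abs, abs_mul, abs_of_pos ht.1]
      nlinarith [abs_nonneg (f t), ht.2])
  simpa using this

lemma exist_aux (G : ℝ → ℝ) (K B u₀ δ : ℝ) (hK : 0 ≤ K) (hB : 0 ≤ B) (hδ : 0 < δ)
    (hGb : ∀ x, |G x| ≤ B) (hGl : ∀ x y, |G x - G y| ≤ K * |x - y|) (hGc : Continuous G) :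
    ∃ R > (0:ℝ), ∃ q : ℝ → ℝ, Continuous q ∧
      (∀ r ∈ Icc 0 R, |Uq u₀ q r - u₀| ≤ δ) ∧
      (∀ r ∈ Icc 0 R, q r = ∫ t in (0:ℝ)..1, t *
        (G (Uq u₀ q (t * r)) * (1 + (t * r) ^ 2 * q (t * r) ^ 2) - (t * r) ^ 2 * q (t * r) ^ 3)) := by
  set M := B + 1 with hM
  have hM0 : 0 ≤ M := by positivity
  set L := K * (1 + M ^ 2) + (2 * B * M + 3 * M ^ 2) with hL
  have hL0 : 0 ≤ L := by positivity
  set C := 1 + 2 * L + (B * M ^ 2 + M ^ 3) + M / δ with hC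
  have hC1 : 1 ≤ C := by
    have : 0 ≤ M / δ := by positivity
    have : 0 ≤ B * M ^ 2 + M ^ 3 := by positivity
    linarith
  set R := 1 / C with hR
  have hR0 : 0 < R := by positivity
  have hR1 : R ≤ 1 := by rw [hR, div_le_one (by linarith)]; exact hC1
  have hRC : R * C = 1 := by rw [hR]; field_simp
  have hR2 : R ^ 2 ≤ R := by nlinarith
  have hRx : ∀ x, 0 ≤ x → x ≤ C → R ^ 2 * x ≤ 1 := by
    intro x h0 hx
    calc R ^ 2 * x ≤ R * C := by gcongr
      _ = 1 := hRC
  have b1 : R ^ 2 * (2 * L) ≤ 1 := hRx _ (by positivity) (by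
    have : 0 ≤ M / δ := by positivity
    have : 0 ≤ B * M ^ 2 + M ^ 3 := by positivity
    linarith)
  have b2 : R ^ 2 * (B * M ^ 2 + M ^ 3) ≤ 1 := hRx _ (by positivity) (by
    have : 0 ≤ M / δ := by positivity
    linarith)
  have b3 : R ^ 2 * M ≤ δ := by
    have := hRx (M / δ) (by positivity) (by
      have : 0 ≤ B * M ^ 2 + M ^ 3 := by positivity
      linarith)
    rw [← mul_div_assoc, div_le_one hδ] at this
    exact this
  set ρ : ℝ → ℝ := fun r => max 0 (min R r) with hρ
  have hρc : Continuous ρ := by fun_prop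
  have hρ0 : ∀ r, 0 ≤ ρ r := fun r => le_max_left _ _
  have hρR : ∀ r, ρ r ≤ R := fun r => max_le hR0.le (min_le_left _ _)
  have hρe : ∀ r ∈ Icc 0 R, ρ r = r := fun r hr => by
    simp only [hρ]; rw [min_eq_right hr.2, max_eq_right hr.1]
  have htρ : ∀ t ∈ Icc (0:ℝ) 1, ∀ r, (t * ρ r) ^ 2 ≤ R ^ 2 := by
    intro t ht r
    have : t * ρ r ≤ 1 * R := mul_le_mul ht.2 (hρR r) (hρ0 r) zero_le_one
    have h0 : 0 ≤ t * ρ r := mul_nonneg ht.1 (hρ0 r)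
    gcongr; linarith
  have hR21 : R ^ 2 ≤ 1 := by linarith
  let Tf : (ℝ → ℝ) → ℝ → ℝ := fun q r =>
    ∫ t in (0:ℝ)..1, t * Ftr G M (t * ρ r) (Uq u₀ q (t * ρ r)) (q (t * ρ r))
  have Tc : ∀ q, Continuous q → Continuous (Tf q) := by
    intro q hq
    have h := Ftr_cont G hGc M u₀ q hq
    apply intervalIntegral.continuous_parametric_intervalIntegral_of_continuous'
    simp only [Function.uncurry_def]
    have h2 : Continuous fun p : ℝ × ℝ => p.2 * ρ p.1 := by fun_prop
    exact continuous_snd.mul (h.comp h2)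
  have Tb : ∀ q r, ‖Tf q r‖ ≤ M := by
    intro q r
    apply int_bound (fun t => Ftr G M (t * ρ r) (Uq u₀ q (t * ρ r)) (q (t * ρ r)))
    intro t ht
    refine (Ftr_bound G M B _ _ _ hM0 (hGb _)).trans ?_
    have : (t * ρ r) ^ 2 * (B * M ^ 2 + M ^ 3) ≤ R ^ 2 * (B * M ^ 2 + M ^ 3) := by
      exact mul_le_mul_of_nonneg_right (htρ t ht r) (by positivity)
    linarith
  let T : BoundedContinuousFunction ℝ ℝ → BoundedContinuousFunction ℝ ℝ := fun q =>
    BoundedContinuousFunction.ofNormedAddCommGroup (Tf q) (Tc q q.continuous) M (Tb q)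
  have Uint : ∀ q : ℝ → ℝ, Continuous q → ∀ s, IntervalIntegrable (fun t => t * q (t * s))
      MeasureTheory.volume 0 1 := by
    intro q hq s
    apply Continuous.intervalIntegrable
    fun_prop
  have hcontr : ContractingWith (1/2) T := by
    refine ⟨by rw [div_lt_one (by norm_num)]; norm_num, LipschitzWith.of_dist_le_mul ?_⟩
    intro q₁ q₂
    rw [BoundedContinuousFunction.dist_le (by positivity)]
    intro r
    set d := dist q₁ q₂ with hd
    have hd0 : 0 ≤ d := dist_nonneg
    have hqd : ∀ x, |q₁ x - q₂ x| ≤ d := fun x => by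
      rw [← Real.dist_eq]; exact BoundedContinuousFunction.dist_coe_le_dist x
    have hUd : ∀ s, |Uq u₀ q₁ s - Uq u₀ q₂ s| ≤ s ^ 2 * d := by
      intro s
      have e : Uq u₀ q₁ s - Uq u₀ q₂ s
          = s ^ 2 * ∫ t in (0:ℝ)..1, t * (q₁ (t * s) - q₂ (t * s)) := by
        unfold Uq
        simp only [mul_sub]
        rw [intervalIntegral.integral_sub (Uint q₁ q₁.continuous s) (Uint q₂ q₂.continuous s)]
        ring
      rw [e, abs_mul, abs_of_nonneg (sq_nonneg s)]
      gcongr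
      exact int_bound (fun t => q₁ (t * s) - q₂ (t * s)) d (fun t _ => hqd _)
    change dist (Tf q₁ r) (Tf q₂ r) ≤ _
    rw [Real.dist_eq]
    have hI : ∀ q : ℝ → ℝ, Continuous q → IntervalIntegrable
        (fun t => t * Ftr G M (t * ρ r) (Uq u₀ q (t * ρ r)) (q (t * ρ r)))
        MeasureTheory.volume 0 1 := by
      intro q hq
      apply Continuous.intervalIntegrable
      have h2 : Continuous fun t : ℝ => t * ρ r := by fun_prop
      exact continuous_id.mul ((Ftr_cont G hGc M u₀ q hq).comp h2)
    have e : Tf q₁ r - Tf q₂ r = ∫ t in (0:ℝ)..1, t *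
        (Ftr G M (t * ρ r) (Uq u₀ q₁ (t * ρ r)) (q₁ (t * ρ r)) -
          Ftr G M (t * ρ r) (Uq u₀ q₂ (t * ρ r)) (q₂ (t * ρ r))) := by
      simp only [mul_sub]
      rw [intervalIntegral.integral_sub (hI q₁ q₁.continuous) (hI q₂ q₂.continuous)]
    rw [e]
    apply int_bound (fun t => Ftr G M (t * ρ r) (Uq u₀ q₁ (t * ρ r)) (q₁ (t * ρ r)) -
          Ftr G M (t * ρ r) (Uq u₀ q₂ (t * ρ r)) (q₂ (t * ρ r)))
    intro t ht
    have hs := htρ t ht r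
    set s := t * ρ r
    refine (Ftr_lip G K M B s _ _ _ _ hM0 hK (hs.trans hR21) (hGb _) (hGl _ _)).trans ?_
    calc _ ≤ K * (1 + M ^ 2) * (R ^ 2 * d) + R ^ 2 * (2 * B * M + 3 * M ^ 2) * d := by
          gcongr
          · exact (hUd s).trans (by gcongr)
          · exact hqd s
      _ = R ^ 2 * L * d := by rw [hL]; ring
      _ ≤ 1 / 2 * d := by gcongr; linarith
      _ = _ := by push_cast; rfl
  obtain ⟨q, hq⟩ : ∃ q, T q = q := ⟨_, hcontr.fixedPoint_isFixedPt⟩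
  have hqT : ∀ r, q r = Tf q r := fun r => by
    conv_lhs => rw [← hq]
    rfl
  have hqb : ∀ r, |q r| ≤ M := fun r => by rw [hqT r]; exact Tb q r
  refine ⟨R, hR0, q, q.continuous, ?_, ?_⟩
  · intro r hr
    unfold Uq
    rw [add_sub_cancel_left, abs_mul, abs_of_nonneg (sq_nonneg r)]
    have h1 := int_bound (fun t => q (t * r)) M (fun t _ => hqb _)
    have h2 : r ^ 2 ≤ R ^ 2 := pow_le_pow_left₀ hr.1 hr.2 2
    calc _ ≤ R ^ 2 * M := by gcongr
      _ ≤ δ := b3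
  · intro r hr
    rw [hqT r]
    simp only [Tf, hρe r hr, Ftr, ctr_eq M _ (hqb _)]

lemma exist_deriv (G : ℝ → ℝ) (hGc : Continuous G) (u₀ R : ℝ) (hR : 0 < R) (q : ℝ → ℝ)
    (hq : Continuous q)
    (hfix : ∀ r ∈ Icc 0 R, q r = ∫ t in (0:ℝ)..1, t *
        (G (Uq u₀ q (t * r)) * (1 + (t * r) ^ 2 * q (t * r) ^ 2) - (t * r) ^ 2 * q (t * r) ^ 3)) :
    ∃ u' u'' : ℝ → ℝ,
      (∀ r ∈ Icc (0 : ℝ) R, HasDerivWithinAt (Uq u₀ q) (u' r) (Icc 0 R) r) ∧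
      (∀ r ∈ Icc (0 : ℝ) R, HasDerivWithinAt u' (u'' r) (Icc 0 R) r) ∧
      ContinuousOn u'' (Icc 0 R) ∧ u' 0 = 0 ∧ u'' 0 = G u₀ / 2 ∧
      (∀ r ∈ Ioc (0 : ℝ) R, u'' r = (1 + u' r ^ 2) * (G (Uq u₀ q r) - u' r / r)) := by
  have hU := Uq_cont u₀ q hq
  have hU0 : Uq u₀ q 0 = u₀ := by simp [Uq]
  set F : ℝ → ℝ := fun s => G (Uq u₀ q s) * (1 + s ^ 2 * q s ^ 2) - s ^ 2 * q s ^ 3 with hF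
  have hFc : Continuous F := by fun_prop
  have hfix' : ∀ r ∈ Icc 0 R, r ^ 2 * q r = ∫ s in (0:ℝ)..r, s * F s := by
    intro r hr
    rw [← subst_aux F r, hfix r hr]
  have hq0 : q 0 = G u₀ / 2 := by
    rw [hfix 0 ⟨le_rfl, hR.le⟩]
    simp [hU0]
    ring
  have hUd : ∀ r, HasDerivAt (Uq u₀ q) (r * q r) r := by
    intro r
    have e : Uq u₀ q = fun r => u₀ + ∫ s in (0:ℝ)..r, s * q s := by
      ext r; unfold Uq; rw [subst_aux]
    rw [e]
    have hc : Continuous fun s => s * q s := by fun_prop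
    exact (hc.integral_hasStrictDerivAt 0 r).hasDerivAt.const_add _
  refine ⟨fun r => r * q r, fun r => F r - q r, fun r _ => (hUd r).hasDerivWithinAt, ?_,
    by fun_prop, by simp, ?_, ?_⟩
  · intro r hr
    rcases hr.1.eq_or_lt with h0 | h0
    · subst h0
      have e : F 0 - q 0 = q 0 := by simp [hF, hU0, hq0]; ring
      change HasDerivWithinAt _ (F 0 - q 0) _ _
      rw [e, hasDerivWithinAt_iff_tendsto_slope]
      have : Tendsto q (nhdsWithin 0 (Icc 0 R \ {0})) (nhds (q 0)) :=
        hq.continuousAt.tendsto.mono_left nhdsWithin_le_nhds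
      refine this.congr' ?_
      filter_upwards [self_mem_nhdsWithin] with x hx
      have hx0 : x ≠ 0 := hx.2
      rw [slope_def_field]
      field_simp
      simp
    · have hc : Continuous fun s => s * F s := by fun_prop
      have h1 := (hc.integral_hasStrictDerivAt 0 r).hasDerivAt
      have h2 := h1.div (hasDerivAt_id r) h0.ne'
      have h3 : HasDerivWithinAt (fun x => (∫ s in (0:ℝ)..x, s * F s) / x) (F r - q r)
          (Icc 0 R) r := by
        refine (h2.congr_deriv ?_).hasDerivWithinAt
        rw [← hfix' r hr]
        simp only [id]
        field_simp
      refine h3.congr ?_ ?_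
      · intro x hx
        rw [← hfix' x hx]
        rcases eq_or_ne x 0 with h | h
        · simp [h]
        · field_simp
      · rw [← hfix' r hr]; field_simp
  · simp [hF, hU0, hq0]; ring
  · intro r hr
    have : r ≠ 0 := hr.1.ne'
    simp only [hF]
    field_simp
    ring

/-- Existence, regularity at the singular point `r = 0` and uniqueness
for the rotational `[φ,e₃]`-minimal equation
`u'' = (1 + u'²)(φ'(u) - u'/r)` with `u(0) = u₀ ∈ (a,b)`, `u'(0) = 0`:
there is a C² solution on some `[0,R]` with `u''(0) = φ'(u₀)/2`, and any two such
solutions agree on their common domain. -/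
theorem stmt_8 (a b : EReal) (hab : a < b) (φ φ' : ℝ → ℝ)
    (hφsm : ContDiffOn ℝ (⊤ : ℕ∞) φ {t : ℝ | a < (t : EReal) ∧ (t : EReal) < b})
    (hφd : ∀ t : ℝ, a < (t : EReal) → (t : EReal) < b → HasDerivAt φ (φ' t) t)
    (u₀ : ℝ) (hu₀l : a < (u₀ : EReal)) (hu₀r : (u₀ : EReal) < b) :
    -- existence
    (∃ R > (0 : ℝ), ∃ u u' u'' : ℝ → ℝ,
      (∀ r ∈ Icc (0 : ℝ) R, a < (u r : EReal) ∧ (u r : EReal) < b) ∧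
      (∀ r ∈ Icc (0 : ℝ) R, HasDerivWithinAt u (u' r) (Icc 0 R) r) ∧
      (∀ r ∈ Icc (0 : ℝ) R, HasDerivWithinAt u' (u'' r) (Icc 0 R) r) ∧
      ContinuousOn u'' (Icc 0 R) ∧
      u 0 = u₀ ∧ u' 0 = 0 ∧ u'' 0 = φ' u₀ / 2 ∧
      (∀ r ∈ Ioc (0 : ℝ) R, u'' r = (1 + u' r ^ 2) * (φ' (u r) - u' r / r))) ∧
    -- uniqueness on the common domain
    (∀ (R₁ R₂ : ℝ), 0 < R₁ → 0 < R₂ →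
      ∀ u₁ u₁' u₁'' u₂ u₂' u₂'' : ℝ → ℝ,
      (∀ r ∈ Icc (0 : ℝ) R₁, a < (u₁ r : EReal) ∧ (u₁ r : EReal) < b) →
      (∀ r ∈ Icc (0 : ℝ) R₁, HasDerivWithinAt u₁ (u₁' r) (Icc 0 R₁) r) →
      (∀ r ∈ Icc (0 : ℝ) R₁, HasDerivWithinAt u₁' (u₁'' r) (Icc 0 R₁) r) →
      ContinuousOn u₁'' (Icc 0 R₁) →
      u₁ 0 = u₀ → u₁' 0 = 0 →
      (∀ r ∈ Ioc (0 : ℝ) R₁, u₁'' r = (1 + u₁' r ^ 2) * (φ' (u₁ r) - u₁' r / r)) →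
      (∀ r ∈ Icc (0 : ℝ) R₂, a < (u₂ r : EReal) ∧ (u₂ r : EReal) < b) →
      (∀ r ∈ Icc (0 : ℝ) R₂, HasDerivWithinAt u₂ (u₂' r) (Icc 0 R₂) r) →
      (∀ r ∈ Icc (0 : ℝ) R₂, HasDerivWithinAt u₂' (u₂'' r) (Icc 0 R₂) r) →
      ContinuousOn u₂'' (Icc 0 R₂) →
      u₂ 0 = u₀ → u₂' 0 = 0 →
      (∀ r ∈ Ioc (0 : ℝ) R₂, u₂'' r = (1 + u₂' r ^ 2) * (φ' (u₂ r) - u₂' r / r)) →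
      ∀ r ∈ Icc (0 : ℝ) (min R₁ R₂), u₁ r = u₂ r) := by
  set S : Set ℝ := {t : ℝ | a < (t : EReal) ∧ (t : EReal) < b} with hSdef
  have hS : IsOpen S := by
    have h1 : IsOpen {t : ℝ | a < (t : EReal)} := isOpen_lt continuous_const continuous_coe_real_ereal
    have h2 : IsOpen {t : ℝ | (t : EReal) < b} := isOpen_lt continuous_coe_real_ereal continuous_const
    exact h1.inter h2
  have hSo : S.OrdConnected := by
    refine ⟨fun x hx y hy z hz => ⟨hx.1.trans_le ?_, lt_of_le_of_lt ?_ hy.2⟩⟩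
    · exact_mod_cast hz.1
    · exact_mod_cast hz.2
  have hSc : Convex ℝ S := hSo.convex
  have hd : ∀ t ∈ S, HasDerivAt φ (φ' t) t := fun t ht => hφd t ht.1 ht.2
  constructor
  · obtain ⟨δ, hδ, hball⟩ := Metric.nhds_basis_closedBall.mem_iff.1 (hS.mem_nhds ⟨hu₀l, hu₀r⟩)
    rw [Real.closedBall_eq_Icc] at hball
    obtain ⟨K, B, hK, hB, hb, hl⟩ :=
      lip_aux S hS φ φ' hφsm hd _ hball isCompact_Icc (convex_Icc _ _)
    have hle : u₀ - δ ≤ u₀ + δ := by linarith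
    set G : ℝ → ℝ := fun x => φ' (projIcc (u₀ - δ) (u₀ + δ) hle x) with hG
    have hGl : ∀ x y, |G x - G y| ≤ K * |x - y| := by
      intro x y
      refine (hl _ (Subtype.mem _) _ (Subtype.mem _)).trans ?_
      have := (LipschitzWith.projIcc hle).dist_le_mul x y
      rw [NNReal.coe_one, one_mul, Subtype.dist_eq, Real.dist_eq, Real.dist_eq] at this
      gcongr
    have hGc : Continuous G := by
      have : LipschitzWith (Real.toNNReal K) G := by
        apply LipschitzWith.of_dist_le_mul
        intro x y
        rw [Real.dist_eq, Real.dist_eq, Real.coe_toNNReal K hK]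
        exact hGl x y
      exact this.continuous
    obtain ⟨R, hR, q, hq, hUb, hfix⟩ := exist_aux G K B u₀ δ hK hB hδ
      (fun x => hb _ (Subtype.mem _)) hGl hGc
    obtain ⟨u', u'', h1, h2, h3, h4, h5, h6⟩ := exist_deriv G hGc u₀ R hR q hq hfix
    have hGe : ∀ x, |x - u₀| ≤ δ → G x = φ' x := by
      intro x hx
      rw [abs_le] at hx
      have hx' : x ∈ Icc (u₀ - δ) (u₀ + δ) := ⟨by linarith, by linarith⟩
      simp only [hG]
      rw [projIcc_of_mem hle hx']
    refine ⟨R, hR, Uq u₀ q, u', u'', ?_, h1, h2, h3, by simp [Uq], h4, ?_, ?_⟩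
    · intro r hr
      have hx := hUb r hr
      rw [abs_le] at hx
      exact hball ⟨by linarith, by linarith⟩
    · rw [h5, hGe u₀ (by simpa using hδ.le)]
    · intro r hr
      rw [h6 r hr, hGe _ (hUb r (Ioc_subset_Icc_self hr))]
  · intro R₁ R₂ hR₁ hR₂ u₁ u₁' u₁'' u₂ u₂' u₂'' m1 d1 dd1 _ i1 i1' e1 m2 d2 dd2 _ i2 i2' e2
    have s1 : Icc 0 (min R₁ R₂) ⊆ Icc 0 R₁ := Icc_subset_Icc_right (min_le_left _ _)
    have s2 : Icc 0 (min R₁ R₂) ⊆ Icc 0 R₂ := Icc_subset_Icc_right (min_le_right _ _)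
    have t1 : Ioc 0 (min R₁ R₂) ⊆ Ioc 0 R₁ := Ioc_subset_Ioc_right (min_le_left _ _)
    have t2 : Ioc 0 (min R₁ R₂) ⊆ Ioc 0 R₂ := Ioc_subset_Ioc_right (min_le_right _ _)
    exact uniq_aux S hS hSc φ φ' hφsm hd (min R₁ R₂) (le_min hR₁.le hR₂.le) u₁ u₁' u₁'' u₂ u₂' u₂''
      (fun r hr => m1 r (s1 hr)) (fun r hr => (d1 r (s1 hr)).mono s1)
      (fun r hr => (dd1 r (s1 hr)).mono s1) (fun r hr => e1 r (t1 hr))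
      (fun r hr => m2 r (s2 hr)) (fun r hr => (d2 r (s2 hr)).mono s2)
      (fun r hr => (dd2 r (s2 hr)).mono s2) (fun r hr => e2 r (t2 hr))
      (i1.trans i2.symm) (i1'.trans i2'.symm)
end

section
/- Let a ∈ ℝ ∪ {−∞} and let φ : (a,∞) → ℝ be smooth with φ'(t) > 0 and φ''(t) ≥ 0 for all t, and suppose φ has quadratic growth with α > 0 and β ∈ ℝ, i.e. lim_{t→∞} φ''(t) = α and lim_{t→∞} (φ'(t) − α·t) = β. Let r₀ > 0, u₀ ∈ (a,∞) and u₁ ≥ 0 with φ'(u₀)·r₀ ≥ u₁. Then the problem u''(r) = (1 + u'(r)²)·(φ'(u(r)) − u'(r)/r), u(r₀) = u₀, u'(r₀) = u₁ has a unique solution u, it is defined on all of [r₀, ∞), and it is strictly convex. Moreover, as r → ∞: (i) lim_{r→∞} log(φ'(u(r)))/r² = α/2; and (ii) lim_{r→∞} (φ'(u(r))²/r)·(u'(r)/φ'(u(r)) − r) = −α; equivalently, u'(r)/φ'(u(r)) = r − α·r·φ'(u(r))^{−2} + o(r·φ'(u(r))^{−2}). -/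
open Set Filter
open scoped Topology

/-- The vector field. -/
noncomputable def rotField (ψ : ℝ → ℝ) (r : ℝ) (p : ℝ × ℝ) : ℝ × ℝ :=
  (p.2, (1 + p.2 ^ 2) * (ψ p.1 - p.2 / r))

lemma barrier {f f' : ℝ → ℝ} {s t c : ℝ} (hst : s ≤ t) (hc : ContinuousOn f (Icc s t))
    (hd : ∀ x ∈ Ioo s t, HasDerivAt f (f' x) x)
    (hs : c ≤ f s) (h : ∀ x ∈ Ioo s t, f x < c → 0 ≤ f' x) : c ≤ f t := by
  by_contra hlt
  push Not at hlt
  set A := {x ∈ Icc s t | c ≤ f x} with hA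
  have hAcl : IsClosed A := hc.preimage_isClosed_of_isClosed isClosed_Icc isClosed_Ici
  have hAc : IsCompact A := isCompact_Icc.of_isClosed_subset hAcl (fun x hx => hx.1)
  have hne : A.Nonempty := ⟨s, left_mem_Icc.2 hst, hs⟩
  have hm := hAc.sSup_mem hne
  set τ := sSup A
  have hout : ∀ x ∈ Ioc τ t, f x < c := by
    intro x hx
    by_contra hcon
    push Not at hcon
    have : x ∈ A := ⟨⟨hm.1.1.trans hx.1.le, hx.2⟩, hcon⟩
    exact absurd (le_csSup hAc.bddAbove this) (not_le.2 hx.1)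
  have hmono : MonotoneOn f (Icc τ t) := by
    apply monotoneOn_of_deriv_nonneg (convex_Icc _ _) (hc.mono (Icc_subset_Icc_left hm.1.1))
    · intro x hx
      rw [interior_Icc] at hx
      exact (hd x ⟨hm.1.1.trans_lt hx.1, hx.2⟩).differentiableAt.differentiableWithinAt
    · intro x hx
      rw [interior_Icc] at hx
      have hx' : x ∈ Ioo s t := ⟨hm.1.1.trans_lt hx.1, hx.2⟩
      rw [(hd x hx').deriv]
      exact h x hx' (hout x ⟨hx.1, hx.2.le⟩)
  have := hmono (left_mem_Icc.2 hm.1.2) (right_mem_Icc.2 hm.1.2) hm.1.2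
  have h2 := hm.2
  linarith

lemma eventually_barrier {f f' : ℝ → ℝ} {R c : ℝ}
    (hd : ∀ x, R < x → HasDerivAt f (f' x) x)
    (h : ∀ x, R < x → f x < c → 1 ≤ f' x) : ∀ᶠ x in atTop, c ≤ f x := by
  have hcont : ∀ s, R < s → ∀ t, ContinuousOn f (Icc s t) := fun s hs t x hx =>
    (hd x (hs.trans_le hx.1)).continuousAt.continuousWithinAt
  by_cases hex : ∃ s, R < s ∧ c ≤ f s
  · obtain ⟨s, hs, hcs⟩ := hex
    filter_upwards [eventually_ge_atTop s] with t ht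
    refine barrier ht (hcont s hs t) (fun x hx => hd x (hs.trans hx.1)) hcs ?_
    intro x hx hxc
    linarith [h x (hs.trans hx.1) hxc]
  · push Not at hex
    exfalso
    set s := R + 1
    set t := s + (c - f s) with ht
    have hs : R < s := by simp [s]
    have hst : s ≤ t := by have := hex s hs; linarith
    have := (convex_Icc s t).mul_sub_le_image_sub_of_le_deriv (C := 1) (hcont s hs t)
      (fun x hx => by
        rw [interior_Icc] at hx
        exact (hd x (hs.trans hx.1)).differentiableAt.differentiableWithinAt)
      (fun x hx => by
        rw [interior_Icc] at hx
        rw [(hd x (hs.trans hx.1)).deriv]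
        exact h x (hs.trans hx.1) (hex x (hs.trans hx.1)))
      s (left_mem_Icc.2 hst) t (right_mem_Icc.2 hst) hst
    have := hex t (hs.trans_le hst)
    linarith

lemma field_contDiff {ψ : ℝ → ℝ} {S : Set ℝ} (hψ : ContDiffOn ℝ 1 ψ S) :
    ContDiffOn ℝ 1 (fun q : ℝ × ℝ × ℝ => rotField ψ q.1 q.2) (Ioi 0 ×ˢ S ×ˢ univ) := by
  unfold rotField
  have h1 : ContDiffOn ℝ 1 (fun q : ℝ × ℝ × ℝ => ψ q.2.1) (Ioi 0 ×ˢ S ×ˢ univ) :=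
    hψ.comp (f := fun q : ℝ × ℝ × ℝ => q.2.1) (by fun_prop) (fun q hq => hq.2.1)
  have h2 : ContDiffOn ℝ 1 (fun q : ℝ × ℝ × ℝ => q.2.2 / q.1) (Ioi 0 ×ˢ S ×ˢ univ) :=
    ContDiffOn.div (by fun_prop) (by fun_prop) (fun q hq => ne_of_gt hq.1)
  exact ContDiffOn.prodMk (by fun_prop) (ContDiffOn.mul (by fun_prop) (h1.sub h2))

lemma field_lip {ψ : ℝ → ℝ} {S : Set ℝ} (hψ : ContDiffOn ℝ 1 ψ S) {r₀ T m M c d : ℝ}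
    (hr₀ : 0 < r₀) (hS : Icc m M ⊆ S) :
    ∃ K, ∀ r ∈ Icc r₀ T, LipschitzOnWith K (rotField ψ r) (Icc m M ×ˢ Icc c d) := by
  have hsub : Icc r₀ T ×ˢ Icc m M ×ˢ Icc c d ⊆ Ioi 0 ×ˢ S ×ˢ (univ : Set ℝ) :=
    fun q hq => ⟨hr₀.trans_le hq.1.1, hS hq.2.1, trivial⟩
  obtain ⟨K, hK⟩ := ((field_contDiff hψ).mono hsub).exists_lipschitzOnWith one_ne_zero
    ((convex_Icc _ _).prod ((convex_Icc _ _).prod (convex_Icc _ _)))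
    (isCompact_Icc.prod (isCompact_Icc.prod isCompact_Icc))
  refine ⟨K, fun r hr p hp q hq => ?_⟩
  have := hK (x := (r, p)) ⟨hr, hp⟩ (y := (r, q)) ⟨hr, hq⟩
  simpa [Prod.edist_eq] using this

lemma field_bound {ψ : ℝ → ℝ} {S : Set ℝ} (hψ : ContDiffOn ℝ 1 ψ S) {r₀ T m M c d : ℝ}
    (hr₀ : 0 < r₀) (hS : Icc m M ⊆ S) :
    ∃ L, ∀ r ∈ Icc r₀ T, ∀ p ∈ Icc m M ×ˢ Icc c d, ‖rotField ψ r p‖ ≤ L := by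
  have hsub : Icc r₀ T ×ˢ Icc m M ×ˢ Icc c d ⊆ Ioi 0 ×ˢ S ×ˢ (univ : Set ℝ) :=
    fun q hq => ⟨hr₀.trans_le hq.1.1, hS hq.2.1, trivial⟩
  obtain ⟨L, hL⟩ := (isCompact_Icc.prod (isCompact_Icc.prod isCompact_Icc)).exists_bound_of_continuousOn
    ((field_contDiff hψ).mono hsub).continuousOn
  exact ⟨L, fun r hr p hp => hL (r, p) ⟨hr, hp⟩⟩

lemma sol_unique {ψ : ℝ → ℝ} {S : Set ℝ} (hψ : ContDiffOn ℝ 1 ψ S) (hS : S.OrdConnected)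
    {r₀ T : ℝ} (hr₀ : 0 < r₀) (hT : r₀ ≤ T) {p q : ℝ → ℝ × ℝ}
    (hp : ∀ r ∈ Icc r₀ T, HasDerivWithinAt p (rotField ψ r (p r)) (Icc r₀ T) r)
    (hq : ∀ r ∈ Icc r₀ T, HasDerivWithinAt q (rotField ψ r (q r)) (Icc r₀ T) r)
    (hpS : ∀ r ∈ Icc r₀ T, (p r).1 ∈ S) (hqS : ∀ r ∈ Icc r₀ T, (q r).1 ∈ S)
    (h0 : p r₀ = q r₀) : EqOn p q (Icc r₀ T) := by
  have hpc : ContinuousOn p (Icc r₀ T) := fun r hr => (hp r hr).continuousWithinAt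
  have hqc : ContinuousOn q (Icc r₀ T) := fun r hr => (hq r hr).continuousWithinAt
  set B := p '' Icc r₀ T ∪ q '' Icc r₀ T with hB
  have hBc : IsCompact B := (isCompact_Icc.image_of_continuousOn hpc).union
    (isCompact_Icc.image_of_continuousOn hqc)
  have hne : B.Nonempty := ⟨p r₀, Or.inl ⟨r₀, left_mem_Icc.2 hT, rfl⟩⟩
  obtain ⟨xm, hxm, hm⟩ := hBc.exists_isMinOn hne continuous_fst.continuousOn
  obtain ⟨xM, hxM, hM⟩ := hBc.exists_isMaxOn hne continuous_fst.continuousOn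
  obtain ⟨ym, hym, hc⟩ := hBc.exists_isMinOn hne continuous_snd.continuousOn
  obtain ⟨yM, hyM, hd⟩ := hBc.exists_isMaxOn hne continuous_snd.continuousOn
  have hBS : ∀ x ∈ B, x.1 ∈ S := by
    rintro x (⟨r, hr, rfl⟩ | ⟨r, hr, rfl⟩)
    · exact hpS r hr
    · exact hqS r hr
  obtain ⟨K, hK⟩ := field_lip hψ (T := T) (c := ym.2) (d := yM.2) hr₀
    (hS.out (hBS _ hxm) (hBS _ hxM))
  have hbox : ∀ x ∈ B, x ∈ Icc xm.1 xM.1 ×ˢ Icc ym.2 yM.2 := fun x hx =>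
    ⟨⟨hm hx, hM hx⟩, ⟨hc hx, hd hx⟩⟩
  have key : ∀ {g : ℝ → ℝ × ℝ} {r : ℝ} {g'}, r ∈ Ico r₀ T → HasDerivWithinAt g g' (Icc r₀ T) r →
      HasDerivWithinAt g g' (Ici r) r := by
    intro g r g' hr hg
    exact (hg.mono (Icc_subset_Icc_left hr.1)).mono_of_mem_nhdsWithin (Icc_mem_nhdsGE hr.2)
  exact ODE_solution_unique_of_mem_Icc_right (v := rotField ψ)
    (s := fun _ => Icc xm.1 xM.1 ×ˢ Icc ym.2 yM.2) (K := K)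
    (fun r hr => hK r (Ico_subset_Icc_self hr)) hpc
    (fun r hr => key hr (hp r (Ico_subset_Icc_self hr)))
    (fun r hr => hbox _ (Or.inl ⟨r, Ico_subset_Icc_self hr, rfl⟩)) hqc
    (fun r hr => key hr (hq r (Ico_subset_Icc_self hr)))
    (fun r hr => hbox _ (Or.inr ⟨r, Ico_subset_Icc_self hr, rfl⟩)) h0

lemma sol_exists {ψ : ℝ → ℝ} {S : Set ℝ} (hψ : ContDiffOn ℝ 1 ψ S) {r₀ T C u₀ u₁ : ℝ}
    (hr₀ : 0 < r₀) (hT : r₀ ≤ T) (hS : Ici u₀ ⊆ S) (hC : 0 < C)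
    (hpos : ∀ t, u₀ ≤ t → 0 < ψ t)
    (hgrow : ∀ t, u₀ ≤ t → ψ t ≤ C * (1 + t - u₀))
    (hu₁ : 0 ≤ u₁) (hu₁C : u₁ ≤ C * r₀) :
    ∃ p : ℝ → ℝ × ℝ, p r₀ = (u₀, u₁) ∧
      (∀ r ∈ Icc r₀ T, HasDerivWithinAt p (rotField ψ r (p r)) (Icc r₀ T) r) ∧
      (∀ r ∈ Icc r₀ T, u₀ ≤ (p r).1) ∧ (∀ r ∈ Icc r₀ T, 0 ≤ (p r).2) := by
  set E : ℝ → ℝ := fun r => Real.exp (C * (r ^ 2 - r₀ ^ 2) / 2) with hE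
  have hEd : ∀ r, HasDerivAt E (C * r * E r) r := by
    intro r
    have h1 : HasDerivAt (fun r : ℝ => C * (r ^ 2 - r₀ ^ 2) / 2) (C * r) r := by
      have := ((((hasDerivAt_id r).pow 2).sub_const (r₀ ^ 2)).const_mul C).div_const 2
      convert! this using 1
      simp; ring
    have := h1.exp
    convert! this using 1
    simp [hE]; ring
  have hEpos : ∀ r, 0 < E r := fun r => Real.exp_pos _
  have hE0 : E r₀ = 1 := by simp [hE]
  have hEmono : ∀ {r s}, r₀ ≤ r → r ≤ s → E r ≤ E s := by
    intro r s h1 h2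
    apply Real.exp_le_exp.2
    have : r ^ 2 ≤ s ^ 2 := by nlinarith
    have := mul_le_mul_of_nonneg_left this hC.le
    nlinarith
  have hEc : Continuous E := continuous_iff_continuousAt.2 fun r => (hEd r).continuousAt
  have hE1 : ∀ {r}, r₀ ≤ r → 1 ≤ E r := fun h => hE0 ▸ hEmono le_rfl h
  set cx : ℝ → ℝ → ℝ := fun r x => max u₀ (min x (u₀ - 1 + E r)) with hcx
  set cy : ℝ → ℝ → ℝ := fun r y => max 0 (min y (C * r * E r)) with hcy
  have hV : ∀ {r}, r₀ ≤ r → 0 ≤ C * r * E r := fun {r} h => by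
    have := hEpos r
    have : 0 < r := hr₀.trans_le h
    positivity
  have hVmono : ∀ {r}, r ∈ Icc r₀ T → C * r * E r ≤ C * T * E T := by
    intro r hr
    have h1 := hEmono hr.1 hr.2
    have h2 : C * r ≤ C * T := mul_le_mul_of_nonneg_left hr.2 hC.le
    have h3 : 0 ≤ C * T := mul_nonneg hC.le (hr₀.le.trans hT)
    exact mul_le_mul h2 h1 (hEpos r).le h3
  have hcxmem : ∀ r ∈ Icc r₀ T, ∀ x, cx r x ∈ Icc u₀ (u₀ - 1 + E T) := by
    intro r hr x
    refine ⟨le_max_left _ _, max_le (by linarith [hE1 hT]) ((min_le_right _ _).trans ?_)⟩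
    linarith [hEmono hr.1 hr.2]
  have hcymem : ∀ r ∈ Icc r₀ T, ∀ y, cy r y ∈ Icc 0 (C * T * E T) := by
    intro r hr y
    exact ⟨le_max_left _ _, max_le (hV hT) ((min_le_right _ _).trans (hVmono hr))⟩
  have hboxS : Icc u₀ (u₀ - 1 + E T) ⊆ S := fun x hx => hS hx.1
  obtain ⟨K, hK⟩ := field_lip hψ (T := T) (c := 0) (d := C * T * E T) hr₀ hboxS
  obtain ⟨L, hL⟩ := field_bound hψ (T := T) (c := 0) (d := C * T * E T) hr₀ hboxS
  set f : ℝ → ℝ × ℝ → ℝ × ℝ := fun r p => rotField ψ r (cx r p.1, cy r p.2) with hf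
  have hmem : ∀ r ∈ Icc r₀ T, ∀ p : ℝ × ℝ,
      ((cx r p.1, cy r p.2) : ℝ × ℝ) ∈ Icc u₀ (u₀ - 1 + E T) ×ˢ Icc 0 (C * T * E T) :=
    fun r hr p => ⟨hcxmem r hr _, hcymem r hr _⟩
  have hflip : ∀ r ∈ Icc r₀ T, LipschitzWith K (f r) := by
    intro r hr
    have hc : LipschitzWith 1 (fun p : ℝ × ℝ => ((cx r p.1, cy r p.2) : ℝ × ℝ)) := by
      have h1 : LipschitzWith 1 (fun p : ℝ × ℝ => cx r p.1) :=
        (LipschitzWith.prod_fst.min_const _).const_max _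
      have h2 : LipschitzWith 1 (fun p : ℝ × ℝ => cy r p.2) :=
        (LipschitzWith.prod_snd.min_const _).const_max _
      simpa using h1.prodMk h2
    have := (hK r hr).comp (hc.lipschitzOnWith (s := univ)) (fun p _ => hmem r hr p)
    rw [mul_one] at this
    exact lipschitzOnWith_univ.1 this
  have hL0 : 0 ≤ L := (norm_nonneg _).trans (hL r₀ (left_mem_Icc.2 hT) _ (hmem r₀ (left_mem_Icc.2 hT) (0, 0)))
  have hPL : IsPicardLindelof f (tmin := r₀) (tmax := T) ⟨r₀, left_mem_Icc.2 hT⟩ (u₀, u₁)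
      (L.toNNReal * (T - r₀).toNNReal) 0 L.toNNReal K := by
    refine ⟨fun r hr => (hflip r hr).lipschitzOnWith, fun p _ => ?_, fun r hr p _ => ?_, ?_⟩
    · have hsub : MapsTo (fun r => ((r, cx r p.1, cy r p.2) : ℝ × ℝ × ℝ)) (Icc r₀ T)
          (Ioi 0 ×ˢ S ×ˢ (univ : Set ℝ)) :=
        fun r hr => ⟨hr₀.trans_le hr.1, hboxS (hcxmem r hr _), trivial⟩
      refine (field_contDiff hψ).continuousOn.comp (f := fun r => ((r, cx r p.1, cy r p.2) : ℝ × ℝ × ℝ)) ?_ hsub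
      apply Continuous.continuousOn
      simp only [hcx, hcy]
      fun_prop
    · rw [Real.coe_toNNReal _ hL0]
      exact hL r hr _ (hmem r hr p)
    · have : 0 ≤ T - r₀ := sub_nonneg.2 hT
      simp [this]
  obtain ⟨p, hp0, hp⟩ := hPL.exists_eq_forall_mem_Icc_hasDerivWithinAt₀
  simp only at hp0
  have hpd : ∀ r ∈ Ioo r₀ T, HasDerivAt p (f r (p r)) r := fun r hr =>
    (hp r (Ioo_subset_Icc_self hr)).hasDerivAt (Icc_mem_nhds hr.1 hr.2)
  have hpc : ContinuousOn p (Icc r₀ T) := fun r hr => (hp r hr).continuousWithinAt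
  have hp1c : ContinuousOn (fun r => (p r).1) (Icc r₀ T) := continuous_fst.comp_continuousOn hpc
  have hp2c : ContinuousOn (fun r => (p r).2) (Icc r₀ T) := continuous_snd.comp_continuousOn hpc
  have hd1 : ∀ r ∈ Ioo r₀ T, HasDerivAt (fun r => (p r).1) (cy r (p r).2) r := fun r hr =>
    (hpd r hr).fst
  have hd2 : ∀ r ∈ Ioo r₀ T, HasDerivAt (fun r => (p r).2)
      ((1 + cy r (p r).2 ^ 2) * (ψ (cx r (p r).1) - cy r (p r).2 / r)) r := fun r hr =>
    (hpd r hr).snd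
  have hsubI : ∀ {t}, t ∈ Icc r₀ T → Icc r₀ t ⊆ Icc r₀ T := fun ht => Icc_subset_Icc_right ht.2
  have hsubO : ∀ {t}, t ∈ Icc r₀ T → Ioo r₀ t ⊆ Ioo r₀ T := fun ht => Ioo_subset_Ioo_right ht.2
  -- lower bound for the first component
  have b1 : ∀ t ∈ Icc r₀ T, u₀ ≤ (p t).1 := by
    intro t ht
    refine barrier ht.1 (hp1c.mono (hsubI ht)) (fun r hr => hd1 r (hsubO ht hr)) (by simp [hp0]) ?_
    intro r hr _
    exact le_max_left _ _
  have b2 : ∀ t ∈ Icc r₀ T, 0 ≤ (p t).2 := by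
    intro t ht
    refine barrier ht.1 (hp2c.mono (hsubI ht)) (fun r hr => hd2 r (hsubO ht hr)) (by simp [hp0, hu₁]) ?_
    intro r hr hlt
    have h0 : cy r (p r).2 = 0 := max_eq_left ((min_le_left _ _).trans hlt.le)
    rw [h0]
    have := hpos (cx r (p r).1) (le_max_left _ _)
    simp [this.le]
  have b3 : ∀ t ∈ Icc r₀ T, (p t).2 ≤ C * t * E t := by
    intro t ht
    have hVd : ∀ r, HasDerivAt (fun r => C * r * E r) (C * E r + C * r * (C * r * E r)) r := by
      intro r
      have := ((hasDerivAt_id r).const_mul C).mul (hEd r)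
      convert! this using 1
      simp
    have := barrier (f := fun r => C * r * E r - (p r).2) (c := 0) ht.1
      ((Continuous.continuousOn (by fun_prop)).sub (hp2c.mono (hsubI ht)))
      (fun r hr => (hVd r).sub (hd2 r (hsubO ht hr))) (by simp [hp0, hE0, hu₁C]) ?_
    · linarith
    intro r hr hlt
    have hr0 : 0 < r := hr₀.trans hr.1
    have h0 : cy r (p r).2 = C * r * E r := by
      simp only [hcy]
      rw [min_eq_right (by linarith), max_eq_right (hV hr.1.le)]
    have h1 : ψ (cx r (p r).1) ≤ C * E r := by
      refine (hgrow _ (le_max_left _ _)).trans ?_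
      apply mul_le_mul_of_nonneg_left _ hC.le
      have : cx r (p r).1 ≤ u₀ - 1 + E r :=
        max_le (by linarith [hE1 hr.1.le]) (min_le_right _ _)
      linarith
    have h2 : cy r (p r).2 / r = C * E r := by
      rw [h0]; field_simp
    rw [h2]
    have h3 : (1 + cy r (p r).2 ^ 2) * (ψ (cx r (p r).1) - C * E r) ≤ 0 :=
      mul_nonpos_of_nonneg_of_nonpos (by positivity) (by linarith)
    have := hEpos r
    have : 0 ≤ C * E r + C * r * (C * r * E r) := by positivity
    linarith
  have hcyeq : ∀ t ∈ Icc r₀ T, cy t (p t).2 = (p t).2 := by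
    intro t ht
    simp only [hcy]
    rw [min_eq_left (b3 t ht), max_eq_right (b2 t ht)]
  have b4 : ∀ t ∈ Icc r₀ T, (p t).1 ≤ u₀ - 1 + E t := by
    intro t ht
    have := barrier (f := fun r => u₀ - 1 + E r - (p r).1) (c := 0) ht.1
      ((Continuous.continuousOn (by fun_prop)).sub (hp1c.mono (hsubI ht)))
      (fun r hr => ((hEd r).const_add _).sub (hd1 r (hsubO ht hr))) (by simp [hp0, hE0]) ?_
    · linarith
    intro r hr _
    have hr' := Ioo_subset_Icc_self (hsubO ht hr)
    rw [hcyeq r hr']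
    linarith [b3 r hr']
  have hcxeq : ∀ t ∈ Icc r₀ T, cx t (p t).1 = (p t).1 := by
    intro t ht
    simp only [hcx]
    rw [min_eq_left (b4 t ht), max_eq_right (b1 t ht)]
  refine ⟨p, hp0, fun r hr => ?_, b1, b2⟩
  have := hp r hr
  simp only [hf, hcxeq r hr, hcyeq r hr] at this
  exact this

lemma sol_global {ψ : ℝ → ℝ} {S : Set ℝ} (hψ : ContDiffOn ℝ 1 ψ S) (hSc : S.OrdConnected)
    {r₀ C u₀ u₁ : ℝ}
    (hr₀ : 0 < r₀) (hS : Ici u₀ ⊆ S) (hC : 0 < C)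
    (hpos : ∀ t, u₀ ≤ t → 0 < ψ t)
    (hgrow : ∀ t, u₀ ≤ t → ψ t ≤ C * (1 + t - u₀))
    (hu₁ : 0 ≤ u₁) (hu₁C : u₁ ≤ C * r₀) :
    ∃ p : ℝ → ℝ × ℝ, p r₀ = (u₀, u₁) ∧
      (∀ r ∈ Ici r₀, HasDerivWithinAt p (rotField ψ r (p r)) (Ici r₀) r) ∧
      (∀ r ∈ Ici r₀, u₀ ≤ (p r).1) ∧ (∀ r ∈ Ici r₀, 0 ≤ (p r).2) := by
  have hex : ∀ T, ∃ p : ℝ → ℝ × ℝ, r₀ ≤ T → p r₀ = (u₀, u₁) ∧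
      (∀ r ∈ Icc r₀ T, HasDerivWithinAt p (rotField ψ r (p r)) (Icc r₀ T) r) ∧
      (∀ r ∈ Icc r₀ T, u₀ ≤ (p r).1) ∧ (∀ r ∈ Icc r₀ T, 0 ≤ (p r).2) := by
    intro T
    by_cases hT : r₀ ≤ T
    · obtain ⟨p, hp⟩ := sol_exists hψ hr₀ hT hS hC hpos hgrow hu₁ hu₁C
      exact ⟨p, fun _ => hp⟩
    · exact ⟨fun _ => 0, fun h => absurd h hT⟩
  choose P hP using hex
  have hagree : ∀ T T', r₀ ≤ T → T ≤ T' → EqOn (P T) (P T') (Icc r₀ T) := by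
    intro T T' h1 h2
    obtain ⟨a0, a1, a2, _⟩ := hP T h1
    obtain ⟨b0, b1, b2, _⟩ := hP T' (h1.trans h2)
    have hsub : Icc r₀ T ⊆ Icc r₀ T' := Icc_subset_Icc_right h2
    exact sol_unique hψ hSc hr₀ h1 a1 (fun r hr => (b1 r (hsub hr)).mono hsub)
      (fun r hr => hS (a2 r hr)) (fun r hr => hS (b2 r (hsub hr))) (a0.trans b0.symm)
  have heq : ∀ T, r₀ ≤ T → EqOn (fun r => P r r) (P T) (Icc r₀ T) := by
    intro T hT r hr
    exact hagree r T hr.1 hr.2 (right_mem_Icc.2 hr.1)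
  refine ⟨fun r => P r r, (hP r₀ le_rfl).1, ?_, ?_, ?_⟩
  · intro r hr
    have hr' : r₀ ≤ r + 1 := le_trans hr (by linarith)
    have hmem : r ∈ Icc r₀ (r + 1) := ⟨hr, by linarith⟩
    have h1 := (hP (r + 1) hr').2.1 r hmem
    have h2 := h1.congr (heq _ hr') (heq _ hr' hmem)
    rw [← heq _ hr' hmem] at h2
    refine h2.mono_of_mem_nhdsWithin ?_
    rw [← Ici_inter_Iic]
    exact inter_mem self_mem_nhdsWithin (mem_nhdsWithin_of_mem_nhds (Iic_mem_nhds (by linarith)))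
  · intro r hr
    exact (hP r hr).2.2.1 r (right_mem_Icc.2 hr)
  · intro r hr
    exact (hP r hr).2.2.2 r (right_mem_Icc.2 hr)

lemma eventually_barrier' {f f' : ℝ → ℝ} {c : ℝ}
    (hd : ∀ᶠ x in atTop, HasDerivAt f (f' x) x)
    (h : ∀ᶠ x in atTop, f x < c → 1 ≤ f' x) : ∀ᶠ x in atTop, c ≤ f x := by
  obtain ⟨R, hR⟩ := (hd.and h).exists_forall_of_atTop
  exact eventually_barrier (R := R) (fun x hx => (hR x hx.le).1) (fun x hx => (hR x hx.le).2)

lemma slope_pos {ψ ψ' u v : ℝ → ℝ} {r₀ u₀ : ℝ} (hr₀ : 0 < r₀)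
    (hψd : ∀ t, u₀ ≤ t → HasDerivAt ψ (ψ' t) t)
    (hpos : ∀ t, u₀ ≤ t → 0 < ψ t) (hnn : ∀ t, u₀ ≤ t → 0 ≤ ψ' t)
    (huc : ContinuousOn u (Ici r₀)) (hvc : ContinuousOn v (Ici r₀))
    (hud : ∀ r, r₀ < r → HasDerivAt u (v r) r)
    (hvd : ∀ r, r₀ < r → HasDerivAt v ((1 + v r ^ 2) * (ψ (u r) - v r / r)) r)
    (hu : ∀ r, r₀ ≤ r → u₀ ≤ u r) (hv : ∀ r, r₀ ≤ r → 0 ≤ v r)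
    (h0 : v r₀ ≤ ψ (u r₀) * r₀) :
    ∀ r, r₀ < r → v r < r * ψ (u r) := by
  have hgd : ∀ r, r₀ < r → HasDerivAt (fun r => r * ψ (u r) - v r)
      (ψ (u r) + r * (ψ' (u r) * v r) - (1 + v r ^ 2) * (ψ (u r) - v r / r)) r := by
    intro r hr
    have := ((hasDerivAt_id r).mul ((hψd (u r) (hu r hr.le)).comp r (hud r hr))).sub (hvd r hr)
    convert! this using 1
    simp
  have hψc : ContinuousOn ψ (Ici u₀) := fun t ht => (hψd t ht).continuousAt.continuousWithinAt
  have hgc : ContinuousOn (fun r => r * ψ (u r) - v r) (Ici r₀) :=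
    (continuousOn_id.mul (hψc.comp huc (fun r hr => hu r hr))).sub hvc
  have key : ∀ r, r₀ < r → r * ψ (u r) - v r ≤ 0 →
      0 < ψ (u r) + r * (ψ' (u r) * v r) - (1 + v r ^ 2) * (ψ (u r) - v r / r) := by
    intro r hr hg
    have hr0 : 0 < r := hr₀.trans hr
    have h1 := hpos _ (hu r hr.le)
    have h2 : 0 ≤ r * (ψ' (u r) * v r) :=
      mul_nonneg hr0.le (mul_nonneg (hnn _ (hu r hr.le)) (hv r hr.le))
    have h3 : ψ (u r) - v r / r ≤ 0 := by
      have : ψ (u r) - v r / r = (r * ψ (u r) - v r) / r := by field_simp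
      rw [this]
      exact div_nonpos_of_nonpos_of_nonneg hg hr0.le
    have h4 : (1 + v r ^ 2) * (ψ (u r) - v r / r) ≤ 0 :=
      mul_nonpos_of_nonneg_of_nonpos (by positivity) h3
    linarith
  have hnonneg : ∀ r, r₀ ≤ r → 0 ≤ r * ψ (u r) - v r := by
    intro r hr
    refine barrier (f := fun r => r * ψ (u r) - v r) hr (hgc.mono Icc_subset_Ici_self)
      (fun x hx => hgd x hx.1) (by linarith) ?_
    intro x hx hlt
    exact (key x hx.1 hlt.le).le
  intro r hr
  by_contra hcon
  have hle : r * ψ (u r) - v r ≤ 0 := by linarith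
  have hzero : r * ψ (u r) - v r = 0 := le_antisymm hle (hnonneg r hr.le)
  have hmin : IsLocalMin (fun r => r * ψ (u r) - v r) r := by
    filter_upwards [Ioi_mem_nhds hr] with x hx
    rw [hzero]
    exact hnonneg x (le_of_lt hx)
  have := hmin.hasDerivAt_eq_zero (hgd r hr)
  linarith [key r hr hle]

lemma asymp {ψ ψ' u v : ℝ → ℝ} {r₀ u₀ α : ℝ} (hr₀ : 0 < r₀)
    (hψd : ∀ t, u₀ ≤ t → HasDerivAt ψ (ψ' t) t)
    (hpos : ∀ t, u₀ ≤ t → 0 < ψ t) (hnn : ∀ t, u₀ ≤ t → 0 ≤ ψ' t)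
    (hψ' : Tendsto ψ' atTop (𝓝 α)) (hψ : Tendsto ψ atTop atTop)
    (hud : ∀ r, r₀ < r → HasDerivAt u (v r) r)
    (hvd : ∀ r, r₀ < r → HasDerivAt v ((1 + v r ^ 2) * (ψ (u r) - v r / r)) r)
    (hu : ∀ r, r₀ ≤ r → u₀ ≤ u r) (hv : ∀ r, r₀ < r → 0 < v r)
    (hvm : StrictMonoOn v (Ici r₀))
    (hslope : ∀ r, r₀ < r → v r < r * ψ (u r)) :
    Tendsto (fun r => Real.log (ψ (u r)) / r ^ 2) atTop (𝓝 (α / 2)) ∧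
    Tendsto (fun r => ψ (u r) ^ 2 / r * (v r / ψ (u r) - r)) atTop (𝓝 (-α)) := by
  have hev : ∀ᶠ r : ℝ in atTop, r₀ < r := eventually_gt_atTop r₀
  have hev1 : ∀ᶠ r : ℝ in atTop, 1 ≤ r := eventually_ge_atTop 1
  -- `u → ∞`
  have hut : Tendsto u atTop atTop := by
    have hk : 0 < v (r₀ + 1) := hv _ (by linarith)
    have : Tendsto (fun r => u r / v (r₀ + 1)) atTop atTop := by
      refine tendsto_atTop.2 fun c => ?_
      refine eventually_barrier (R := r₀ + 1) (f' := fun r => v r / v (r₀ + 1))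
        (fun r hr => (hud r (by linarith)).div_const _) (fun r hr _ => ?_)
      rw [one_le_div hk]
      exact hvm.monotoneOn (by simp) (mem_Ici.2 (by linarith)) hr.le
    have h2 := this.atTop_mul_const hk
    refine h2.congr fun r => ?_
    field_simp
  set w : ℝ → ℝ := fun r => ψ (u r) with hw
  set p : ℝ → ℝ := fun r => ψ' (u r) with hp
  have hwt : Tendsto w atTop atTop := hψ.comp hut
  have hpt : Tendsto p atTop (𝓝 α) := hψ'.comp hut
  have hw2 : Tendsto (fun r => w r ^ 2) atTop atTop :=
    (tendsto_pow_atTop two_ne_zero).comp hwt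
  have hwpos : ∀ r, r₀ < r → 0 < w r := fun r hr => hpos _ (hu r hr.le)
  have hpnn : ∀ r, r₀ < r → 0 ≤ p r := fun r hr => hnn _ (hu r hr.le)
  have hwd : ∀ r, r₀ < r → HasDerivAt w (p r * v r) r := fun r hr =>
    (hψd (u r) (hu r hr.le)).comp r (hud r hr)
  set z : ℝ → ℝ := fun r => v r / (r * w r) with hz
  have hvz : ∀ r, r₀ < r → v r = r * w r * z r := by
    intro r hr
    have := hwpos r hr
    have : 0 < r := hr₀.trans hr
    simp only [hz]; field_simp
  have hz0 : ∀ r, r₀ < r → 0 < z r := fun r hr =>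
    div_pos (hv r hr) (mul_pos (hr₀.trans hr) (hwpos r hr))
  have hz1 : ∀ r, r₀ < r → z r < 1 := fun r hr =>
    (div_lt_one (mul_pos (hr₀.trans hr) (hwpos r hr))).2 (hslope r hr)
  have hzd : ∀ r, r₀ < r → HasDerivAt z
      ((1 - z r) / r + r * w r ^ 2 * z r ^ 2 * (1 - z r) - r * p r * z r ^ 2 - z r / r) r := by
    intro r hr
    have hwr := hwpos r hr
    have hr0 : 0 < r := hr₀.trans hr
    have h := (hvd r hr).div ((hasDerivAt_id r).mul (hwd r hr)) (mul_pos hr0 hwr).ne'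
    convert! h using 1
    have hψw : ψ (u r) = w r := rfl
    simp only [id, Pi.mul_apply, hψw]
    rw [hvz r hr]
    field_simp
    ring
  -- `z` is bounded below
  have hzlow : ∃ z₁, 0 < z₁ ∧ ∀ᶠ r in atTop, z₁ ≤ z r := by
    have h1 : ∀ᶠ r in atTop, 2 * (α + 1) ≤ w r ^ 2 := hw2.eventually_ge_atTop _
    have h2 : ∀ᶠ r in atTop, p r ≤ α + 1 := hpt.eventually_le_const (by linarith)
    obtain ⟨R, hR⟩ := (h1.and (h2.and hev)).exists_forall_of_atTop
    refine ⟨min (z R) (1 / 2), lt_min (hz0 R (hR R le_rfl).2.2) (by norm_num), ?_⟩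
    filter_upwards [eventually_ge_atTop R] with t ht
    refine barrier ht (fun x hx => (hzd x (hR x hx.1).2.2).continuousAt.continuousWithinAt)
      (fun x hx => hzd x (hR x hx.1.le).2.2) (min_le_left _ _) ?_
    intro x hx hlt
    obtain ⟨a1, a2, a3⟩ := hR x hx.1.le
    have hx0 : 0 < x := hr₀.trans a3
    have hlt' : z x < 1 / 2 := hlt.trans_le (min_le_right _ _)
    have e1 : 0 ≤ (1 - z x) / x - z x / x := by
      rw [← sub_div]
      exact div_nonneg (by linarith) hx0.le
    have e2 : 0 ≤ x * z x ^ 2 * (w x ^ 2 * (1 - z x) - p x) := by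
      refine mul_nonneg (by positivity) ?_
      nlinarith [sq_nonneg (w x)]
    nlinarith
  obtain ⟨z₁, hz₁, hzl⟩ := hzlow
  have hzt : Tendsto z atTop (𝓝 1) := by
    refine tendsto_order.2 ⟨fun c hc => ?_, fun c hc => ?_⟩
    · have hc' : c < (c + 1) / 2 := by linarith
      set d := (c + 1) / 2 with hd
      have hd1 : 0 < 1 - d := by simp only [hd]; linarith
      have h1 : ∀ᶠ r in atTop, (α + 1 + 2 / z₁ ^ 2) / (1 - d) ≤ w r ^ 2 :=
        hw2.eventually_ge_atTop _
      have h2 : ∀ᶠ r in atTop, p r ≤ α + 1 := hpt.eventually_le_const (by linarith)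
      have : ∀ᶠ r in atTop, d ≤ z r := by
        refine eventually_barrier' (hev.mono hzd) ?_
        filter_upwards [h1, h2, hev, hev1, hzl] with r a1 a2 a3 a4 a5 hlt
        have hr0 : 0 < r := hr₀.trans a3
        have e0 : 0 ≤ (1 - z r) / r := div_nonneg (by linarith [hz1 r a3]) hr0.le
        have e1 : z r / r ≤ 1 := by
          rw [div_le_one hr0]; linarith [hz1 r a3]
        rw [div_le_iff₀ hd1] at a1
        have e2 : 2 / z₁ ^ 2 ≤ w r ^ 2 * (1 - z r) - p r := by
          nlinarith [sq_nonneg (w r)]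
        have e3 : z₁ ^ 2 ≤ r * z r ^ 2 := by
          nlinarith [pow_le_pow_left₀ hz₁.le a5 2, sq_nonneg (z r)]
        have e4 : 2 ≤ r * z r ^ 2 * (w r ^ 2 * (1 - z r) - p r) := by
          calc (2 : ℝ) = z₁ ^ 2 * (2 / z₁ ^ 2) := by field_simp
            _ ≤ _ := mul_le_mul e3 e2 (by positivity) (by positivity)
        nlinarith
      filter_upwards [this] with r hr
      linarith
    · filter_upwards [hev] with r hr
      exact (hz1 r hr).trans hc
  set q : ℝ → ℝ := fun r => w r ^ 2 * (1 - z r) with hq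
  set A : ℝ → ℝ := fun r => 2 * p r * z r * (1 - z r) + p r * z r ^ 2 + (2 * z r - 1) / r ^ 2 with hA
  have hqd : ∀ r, r₀ < r → HasDerivAt q (r * w r ^ 2 * (A r - z r ^ 2 * q r)) r := by
    intro r hr
    have hwr := hwpos r hr
    have hr0 : 0 < r := hr₀.trans hr
    have h := ((hwd r hr).pow 2).mul ((hzd r hr).const_sub 1)
    convert! h using 1
    simp only [hA, hq]
    rw [hvz r hr]
    simp
    field_simp
    ring
  have hr2 : Tendsto (fun r : ℝ => r ^ 2) atTop atTop := tendsto_pow_atTop two_ne_zero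
  have hAt : Tendsto A atTop (𝓝 α) := by
    have h1 : Tendsto (fun r => (2 * z r - 1) / r ^ 2) atTop (𝓝 0) :=
      ((hzt.const_mul 2).sub_const 1).div_atTop hr2
    have := ((((hpt.const_mul 2).mul hzt).mul (hzt.const_sub 1)).add (hpt.mul (hzt.pow 2))).add h1
    simpa using this
  have hzz : Tendsto (fun r => z r ^ 2) atTop (𝓝 1) := by simpa using hzt.pow 2
  have hbig : ∀ ε : ℝ, 0 < ε → ∀ᶠ r in atTop, 2 / ε ≤ r * w r ^ 2 := by
    intro ε hε
    filter_upwards [hev1, hw2.eventually_ge_atTop (2 / ε)] with r a1 a2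
    nlinarith [sq_nonneg (w r)]
  have hqt : Tendsto q atTop (𝓝 α) := by
    refine tendsto_order.2 ⟨fun c hc => ?_, fun c hc => ?_⟩
    · set d := (c + α) / 2 with hd
      have hdε : 0 < α - d := by simp only [hd]; linarith
      have h1 : Tendsto (fun r => A r - z r ^ 2 * d) atTop (𝓝 (α - d)) := by
        simpa using hAt.sub (hzz.mul_const d)
      have : ∀ᶠ r in atTop, d ≤ q r := by
        refine eventually_barrier' (hev.mono hqd) ?_
        filter_upwards [h1.eventually_const_le (u := (α - d) / 2) (by linarith), hbig _ hdε] with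
          r a1 a2 hlt
        have e1 : (α - d) / 2 ≤ A r - z r ^ 2 * q r := by nlinarith [sq_nonneg (z r)]
        calc (1 : ℝ) = 2 / (α - d) * ((α - d) / 2) := by field_simp
          _ ≤ _ := mul_le_mul a2 e1 (by linarith) (le_trans (by positivity) a2)
      filter_upwards [this] with r hr
      have : c < d := by simp only [hd]; linarith
      linarith
    · set d := (c + α) / 2 with hd
      have hdε : 0 < d - α := by simp only [hd]; linarith
      have h1 : Tendsto (fun r => z r ^ 2 * d - A r) atTop (𝓝 (d - α)) := by
        simpa using (hzz.mul_const d).sub hAt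
      have : ∀ᶠ r in atTop, -d ≤ -q r := by
        refine eventually_barrier' (f := fun r => -q r) (hev.mono fun r hr => (hqd r hr).neg) ?_
        filter_upwards [h1.eventually_const_le (u := (d - α) / 2) (by linarith), hbig _ hdε] with
          r a1 a2 hlt
        have e1 : (d - α) / 2 ≤ z r ^ 2 * q r - A r := by nlinarith [sq_nonneg (z r)]
        have e2 : (1 : ℝ) ≤ r * w r ^ 2 * (z r ^ 2 * q r - A r) := by
          calc (1 : ℝ) = 2 / (d - α) * ((d - α) / 2) := by field_simp
            _ ≤ _ := mul_le_mul a2 e1 (by linarith) (le_trans (by positivity) a2)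
        linarith
      filter_upwards [this] with r hr
      have : d < c := by simp only [hd]; linarith
      linarith
  constructor
  · have hlogd : ∀ c : ℝ, ∀ r, r₀ < r →
        HasDerivAt (fun r => Real.log (w r) - c * r ^ 2) (r * (p r * z r - 2 * c)) r := by
      intro c r hr
      have hwr := hwpos r hr
      have h := ((hwd r hr).log hwr.ne').sub (((hasDerivAt_id r).pow 2).const_mul c)
      convert! h using 1
      rw [hvz r hr]
      simp
      field_simp
    have hpz : ∀ c, Tendsto (fun r => p r * z r - 2 * c) atTop (𝓝 (α - 2 * c)) := by
      intro c
      simpa using (hpt.mul hzt).sub_const (2 * c)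
    refine tendsto_order.2 ⟨fun c hc => ?_, fun c hc => ?_⟩
    · set d := (c + α / 2) / 2 with hd
      have hdε : 0 < α - 2 * d := by simp only [hd]; linarith
      have : ∀ᶠ r in atTop, 0 ≤ Real.log (w r) - d * r ^ 2 := by
        refine eventually_barrier' (f := fun r => Real.log (w r) - d * r ^ 2)
          (hev.mono (hlogd d)) ?_
        filter_upwards [(hpz d).eventually_const_le (u := (α - 2 * d) / 2) (by linarith),
          eventually_ge_atTop (2 / (α - 2 * d))] with r a1 a2 _
        calc (1 : ℝ) = 2 / (α - 2 * d) * ((α - 2 * d) / 2) := by field_simp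
          _ ≤ _ := mul_le_mul a2 a1 (by linarith) (le_trans (by positivity) a2)
      filter_upwards [this, hev] with r hr h0
      have hr0 : 0 < r := hr₀.trans h0
      have hcd : c < d := by simp only [hd]; linarith
      rw [lt_div_iff₀ (by positivity)]
      nlinarith [sq_pos_of_pos hr0]
    · set d := (c + α / 2) / 2 with hd
      have hdε : 0 < 2 * d - α := by simp only [hd]; linarith
      have : ∀ᶠ r in atTop, 0 ≤ -(Real.log (w r) - d * r ^ 2) := by
        refine eventually_barrier' (f := fun r => -(Real.log (w r) - d * r ^ 2))
          (hev.mono fun r hr => (hlogd d r hr).neg) ?_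
        filter_upwards [(hpz d).neg.eventually_const_le (u := (2 * d - α) / 2) (by linarith),
          eventually_ge_atTop (2 / (2 * d - α))] with r a1 a2 _
        have : (1 : ℝ) ≤ r * (-(p r * z r - 2 * d)) := by
          calc (1 : ℝ) = 2 / (2 * d - α) * ((2 * d - α) / 2) := by field_simp
            _ ≤ _ := mul_le_mul a2 a1 (by linarith) (le_trans (by positivity) a2)
        linarith
      filter_upwards [this, hev] with r hr h0
      have hr0 : 0 < r := hr₀.trans h0
      have hcd : d < c := by simp only [hd]; linarith
      rw [div_lt_iff₀ (by positivity)]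
      nlinarith [sq_pos_of_pos hr0]
  · refine hqt.neg.congr' ?_
    filter_upwards [hev] with r hr
    have hwr := hwpos r hr
    have hr0 : 0 < r := hr₀.trans hr
    have hψw : ψ (u r) = w r := rfl
    simp only [hq, hψw]
    rw [hvz r hr]
    field_simp
    ring

/-- (Asymptotic behaviour, case `α > 0`.) Let `φ` be smooth on
`(a,∞)` with `φ' > 0`, `φ'' ≥ 0`, `φ''(t) → α > 0` and `φ'(t) - α·t → β`.  If
`r₀ > 0`, `u₀ ∈ (a,∞)`, `0 ≤ u₁` and `φ'(u₀)·r₀ ≥ u₁`, then the problem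
`u'' = (1 + u'²)(φ'(u) - u'/r)`, `u(r₀) = u₀`, `u'(r₀) = u₁` has a unique solution,
defined and strictly convex on all of `[r₀,∞)`, with
`log φ'(u(r))/r² → α/2` and `(φ'(u(r))²/r)(u'(r)/φ'(u(r)) - r) → -α` as `r → ∞`. -/
theorem stmt_16 (a : EReal) (α β : ℝ) (hα : 0 < α) (φ φ' φ'' : ℝ → ℝ)
    (hφsm : ContDiffOn ℝ (⊤ : ℕ∞) φ {t : ℝ | a < (t : EReal)})
    (hφd : ∀ t : ℝ, a < (t : EReal) → HasDerivAt φ (φ' t) t)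
    (hφd2 : ∀ t : ℝ, a < (t : EReal) → HasDerivAt φ' (φ'' t) t)
    (hφ'pos : ∀ t : ℝ, a < (t : EReal) → 0 < φ' t)
    (hφ''nn : ∀ t : ℝ, a < (t : EReal) → 0 ≤ φ'' t)
    -- quadratic growth of `φ`
    (hquad1 : Tendsto φ'' atTop (𝓝 α))
    (hquad2 : Tendsto (fun t : ℝ => φ' t - α * t) atTop (𝓝 β))
    (r₀ : ℝ) (hr₀ : 0 < r₀)
    (u₀ : ℝ) (hu₀ : a < (u₀ : EReal))
    (u₁ : ℝ) (hu₁ : 0 ≤ u₁) (hslope : u₁ ≤ φ' u₀ * r₀) :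
    ∃ u u' : ℝ → ℝ,
      (∀ r ∈ Ici r₀, a < (u r : EReal)) ∧
      u r₀ = u₀ ∧ u' r₀ = u₁ ∧
      (∀ r ∈ Ici r₀, HasDerivWithinAt u (u' r) (Ici r₀) r) ∧
      (∀ r ∈ Ici r₀,
        HasDerivWithinAt u' ((1 + u' r ^ 2) * (φ' (u r) - u' r / r)) (Ici r₀) r) ∧
      -- strict convexity
      StrictConvexOn ℝ (Ici r₀) u ∧
      -- uniqueness
      (∀ v v' : ℝ → ℝ,
        (∀ r ∈ Ici r₀, a < (v r : EReal)) →
        v r₀ = u₀ → v' r₀ = u₁ →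
        (∀ r ∈ Ici r₀, HasDerivWithinAt v (v' r) (Ici r₀) r) →
        (∀ r ∈ Ici r₀,
          HasDerivWithinAt v' ((1 + v' r ^ 2) * (φ' (v r) - v' r / r)) (Ici r₀) r) →
        ∀ r ∈ Ici r₀, v r = u r) ∧
      -- (i) `φ'(u(r)) = e^{α r²/2 + o(r²)}`
      Tendsto (fun r => Real.log (φ' (u r)) / r ^ 2) atTop (𝓝 (α / 2)) ∧
      -- (ii) `u'/φ'(u) = r - α r φ'(u)⁻² + o(r φ'(u)⁻²)`
      Tendsto (fun r => φ' (u r) ^ 2 / r * (u' r / φ' (u r) - r)) atTop (𝓝 (-α)) := by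
  classical
  set S : Set ℝ := {t : ℝ | a < (t : EReal)} with hSdef
  have hSopen : IsOpen S := isOpen_lt continuous_const continuous_coe_real_ereal
  have hSup : ∀ {s t : ℝ}, s ∈ S → s ≤ t → t ∈ S := fun hs hst =>
    lt_of_lt_of_le (show a < _ from hs) (EReal.coe_le_coe_iff.2 hst)
  have hSc : S.OrdConnected := ⟨fun x hx y _ t ht => hSup hx ht.1⟩
  have hIci : Ici u₀ ⊆ S := fun t ht => hSup hu₀ ht
  have hψ : ContDiffOn ℝ 1 φ' S := by
    have h1 : ContDiffOn ℝ 1 (deriv φ) S := hφsm.deriv_of_isOpen hSopen (by norm_cast)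
    exact h1.congr fun t ht => (hφd t ht).deriv.symm
  have hψt : Tendsto φ' atTop atTop := by
    have h1 : Tendsto (fun t : ℝ => α * t) atTop atTop := tendsto_id.const_mul_atTop hα
    have := h1.atTop_add hquad2
    refine this.congr fun t => ?_
    ring
  have hmono : ∀ s t, u₀ ≤ s → s ≤ t → φ' s ≤ φ' t := by
    have : MonotoneOn φ' (Ici u₀) := by
      apply monotoneOn_of_deriv_nonneg (convex_Ici _)
      · exact fun t ht => (hφd2 t (hIci ht)).continuousAt.continuousWithinAt
      · intro t ht
        exact (hφd2 t (hIci (interior_subset ht))).differentiableAt.differentiableWithinAt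
      · intro t ht
        rw [(hφd2 t (hIci (interior_subset ht))).deriv]
        exact hφ''nn t (hIci (interior_subset ht))
    exact fun s t hs hst => this hs (hs.trans hst) hst
  obtain ⟨C, hC, hgrow⟩ : ∃ C : ℝ, 0 < C ∧ ∀ t, u₀ ≤ t → φ' t ≤ C * (1 + t - u₀) := by
    have h1 : ∀ᶠ t in atTop, φ' t - α * t ≤ β + 1 := hquad2.eventually_le_const (by linarith)
    obtain ⟨N, hN⟩ := (h1.and (eventually_ge_atTop u₀)).exists_forall_of_atTop
    have hNpos := hφ'pos N (hIci (hN N le_rfl).2)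
    refine ⟨α + |α * u₀| + |β| + 1 + φ' N, by positivity, fun t ht => ?_⟩
    have b1 := abs_nonneg (α * u₀)
    have b2 := le_abs_self (α * u₀)
    have b3 := le_abs_self β
    have b4 := abs_nonneg β
    have ht' : 0 ≤ t - u₀ := by linarith
    rcases le_total N t with h | h
    · have := (hN t h).1
      nlinarith [mul_nonneg b1 ht', mul_nonneg b4 ht', mul_nonneg hNpos.le ht']
    · have := hmono t N ht h
      nlinarith [mul_nonneg b1 ht', mul_nonneg b4 ht', mul_nonneg hNpos.le ht',
        mul_nonneg hα.le ht']
  have hu₁C : u₁ ≤ C * r₀ := by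
    have := hgrow u₀ le_rfl
    nlinarith
  obtain ⟨P, hP0, hPd, hPu, hPv⟩ := sol_global hψ hSc hr₀ hIci hC
    (fun t ht => hφ'pos t (hIci ht)) hgrow hu₁ hu₁C
  have hdu : ∀ r ∈ Ici r₀, HasDerivWithinAt (fun r => (P r).1) ((P r).2) (Ici r₀) r :=
    fun r hr => (hPd r hr).fst
  have hdv : ∀ r ∈ Ici r₀, HasDerivWithinAt (fun r => (P r).2)
      ((1 + (P r).2 ^ 2) * (φ' (P r).1 - (P r).2 / r)) (Ici r₀) r :=
    fun r hr => (hPd r hr).snd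
  have hdu' : ∀ r, r₀ < r → HasDerivAt (fun r => (P r).1) ((P r).2) r :=
    fun r hr => (hdu r hr.le).hasDerivAt (Ici_mem_nhds hr)
  have hdv' : ∀ r, r₀ < r → HasDerivAt (fun r => (P r).2)
      ((1 + (P r).2 ^ 2) * (φ' (P r).1 - (P r).2 / r)) r :=
    fun r hr => (hdv r hr.le).hasDerivAt (Ici_mem_nhds hr)
  have huc : ContinuousOn (fun r => (P r).1) (Ici r₀) := fun r hr => (hdu r hr).continuousWithinAt
  have hvc : ContinuousOn (fun r => (P r).2) (Ici r₀) := fun r hr => (hdv r hr).continuousWithinAt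
  have hsl : ∀ r, r₀ < r → (P r).2 < r * φ' (P r).1 :=
    slope_pos (u := fun r => (P r).1) (v := fun r => (P r).2) hr₀
      (fun t ht => hφd2 t (hIci ht)) (fun t ht => hφ'pos t (hIci ht))
      (fun t ht => hφ''nn t (hIci ht)) huc hvc hdu' hdv' hPu hPv (by simpa [hP0] using hslope)
  have hvm : StrictMonoOn (fun r => (P r).2) (Ici r₀) := by
    apply strictMonoOn_of_deriv_pos (convex_Ici _) hvc
    intro r hr
    rw [interior_Ici] at hr
    rw [(hdv' r hr).deriv]
    have hr0 : 0 < r := hr₀.trans hr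
    refine mul_pos (by positivity) ?_
    rw [sub_pos, div_lt_iff₀ hr0]
    linarith [hsl r hr]
  have hvpos : ∀ r, r₀ < r → 0 < (P r).2 := by
    intro r hr
    have h1 := hvm (self_mem_Ici) (mem_Ici.2 hr.le) hr
    have h2 := hPv r₀ self_mem_Ici
    exact lt_of_le_of_lt h2 h1
  obtain ⟨has1, has2⟩ := asymp (ψ := φ') (ψ' := φ'') (u := fun r => (P r).1) (v := fun r => (P r).2)
    hr₀ (fun t ht => hφd2 t (hIci ht)) (fun t ht => hφ'pos t (hIci ht))
    (fun t ht => hφ''nn t (hIci ht)) hquad1 hψt hdu' hdv' hPu hvpos hvm hsl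
  refine ⟨fun r => (P r).1, fun r => (P r).2, fun r hr => hIci (hPu r hr), by simp [hP0],
    by simp [hP0], hdu, hdv, ?_, ?_, has1, has2⟩
  · apply StrictMonoOn.strictConvexOn_of_deriv (convex_Ici _) huc
    rw [interior_Ici]
    intro x hx y hy hxy
    rw [(hdu' x hx).deriv, (hdu' y hy).deriv]
    exact hvm (mem_Ici.2 (le_of_lt hx)) (mem_Ici.2 (le_of_lt hy)) hxy
  · intro v v' hvS hv0 hv1 hvd hvd' r hr
    have hq : ∀ s ∈ Icc r₀ r, HasDerivWithinAt (fun s => (v s, v' s))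
        (rotField φ' s (v s, v' s)) (Icc r₀ r) s := fun s hs =>
      ((hvd s hs.1).prodMk (hvd' s hs.1)).mono Icc_subset_Ici_self
    have := sol_unique hψ hSc hr₀ hr hq (fun s hs => (hPd s hs.1).mono Icc_subset_Ici_self)
      (fun s hs => hvS s hs.1) (fun s hs => hIci (hPu s hs.1)) (by simp [hP0, hv0, hv1])
      (right_mem_Icc.2 hr)
    exact congrArg Prod.fst this
end
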